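/- Let P be a simple polytope such that the face ring k[K_P] is minimally non-Golod (over a field k of characteristic zero). Then for any vertex truncation Q = vc(P) (at any vertex of P), the face ring k[K_Q] is also minimally non-Golod. -/

import Mathlib

open Finset Module

/-- An abstract simplicial complex on the vertex type `V`: a collection of
nonempty finite subsets of `V` (the *faces*), closed under passing to
nonempty subsets. -/
structure SimComplex (V : Type*) where
  faces : Set (Finset V)
  not_empty_mem : ∅ ∉ faces
  down_closed : ∀ ⦃s t : Finset V⦄, s ∈ faces → t ⊆ s → t.Nonempty → t ∈ faces

namespace SimComplex

variable {V : Type*}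

/-- The `n`-dimensional faces of `K` (faces with `n + 1` vertices). -/
def Face (K : SimComplex V) (n : ℕ) : Type _ :=
  {s : Finset V // s ∈ K.faces ∧ s.card = n + 1}

/-- The space of simplicial `n`-chains of `K` with coefficients in `𝕜`. -/
abbrev chains (K : SimComplex V) (𝕜 : Type*) [Field 𝕜] (n : ℕ) : Type _ :=
  K.Face n →₀ 𝕜

variable (𝕜 : Type*) [Field 𝕜] [LinearOrder V]

/-- The boundary of a single `(n+1)`-dimensional face, as an alternating sum of its
codimension-one subfaces (signs determined by the linear order on the vertices). -/
noncomputable def faceBoundary (K : SimComplex V) (n : ℕ) (s : K.Face (n + 1)) :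
    K.chains 𝕜 n :=
  ∑ a ∈ s.1.attach, ((-1 : 𝕜) ^ (s.1.filter (fun b => b < a.1)).card) •
    Finsupp.single
      ⟨s.1.erase a.1,
        K.down_closed s.2.1 (Finset.erase_subset _ _)
          (Finset.card_pos.mp (by rw [Finset.card_erase_of_mem a.2, s.2.2]; omega)),
        by rw [Finset.card_erase_of_mem a.2, s.2.2]; omega⟩ (1 : 𝕜)

/-- The simplicial boundary operator `∂ : C_{n+1}(K) → C_n(K)`. -/
noncomputable def boundary (K : SimComplex V) (n : ℕ) :
    K.chains 𝕜 (n + 1) →ₗ[𝕜] K.chains 𝕜 n :=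
  Finsupp.lsum 𝕜 fun s => LinearMap.toSpanSingleton 𝕜 _ (K.faceBoundary 𝕜 n s)

/-- The augmentation `C_0(K) → 𝕜` sending every vertex to `1`. -/
noncomputable def augmentation (K : SimComplex V) : K.chains 𝕜 0 →ₗ[𝕜] 𝕜 :=
  Finsupp.lsum 𝕜 fun _ => LinearMap.id

/-- The reduced cycles in degree `n`. -/
noncomputable def cycles (K : SimComplex V) : (n : ℕ) → Submodule 𝕜 (K.chains 𝕜 n)
  | 0 => LinearMap.ker (K.augmentation 𝕜)
  | (n + 1) => LinearMap.ker (K.boundary 𝕜 n)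

/-- The dimension of the reduced simplicial homology `H̃_n(K; 𝕜)` in degree `n ≥ 0`
(over the field `𝕜`, this also equals the dimension of reduced cohomology). -/
noncomputable def hdimNat (K : SimComplex V) (n : ℕ) : ℕ :=
  finrank 𝕜 ↥(K.cycles 𝕜 n) -
    finrank 𝕜 ↥(LinearMap.range (K.boundary 𝕜 n) ⊓ K.cycles 𝕜 n)

/-- The dimension of reduced simplicial (co)homology `H̃_i(K; 𝕜)` for `i : ℤ`;
in degree `-1` it is `1` precisely for the empty complex. -/
noncomputable def hdim (K : SimComplex V) (i : ℤ) : ℕ :=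
  letI := Classical.dec (K.faces = ∅)
  if i = -1 then (if K.faces = ∅ then 1 else 0)
  else if 0 ≤ i then K.hdimNat 𝕜 i.toNat else 0

/-- The full subcomplex of `K` on a vertex subset `J`. -/
def restrict (K : SimComplex V) (J : Finset V) : SimComplex V where
  faces := {s | s ∈ K.faces ∧ s ⊆ J}
  not_empty_mem := fun h => K.not_empty_mem h.1
  down_closed := fun _ _ hs hts ht => ⟨K.down_closed hs.1 hts ht, hts.trans hs.2⟩

/-- The bigraded Betti numbers `β^{-i,2j}(𝕜[K]) = dim 𝕜Tor^{-i,2j}_{𝕜[v₁,…,v_m]}(𝕜[K],𝕜)`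
of the Stanley–Reisner ring of `K`, expressed through Hochster's formula:
`β^{-i,2j}(K) = ∑_{J ⊆ [m], |J| = j} dim H̃^{j-i-1}(K_J; 𝕜)`. -/
noncomputable def bbetti (K : SimComplex V) [Fintype V] (i j : ℕ) : ℕ :=
  ∑ J ∈ Finset.powersetCard j (Finset.univ : Finset V),
    (K.restrict J).hdim 𝕜 ((j : ℤ) - i - 1)

/-- Bigraded Betti numbers with integer (possibly out-of-range) indices:
`Tor^{-i,2j}` vanishes unless `i, j ≥ 0`. -/
noncomputable def bbettiZ (K : SimComplex V) [Fintype V] (i j : ℤ) : ℕ :=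
  if 0 ≤ i ∧ 0 ≤ j then K.bbetti 𝕜 i.toNat j.toNat else 0

/-- `F` is a facet (maximal face) of `K`. -/
def IsFacet (K : SimComplex V) (F : Finset V) : Prop :=
  F ∈ K.faces ∧ ∀ s ∈ K.faces, F ⊆ s → s = F

end SimComplex
namespace SimComplex

/-- The boundary complex `∂Δ^{n 0} * ⋯ * ∂Δ^{n (r-1)}` of the simplicial polytope dual to
the product of simplices `Δ^{n 0} × ⋯ × Δ^{n (r-1)}`: a subset is a face iff it is nonempty
and misses at least one vertex from every join factor. -/
def prodSimplicesDual (r : ℕ) (n : Fin r → ℕ) :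
    SimComplex (Σ p : Fin r, Fin (n p + 1)) where
  faces := {s | s.Nonempty ∧
    ∀ p : Fin r, ∃ q : Fin (n p + 1), (⟨p, q⟩ : Σ p : Fin r, Fin (n p + 1)) ∉ s}
  not_empty_mem := fun h => Finset.not_nonempty_empty h.1
  down_closed := fun _ _ hs hts ht =>
    ⟨ht, fun p => (hs.2 p).imp fun _ hq hmem => hq (hts hmem)⟩

/-- The stellar subdivision of the simplicial complex `K` at the face `F`, with a new
apex vertex `none`: faces of `K` not containing `F` survive, and cones (with apex `none`)
over proper subsets of `F` are added.  When `F` is a facet of `K`, this is the complex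
obtained by replacing the facet `F` with the cone over its boundary, i.e. the operation
dual to cutting a vertex of a simple polytope. -/
def stellar (K : SimComplex V) (F : Finset V) : SimComplex (Option V) where
  faces := {s | s.Nonempty ∧
    ((none ∉ s ∧ Finset.eraseNone s ∈ K.faces ∧ ¬ F ⊆ Finset.eraseNone s) ∨
     (none ∈ s ∧ Finset.eraseNone s ⊂ F ∧
        (Finset.eraseNone s ∈ K.faces ∨ Finset.eraseNone s = ∅)))}
  not_empty_mem := fun h => Finset.not_nonempty_empty h.1
  down_closed := by
    rintro s t ⟨hsne, hs⟩ hts htne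
    refine ⟨htne, ?_⟩
    have hsub : Finset.eraseNone t ⊆ Finset.eraseNone s := by
      intro a ha
      rw [Finset.mem_eraseNone] at ha ⊢
      exact hts ha
    rcases hs with ⟨hn, hf, hF⟩ | ⟨hn, hF, hf⟩
    · left
      have hnt : none ∉ t := fun h => hn (hts h)
      have htne' : (Finset.eraseNone t).Nonempty := by
        obtain ⟨x, hx⟩ := htne
        match x with
        | none => exact absurd hx hnt
        | some a => exact ⟨a, Finset.mem_eraseNone.mpr hx⟩
      exact ⟨hnt, K.down_closed hf hsub htne',
        fun h => hF (h.trans hsub)⟩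
    · have hKs : (Finset.eraseNone t).Nonempty → Finset.eraseNone t ∈ K.faces := by
        intro htne'
        have hsne' : (Finset.eraseNone s).Nonempty := htne'.mono hsub
        rcases hf with hf | hf
        · exact K.down_closed hf hsub htne'
        · rw [hf] at hsub
          exact absurd (Finset.subset_empty.mp hsub) htne'.ne_empty
      by_cases hnt : none ∈ t
      · right
        refine ⟨hnt, lt_of_le_of_lt hsub hF, ?_⟩
        rcases Finset.eq_empty_or_nonempty (Finset.eraseNone t) with h | h
        · exact Or.inr h
        · exact Or.inl (hKs h)
      · left
        have htne' : (Finset.eraseNone t).Nonempty := by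
          obtain ⟨x, hx⟩ := htne
          match x with
          | none => exact absurd hx hnt
          | some a => exact ⟨a, Finset.mem_eraseNone.mpr hx⟩
        refine ⟨hnt, hKs htne', fun h => ?_⟩
        exact (lt_of_le_of_lt (h.trans hsub) hF).ne rfl

/-- An isomorphism of simplicial complexes: a bijection of vertex types carrying
faces exactly to faces. -/
def Iso {W : Type*} (K : SimComplex V) (L : SimComplex W) : Prop :=
  ∃ e : V ≃ W, ∀ s : Finset V, s ∈ K.faces ↔ s.map e.toEmbedding ∈ L.faces

end SimComplex

open SimComplex in
/-- `K` is (isomorphic to) the boundary complex `K_P` of a generalized truncation polytope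
`P = vc^k(Δ^{n 0} × ⋯ × Δ^{n (r-1)})` of type `(k; n)`, i.e. it is obtained from
`∂Δ^{n 0} * ⋯ * ∂Δ^{n (r-1)}` by `k` successive stellar subdivisions of facets
(the operation dual to cutting a vertex of a simple polytope). -/
def IsGenTruncCx (r : ℕ) (n : Fin r → ℕ) : ℕ → (V : Type) → SimComplex V → Prop
  | 0, _, K => Iso (prodSimplicesDual r n) K
  | (k + 1), _, K => ∃ (W : Type) (L : SimComplex W) (F : Finset W),
      IsGenTruncCx r n k W L ∧ L.IsFacet F ∧ Iso (stellar L F) K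
/-- `s` is the vertex set of a (proper or improper) face of the polytope
`conv {vert v | v}`: some linear functional attains its maximum over the vertices
exactly on `s`. -/
def IsFaceOf {V : Type*} {d : ℕ} (vert : V → EuclideanSpace ℝ (Fin d))
    (s : Finset V) : Prop :=
  ∃ (f : EuclideanSpace ℝ (Fin d) →ₗ[ℝ] ℝ) (c : ℝ),
    (∀ v ∈ s, f (vert v) = c) ∧ ∀ v ∉ s, f (vert v) < c

/-- A simplicial `d`-dimensional convex polytope with vertex set indexed by `V`:
a full-dimensional configuration of points, each of which is a vertex, all of whose
proper faces are simplices. -/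
structure SimplicialPolytope (d : ℕ) (V : Type*) [Fintype V] where
  vert : V → EuclideanSpace ℝ (Fin d)
  full_dim : affineSpan ℝ (Set.range vert) = ⊤
  is_vertex : ∀ v : V, IsFaceOf vert {v}
  simplicial : ∀ s : Finset V, s ≠ Finset.univ → IsFaceOf vert s →
    AffineIndependent ℝ (fun v : s => vert v)

/-- The boundary complex of a simplicial polytope: the simplicial complex (a simplicial
`(d-1)`-sphere) whose faces are the nonempty vertex sets of proper faces of the polytope,
together with all their nonempty subsets. -/
def SimplicialPolytope.boundaryComplex {d : ℕ} {V : Type*} [Fintype V]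
    (P : SimplicialPolytope d V) : SimComplex V where
  faces := {s | s.Nonempty ∧ ∃ t : Finset V, t ≠ Finset.univ ∧ IsFaceOf P.vert t ∧ s ⊆ t}
  not_empty_mem := fun h => Finset.not_nonempty_empty h.1
  down_closed := fun _ _ hs hts ht =>
    ⟨ht, hs.2.imp fun _ h => ⟨h.1, h.2.1, hts.trans h.2.2⟩⟩

/-- A linear order on `Option V` (used to fix orientations of the simplices of a stellar
subdivision, whose new apex vertex is `none`). -/
noncomputable instance Option.instLinearOrderOfLinearOrder (V : Type*) [LinearOrder V] :
    LinearOrder (Option V) :=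
  inferInstanceAs (LinearOrder (WithBot V))
open scoped TensorProduct

namespace SimComplex

variable {V : Type} [Fintype V]

/-- The vertices of `K`, as a type. -/
abbrev VertexType (K : SimComplex V) : Type := {v : V // {v} ∈ K.faces}

noncomputable instance (K : SimComplex V) : Fintype K.VertexType :=
  Fintype.ofFinite _

variable (𝕜 : Type) [Field 𝕜]

/-- The Stanley–Reisner ideal of `K`: the ideal of the polynomial ring on the vertices
of `K` generated by the squarefree monomials corresponding to the non-faces of `K`. -/
noncomputable def faceIdeal (K : SimComplex V) : Ideal (MvPolynomial K.VertexType 𝕜) :=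
  Ideal.span ((fun s : Finset K.VertexType => ∏ i ∈ s, MvPolynomial.X i) ''
    {s : Finset K.VertexType |
      s.Nonempty ∧ s.map (Function.Embedding.subtype _) ∉ K.faces})

/-- The Stanley–Reisner ring (face ring) `𝕜[K]` of the simplicial complex `K`. -/
abbrev FaceRing (K : SimComplex V) : Type :=
  MvPolynomial K.VertexType 𝕜 ⧸ K.faceIdeal 𝕜

/-- The Koszul complex `Λ[u_1, …, u_m] ⊗ 𝕜[K]` of the face ring, whose homology is
`Tor_{𝕜[v_1,…,v_m]}(𝕜[K], 𝕜)`, as a `𝕜`-algebra.  (Since `𝕜[K]` sits in even degrees,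
the multiplication carries no Koszul signs.) -/
abbrev KoszulCx (K : SimComplex V) : Type :=
  ExteriorAlgebra 𝕜 (K.VertexType → 𝕜) ⊗[𝕜] K.FaceRing 𝕜

/-- The Koszul differential on `Λ[u_1, …, u_m] ⊗ 𝕜[K]`, determined by
`d(u_i) = v_i`, `d(v_i) = 0` and the graded Leibniz rule: the sum over the vertices `i`
of (contraction against the `i`-th coordinate) ⊗ (multiplication by `v_i`). -/
noncomputable def koszulD (K : SimComplex V) : K.KoszulCx 𝕜 →ₗ[𝕜] K.KoszulCx 𝕜 :=
  ∑ i : K.VertexType,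
    TensorProduct.map
      (CliffordAlgebra.contractLeft
        (Q := (0 : QuadraticForm 𝕜 (K.VertexType → 𝕜))) (LinearMap.proj i))
      (LinearMap.mulLeft 𝕜 (Ideal.Quotient.mk (K.faceIdeal 𝕜) (MvPolynomial.X i)))

/-- The augmentation `Λ[u_1, …, u_m] ⊗ 𝕜[K] → 𝕜`, killing all `u_i` and `v_i`. -/
noncomputable def koszulAug (K : SimComplex V) : K.KoszulCx 𝕜 →ₐ[𝕜] 𝕜 :=
  Algebra.TensorProduct.lift
    (CliffordAlgebra.lift _ ⟨0, fun m => by simp⟩)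
    (Ideal.Quotient.liftₐ (K.faceIdeal 𝕜) (MvPolynomial.aeval fun _ => (0 : 𝕜))
      (by
        intro a ha
        refine Submodule.span_induction ?_ ?_ ?_ ?_ ha
        · rintro x ⟨s, ⟨hne, -⟩, rfl⟩
          simp only [map_prod, MvPolynomial.aeval_X]
          exact Finset.prod_eq_zero hne.choose_spec rfl
        · exact map_zero _
        · intro x y _ _ hx hy
          rw [map_add, hx, hy, add_zero]
        · intro c x _ hx
          rw [smul_eq_mul, map_mul, hx, mul_zero]))
    (fun x y => Commute.all _ _)

/-- The sign operator `x ↦ x̄ = (-1)^{1+deg x}·x` on the Koszul complex: the negative of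
the grade involution (v's have even degree, so only the exterior degree matters). -/
noncomputable def koszulBar (K : SimComplex V) : K.KoszulCx 𝕜 →ₗ[𝕜] K.KoszulCx 𝕜 :=
  - TensorProduct.map
      (CliffordAlgebra.involute
        (Q := (0 : QuadraticForm 𝕜 (K.VertexType → 𝕜)))).toLinearMap
      (LinearMap.id : K.FaceRing 𝕜 →ₗ[𝕜] K.FaceRing 𝕜)

/-- **Golodness** of the face ring `𝕜[K]` (equivalently, of `K`): the multiplication and
all higher Massey operations in `Tor_{𝕜[v_1,…,v_m]}(𝕜[K], 𝕜)` are trivial.  Following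
the standard formulation, this says that the Koszul complex of `𝕜[K]` admits a *trivial
Massey operation*: there are a set `Z` of cycles of positive degree representing all of
the positive-degree homology (= `Tor₊`), and a function `μ` on nonempty words in `Z`,
extending the identity on letters, with values in the augmentation ideal, such that
`d μ(z_1, …, z_p) = ∑_{j=1}^{p-1} \overline{μ(z_1,…,z_j)}·μ(z_{j+1},…,z_p)`.
(In particular all products of positive-degree homology classes vanish.) -/
def IsGolod (K : SimComplex V) : Prop :=
  ∃ (Z : Set (K.KoszulCx 𝕜)) (μ : List (K.KoszulCx 𝕜) → K.KoszulCx 𝕜),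
    (∀ z ∈ Z, K.koszulD 𝕜 z = 0 ∧ K.koszulAug 𝕜 z = 0) ∧
    (∀ x : K.KoszulCx 𝕜, K.koszulD 𝕜 x = 0 → K.koszulAug 𝕜 x = 0 →
      x ∈ Submodule.span 𝕜 Z ⊔ LinearMap.range (K.koszulD 𝕜)) ∧
    (∀ z ∈ Z, μ [z] = z) ∧
    (∀ l : List (K.KoszulCx 𝕜), 2 ≤ l.length → (∀ z ∈ l, z ∈ Z) →
      K.koszulAug 𝕜 (μ l) = 0 ∧
      K.koszulD 𝕜 (μ l) =
        ∑ j ∈ Finset.Ioo 0 l.length,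
          K.koszulBar 𝕜 (μ (l.take j)) * μ (l.drop j))

/-- The deletion `K - v` of a vertex from `K`: the full subcomplex on the remaining
vertices. -/
noncomputable def deleteVertex (K : SimComplex V) (v : V) : SimComplex V :=
  letI := Classical.decEq V
  K.restrict (Finset.univ.erase v)

/-- **Minimal non-Golodness**: `K` is not Golod, but deleting any vertex `v` from `K`
turns the full subcomplex `K - v` into a Golod one. -/
def IsMinimallyNonGolod (K : SimComplex V) : Prop :=
  ¬ K.IsGolod 𝕜 ∧ ∀ v : V, {v} ∈ K.faces → (K.deleteVertex v).IsGolod 𝕜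

end SimComplex

open Finset Module
open scoped TensorProduct
structure DGA (κ : Type) [Field κ] (A : Type) [Ring A] [Algebra κ A] where
  d : A →ₗ[κ] A
  inv : A →ₐ[κ] A
  d_d : ∀ x, d (d x) = 0
  leib : ∀ x y, d (x * y) = d x * y + inv x * d y
  inv_inv : ∀ x, inv (inv x) = x
  d_inv : ∀ x, d (inv x) = - inv (d x)
namespace DGA
variable {κ : Type} [Field κ] {A : Type} [Ring A] [Algebra κ A] (D : DGA κ A)
def obs (a : ℕ → ℕ → A) (i j : ℕ) : A := ∑ k ∈ Ioo i j, -(D.inv (a i k)) * a k j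
def Sys (P : Submodule κ A) (a : ℕ → ℕ → A) (i j : ℕ) : Prop :=
  a i j ∈ P ∧ D.d (a i j) = D.obs a i j
def Dec (P : Submodule κ A) (x : A) : Prop :=
  ∃ (p : ℕ) (a : ℕ → ℕ → A),
    (∀ i j, i < j → j ≤ p → ¬ (i = 0 ∧ j = p) → D.Sys P a i j) ∧ x = D.obs a 0 p
def S (P : Submodule κ A) : Prop := ∀ x, D.Dec P x → ∃ y ∈ P, D.d y = x
def G (P : Submodule κ A) : Prop :=
  ∃ (Z : Set A) (μ : List A → A),
    (∀ z ∈ Z, z ∈ P ∧ D.d z = 0) ∧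
    (∀ x ∈ P, D.d x = 0 → x ∈ Submodule.span κ Z ⊔ LinearMap.range D.d) ∧
    (∀ z ∈ Z, μ [z] = z) ∧
    (∀ l : List A, l ≠ [] → (∀ z ∈ l, z ∈ Z) → μ l ∈ P ∧
      D.d (μ l) = ∑ j ∈ Ioo 0 l.length, -(D.inv (μ (l.take j))) * μ (l.drop j))
theorem sum_Ioo_swap {M : Type*} [AddCommMonoid M] (i j : ℕ) (f : ℕ → ℕ → M) :
    ∑ k ∈ Ioo i j, ∑ l ∈ Ioo i k, f l k = ∑ l ∈ Ioo i j, ∑ k ∈ Ioo l j, f l k := by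
  apply Finset.sum_comm'
  intro x y
  simp only [mem_Ioo]
  omega
theorem obs_congr {a b : ℕ → ℕ → A} {i j : ℕ} (h : ∀ k ∈ Ioo i j, a i k = b i k ∧ a k j = b k j) :
    D.obs a i j = D.obs b i j :=
  Finset.sum_congr rfl fun k hk => by rw [(h k hk).1, (h k hk).2]
theorem d_obs (a : ℕ → ℕ → A) (i j : ℕ)
    (h : ∀ k ∈ Ioo i j, D.d (a i k) = D.obs a i k ∧ D.d (a k j) = D.obs a k j) :
    D.d (D.obs a i j) = 0 := by
  have e : ∀ k ∈ Ioo i j, D.d (-(D.inv (a i k)) * a k j) =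
      - ∑ l ∈ Ioo i k, a i l * D.inv (a l k) * a k j
      + ∑ l ∈ Ioo k j, a i k * D.inv (a k l) * a l j := by
    intro k hk
    rw [D.leib, (h k hk).2, map_neg, map_neg, D.d_inv, (h k hk).1, D.inv_inv]
    simp only [obs, map_sum, map_mul, map_neg, D.inv_inv, sum_mul, mul_sum, neg_mul, mul_neg,
      sum_neg_distrib, neg_neg, mul_assoc]
  rw [obs, map_sum, Finset.sum_congr rfl e, Finset.sum_add_distrib, Finset.sum_neg_distrib,
    sum_Ioo_swap i j (fun l k => a i l * D.inv (a l k) * a k j)]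
  simp
theorem Dec.cycle {D : DGA κ A} {P : Submodule κ A} {x : A} (h : D.Dec P x) : D.d x = 0 := by
  obtain ⟨p, a, h, rfl⟩ := h
  apply D.d_obs
  intro k hk
  rw [mem_Ioo] at hk
  exact ⟨(h 0 k (by omega) (by omega) (by omega)).2, (h k p (by omega) (by omega) (by omega)).2⟩
theorem Dec.mem {D : DGA κ A} {P P2 : Submodule κ A} {x : A} (h : D.Dec P x)
    (hinv : ∀ x ∈ P, D.inv x ∈ P) (h2 : ∀ x ∈ P, ∀ y ∈ P, x * y ∈ P2) : x ∈ P2 := by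
  obtain ⟨p, a, h, rfl⟩ := h
  refine Submodule.sum_mem _ fun k hk => ?_
  rw [mem_Ioo] at hk
  exact h2 _ (neg_mem (hinv _ (h 0 k (by omega) (by omega) (by omega)).1)) _
    (h k p (by omega) (by omega) (by omega)).1
theorem Dec.map {D : DGA κ A} {P : Submodule κ A} {x : A} (h : D.Dec P x)
    {B : Type} [Ring B] [Algebra κ B] {D' : DGA κ B} {P' : Submodule κ B} (f : A →ₐ[κ] B)
    (hd : ∀ x, f (D.d x) = D'.d (f x)) (hi : ∀ x, f (D.inv x) = D'.inv (f x))
    (hP : ∀ x ∈ P, f x ∈ P') : D'.Dec P' (f x) := by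
  obtain ⟨p, a, h, rfl⟩ := h
  have e : ∀ i j, f (D.obs a i j) = D'.obs (fun i j => f (a i j)) i j := by
    intro i j
    simp [obs, hi]
  refine ⟨p, fun i j => f (a i j), fun i j h1 h2 h3 => ⟨hP _ (h i j h1 h2 h3).1, ?_⟩, e 0 p⟩
  rw [← hd, (h i j h1 h2 h3).2, e]
theorem exists_rec {X Y : Type*} [Nonempty Y] (R : (List X → Y) → List X → Y → Prop)
    (hc : ∀ f g l y, (∀ l', l'.length < l.length → f l' = g l') → R f l y → R g l y)
    (Good : List X → Prop)
    (hs : ∀ f l, Good l → (∀ l', l'.length < l.length → Good l' → R f l' (f l')) → ∃ y, R f l y) :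
    ∃ μ : List X → Y, ∀ l, Good l → R μ l (μ l) := by
  classical
  let _ : Inhabited Y := Classical.inhabited_of_nonempty inferInstance
  let wf : WellFounded (fun a b : List X => a.length < b.length) :=
    (measure List.length).wf
  let F : ∀ l : List X, (∀ l' : List X, l'.length < l.length → Y) → Y := fun l ih =>
    let f : List X → Y := fun l' => if h : l'.length < l.length then ih l' h else default
    if h : ∃ y, R f l y then h.choose else default
  let μ : List X → Y := fun l => wf.fix (C := fun _ => Y) F l
  have hμ : ∀ l, μ l = F l (fun l' _ => μ l') := fun l => wf.fix_eq F l
  refine ⟨μ, ?_⟩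
  intro l
  induction hn : l.length using Nat.strong_induction_on generalizing l with
  | _ n ih =>
  intro hl
  subst hn
  let f : List X → Y := fun l' => if h : l'.length < l.length then μ l' else default
  have hf : ∀ l', l'.length < l.length → μ l' = f l' := fun l' h => by simp [f, h]
  have hex : ∃ y, R f l y := by
    obtain ⟨y, hy⟩ := hs μ l hl (fun l' h1 h2 => ih _ h1 l' rfl h2)
    exact ⟨y, hc _ _ _ _ hf hy⟩
  have : μ l = hex.choose := by
    rw [hμ]
    exact dif_pos hex
  rw [this]
  exact hc _ _ _ _ (fun l' h => (hf l' h).symm) hex.choose_spec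
def WordEq (μ : List A → A) (l : List A) (y : A) : Prop :=
  D.d y = ∑ j ∈ Ioo 0 l.length, -(D.inv (μ (l.take j))) * μ (l.drop j)
theorem WordEq_congr {f g : List A → A} {l : List A} {y : A}
    (h : ∀ l', l'.length < l.length → f l' = g l') (hf : D.WordEq f l y) : D.WordEq g l y := by
  rw [WordEq, hf]
  apply Finset.sum_congr rfl
  intro j hj
  rw [mem_Ioo] at hj
  rw [h, h]
  · simp; omega
  · simp; omega
/-- the obstruction of a word is a `Dec` element -/
theorem word_sys (P : Submodule κ A) (μ : List A → A) (l : List A)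
    (h : ∀ l', l'.length < l.length → l' ≠ [] → (∀ z ∈ l', z ∈ l) →
      μ l' ∈ P ∧ D.WordEq μ l' (μ l')) :
    D.Dec P (∑ j ∈ Ioo 0 l.length, -(D.inv (μ (l.take j))) * μ (l.drop j)) := by
  refine ⟨l.length, fun i j => μ ((l.take j).drop i), ?_, ?_⟩
  · intro i j hij hj hne
    obtain ⟨h1, h2⟩ := h ((l.take j).drop i) (by simp; omega) (by
      rw [Ne, ← List.length_eq_zero_iff]; simp; omega) (fun z hz =>
        List.mem_of_mem_take (List.mem_of_mem_drop hz))
    refine ⟨h1, ?_⟩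
    rw [h2, obs]
    have : (Ioo i j : Finset ℕ) = (Ioo 0 (j - i)).map (addLeftEmbedding i) := by
      ext k
      simp only [mem_Ioo, mem_map, addLeftEmbedding_apply]
      constructor
      · intro hk; exact ⟨k - i, by omega, by omega⟩
      · rintro ⟨k, hk, rfl⟩; omega
    rw [this, Finset.sum_map]
    have hl : ((l.take j).drop i).length = j - i := by simp; omega
    rw [hl]
    apply Finset.sum_congr rfl
    intro k hk
    rw [mem_Ioo] at hk
    simp only [addLeftEmbedding_apply]
    have e1 : ((l.take j).drop i).take k = (l.take (i + k)).drop i := by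
      rw [List.take_drop, List.take_take, min_eq_left (by omega)]
    have e2 : ((l.take j).drop i).drop k = (l.take j).drop (i + k) := by
      rw [List.drop_drop]
    rw [e1, e2]
  · rw [obs]
    apply Finset.sum_congr rfl
    intro k hk
    simp
theorem G_of_S (P : Submodule κ A) (h : D.S P) : D.G P := by
  let Z : Set A := {z | z ∈ P ∧ D.d z = 0}
  obtain ⟨μ, hμ⟩ := exists_rec (X := A) (Y := A)
    (fun f l y => y ∈ P ∧ D.WordEq f l y ∧ ∀ z, l = [z] → y = z)
    (fun f g l y h1 h2 => ⟨h2.1, D.WordEq_congr h1 h2.2.1, h2.2.2⟩)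
    (fun l => l ≠ [] ∧ ∀ z ∈ l, z ∈ Z) (by
      rintro f l ⟨hl, hZ⟩ ih
      by_cases h1 : ∃ z, l = [z]
      · obtain ⟨z, rfl⟩ := h1
        have := hZ z (by simp)
        refine ⟨z, this.1, ?_, ?_⟩
        · rw [WordEq, this.2]; exact (Finset.sum_empty).symm
        · rintro w hw; simpa using hw
      · push Not at h1
        obtain ⟨y, hy, hy2⟩ := h _ (D.word_sys P f l fun l' a b c =>
          let t := ih l' a ⟨b, fun z hz => hZ z (c z hz)⟩
          ⟨t.1, t.2.1⟩)
        exact ⟨y, hy, hy2, fun z hz => absurd hz (h1 z)⟩)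
  refine ⟨Z, μ, fun z hz => hz, fun x hx hdx => ?_, fun z hz => ?_, fun l hl hZ => ?_⟩
  · exact Submodule.mem_sup_left (Submodule.subset_span ⟨hx, hdx⟩)
  · exact (hμ [z] ⟨by simp, by simpa using hz⟩).2.2 z rfl
  · exact ⟨(hμ l ⟨hl, hZ⟩).1, (hμ l ⟨hl, hZ⟩).2.1⟩
end DGA
set_option linter.unusedSectionVars false
namespace DGA
variable {κ : Type} [Field κ] {A : Type} [Ring A] [Algebra κ A] (D : DGA κ A)
section gauge
variable (κ A)
abbrev TT := List A →₀ κ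
noncomputable def dc : TT κ A →ₗ[κ] TT κ A ⊗[κ] TT κ A :=
  Finsupp.linearCombination κ (fun l => ∑ j ∈ Ioo 0 l.length,
    (Finsupp.single (l.take j) (1:κ)) ⊗ₜ[κ] (Finsupp.single (l.drop j) (1:κ)))
noncomputable def cns (z : A) : TT κ A →ₗ[κ] TT κ A := Finsupp.lmapDomain κ κ (List.cons z)
noncomputable def LL : (A →₀ κ) →ₗ[κ] (TT κ A →ₗ[κ] TT κ A) :=
  Finsupp.linearCombination κ (cns κ A)
noncomputable def ltr : (A →₀ κ) →ₗ[κ] TT κ A := Finsupp.lmapDomain κ κ (fun z => [z])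
variable {A}
noncomputable def GS (Z : Set A) : Submodule κ (TT κ A) :=
  Submodule.span κ ((fun l => Finsupp.single l (1:κ)) '' {l | l ≠ [] ∧ ∀ z ∈ l, z ∈ Z})
variable {κ}
theorem dc_cns (z : A) (l : List A) (hl : l ≠ []) :
    dc κ A (cns κ A z (Finsupp.single l 1)) = Finsupp.single [z] 1 ⊗ₜ Finsupp.single l 1 +
      (cns κ A z).rTensor _ (dc κ A (Finsupp.single l 1)) := by
  have hl0 : 0 < l.length := List.length_pos_iff.mpr hl
  have : (Ioo 0 (l.length + 1) : Finset ℕ) =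
      insert 1 ((Ioo 0 l.length).map (addRightEmbedding 1)) := by
    ext k
    simp only [mem_Ioo, mem_insert, mem_map, addRightEmbedding_apply]
    constructor
    · intro hk
      by_cases h : k = 1
      · exact Or.inl h
      · exact Or.inr ⟨k - 1, by omega, by omega⟩
    · rintro (rfl | ⟨k, hk, rfl⟩) <;> omega
  simp only [dc, cns, Finsupp.lmapDomain_apply, Finsupp.mapDomain_single,
    Finsupp.linearCombination_single, one_smul, List.length_cons, map_sum, this]
  rw [Finset.sum_insert (by simp), Finset.sum_map]
  simp
theorem dc_LL (Z : Set A) (c : A →₀ κ) (t : TT κ A) (ht : t ∈ GS κ Z) :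
    dc κ A (LL κ A c t) = ltr κ A c ⊗ₜ t + (LL κ A c).rTensor _ (dc κ A t) := by
  induction c using Finsupp.induction_linear with
  | zero => simp
  | add f g hf hg =>
    simp only [map_add, LinearMap.add_apply, hf, hg, TensorProduct.add_tmul, LinearMap.rTensor_add]
    abel
  | single z r =>
    induction ht using Submodule.span_induction with
    | mem x hx =>
      obtain ⟨l, ⟨hl, -⟩, rfl⟩ := hx
      have := dc_cns (κ := κ) z l hl
      simp only [LL, ltr, Finsupp.linearCombination_single, LinearMap.smul_apply, map_smul, this,
        LinearMap.rTensor_smul, smul_add, Finsupp.lmapDomain_apply, Finsupp.mapDomain_single]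
      rw [TensorProduct.smul_tmul', Finsupp.smul_single, smul_eq_mul, mul_one]
    | zero => simp
    | add x y _ _ hx hy => simp only [map_add, hx, hy, TensorProduct.tmul_add]; abel
    | smul a x _ hx => simp only [map_smul, hx, TensorProduct.tmul_smul, smul_add]
theorem LL_mem (Z : Set A) (c : A →₀ κ) (hc : c ∈ Finsupp.supported κ κ Z) (t : TT κ A)
    (ht : t ∈ GS κ Z) : LL κ A c t ∈ GS κ Z := by
  rw [Finsupp.supported_eq_span_single] at hc
  induction hc using Submodule.span_induction with
  | mem x hx =>
    obtain ⟨z, hz, rfl⟩ := hx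
    induction ht using Submodule.span_induction with
    | mem x hx =>
      obtain ⟨l, ⟨hl, hl2⟩, rfl⟩ := hx
      apply Submodule.subset_span
      refine ⟨z :: l, ⟨by simp, ?_⟩, ?_⟩
      · simpa using ⟨hz, hl2⟩
      · simp [LL, cns, Finsupp.mapDomain_single]
    | zero => simp
    | add x y _ _ hx hy => simpa using add_mem hx hy
    | smul a x _ hx => simpa using Submodule.smul_mem _ a hx
  | zero => simp
  | add x y _ _ hx hy => simpa using add_mem hx hy
  | smul a x _ hx => simpa using Submodule.smul_mem _ a hx
theorem ltr_mem (Z : Set A) (c : A →₀ κ) (hc : c ∈ Finsupp.supported κ κ Z) :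
    ltr κ A c ∈ GS κ Z := by
  rw [Finsupp.supported_eq_span_single] at hc
  induction hc using Submodule.span_induction with
  | mem x hx =>
    obtain ⟨z, hz, rfl⟩ := hx
    apply Submodule.subset_span
    exact ⟨[z], ⟨by simp, by simpa using hz⟩, by simp [ltr, Finsupp.mapDomain_single]⟩
  | zero => simp
  | add x y _ _ hx hy => simpa using add_mem hx hy
  | smul a x _ hx => simpa using Submodule.smul_mem _ a hx
theorem dc_ltr (c : A →₀ κ) : dc κ A (ltr κ A c) = 0 := by
  induction c using Finsupp.induction_linear with
  | zero => simp
  | add f g hf hg => simp [hf, hg]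
  | single z r =>
    simp only [dc, ltr, Finsupp.lmapDomain_apply, Finsupp.mapDomain_single,
      Finsupp.linearCombination_single]
    rw [show (Ioo 0 [z].length : Finset ℕ) = ∅ from rfl]
    simp
/-- chain elements -/
theorem dc_chain (Z : Set A) (c : ℕ → ℕ → (A →₀ κ)) (m : ℕ → ℕ → TT κ A) (q p n : ℕ)
    (h : ∀ i j, q ≤ i → i < j → j ≤ p → j - i ≤ n → c i j ∈ Finsupp.supported κ κ Z ∧
      m i j = ltr κ A (c i j) + ∑ k ∈ Ioo i j, LL κ A (c i k) (m k j)) :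
    ∀ i j, q ≤ i → i < j → j ≤ p → j - i ≤ n →
      m i j ∈ GS κ Z ∧ dc κ A (m i j) = ∑ k ∈ Ioo i j, m i k ⊗ₜ m k j := by
  intro i j
  induction hr : j - i using Nat.strong_induction_on generalizing i j with
  | _ r ih =>
  intro hq hij hj hn
  subst hr
  have ih' : ∀ k ∈ Ioo i j, m k j ∈ GS κ Z ∧ dc κ A (m k j) = ∑ l ∈ Ioo k j, m k l ⊗ₜ m l j := by
    intro k hk
    rw [mem_Ioo] at hk
    exact ih (j - k) (by omega) k j rfl (by omega) (by omega) (by omega) (by omega)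
  have hm := (h i j hq hij hj hn).2
  constructor
  · rw [hm]
    refine add_mem (ltr_mem Z _ (h i j hq hij hj hn).1) (Submodule.sum_mem _ fun k hk => ?_)
    have hk' := mem_Ioo.mp hk
    exact LL_mem Z _ (h i k hq (by omega) (by omega) (by omega)).1 _ (ih' k hk).1
  · rw [hm, map_add, dc_ltr, zero_add, map_sum]
    have e : ∀ k ∈ Ioo i j, dc κ A (LL κ A (c i k) (m k j)) =
        ltr κ A (c i k) ⊗ₜ m k j + ∑ l ∈ Ioo k j, (LL κ A (c i k) (m k l)) ⊗ₜ m l j := by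
      intro k hk
      rw [dc_LL Z _ _ (ih' k hk).1, (ih' k hk).2, map_sum]
      simp
    rw [Finset.sum_congr rfl e, Finset.sum_add_distrib,
      ← sum_Ioo_swap i j (fun k l => (LL κ A (c i k) (m k l)) ⊗ₜ[κ] m l j),
      ← Finset.sum_add_distrib]
    refine Finset.sum_congr rfl fun k hk => ?_
    have hk' := mem_Ioo.mp hk
    rw [(h i k hq (by omega) (by omega) (by omega)).2, TensorProduct.add_tmul, TensorProduct.sum_tmul]
end gauge
theorem S_of_G (P : Submodule κ A) (hinv : ∀ x ∈ P, D.inv x ∈ P)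
    (hPl : ∀ x, ∀ y ∈ P, x * y ∈ P) (hPr : ∀ x ∈ P, ∀ y, x * y ∈ P) (h : D.G P) : D.S P := by
  obtain ⟨Z, μ, hZ, hspan, hμ1, hμ⟩ := h
  let M : TT κ A →ₗ[κ] A := Finsupp.linearCombination κ μ
  let B : TT κ A ⊗[κ] TT κ A →ₗ[κ] A :=
    TensorProduct.lift ((LinearMap.mul κ A).compl₁₂ (-(D.inv.toLinearMap ∘ₗ M)) M)
  have hB : ∀ s t, B (s ⊗ₜ t) = -(D.inv (M s)) * M t := by
    intro s t; simp [B]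
  have hM : ∀ t ∈ GS κ Z, M t ∈ P ∧ D.d (M t) = B (dc κ A t) := by
    intro t ht
    induction ht using Submodule.span_induction with
    | mem x hx =>
      obtain ⟨l, ⟨hl, hl2⟩, rfl⟩ := hx
      have := hμ l hl hl2
      simp only [M, Finsupp.linearCombination_single, one_smul]
      refine ⟨this.1, ?_⟩
      rw [this.2]
      simp [dc, hB, M]
    | zero => simp
    | add x y _ _ hx hy =>
      simp only [map_add]
      exact ⟨add_mem hx.1 hy.1, by rw [hx.2, hy.2]⟩
    | smul a x _ hx =>
      simp only [map_smul]
      exact ⟨Submodule.smul_mem _ _ hx.1, by rw [hx.2]⟩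
  have hlift : ∀ x ∈ Submodule.span κ Z, ∃ c ∈ Finsupp.supported κ κ Z, M (ltr κ A c) = x := by
    intro x hx
    have hx2 : x ∈ Submodule.span κ ((id : A → A) '' Z) := by simpa using hx
    rw [Finsupp.span_image_eq_map_linearCombination] at hx2
    obtain ⟨c, hc, rfl⟩ := hx2
    refine ⟨c, hc, ?_⟩
    simp only [M, ltr, Finsupp.lmapDomain_apply, Finsupp.linearCombination_mapDomain]
    simp only [Finsupp.linearCombination_apply, Finsupp.sum]
    refine Finset.sum_congr rfl fun z hz => ?_
    simp [hμ1 z (hc hz)]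
  rintro x ⟨p, a, ha, rfl⟩
  -- partial right-hand side
  let Y : (ℕ → ℕ → (A →₀ κ)) → (ℕ → ℕ → TT κ A) → (ℕ → ℕ → A) → ℕ → ℕ → A := fun c m h i j =>
    ∑ k ∈ Ioo i j, (a i k * h k j - D.inv (h i k) * M (m k j)) -
      M (∑ k ∈ Ioo i j, LL κ A (c i k) (m k j))
  have key : ∀ n, ∀ c m h, (∀ i j, i < j → j ≤ p → j - i ≤ n → ¬ (i = 0 ∧ j = p) →
      c i j ∈ Finsupp.supported κ κ Z ∧
      m i j = ltr κ A (c i j) + ∑ k ∈ Ioo i j, LL κ A (c i k) (m k j) ∧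
      D.d (h i j) = a i j - M (ltr κ A (c i j)) + Y c m h i j) →
      ∀ i j, i < j → j ≤ p → j - i ≤ n + 1 →
       Y c m h i j ∈ P ∧ D.d (Y c m h i j) = - D.obs a i j := by
    intro n c m h H i j hij hj hn
    -- modified `m` at `(i,j)`
    let c' : ℕ → ℕ → (A →₀ κ) := fun i' j' => if i' = i ∧ j' = j then 0 else c i' j'
    let m' : ℕ → ℕ → TT κ A := fun i' j' => if i' = i ∧ j' = j then
      ∑ k ∈ Ioo i j, LL κ A (c i k) (m k j) else m i' j'
    have hs : ∀ k ∈ Ioo i j, c' i k = c i k ∧ m' i k = m i k ∧ m' k j = m k j := by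
      intro k hk
      rw [mem_Ioo] at hk
      refine ⟨if_neg (by omega), if_neg (by omega), if_neg (by omega)⟩
    have hch := dc_chain Z c' m' i j (j - i) (by
      intro i' j' h0 h1 h2 h3
      by_cases hh : i' = i ∧ j' = j
      · obtain ⟨rfl, rfl⟩ := hh
        refine ⟨by simp [c'], ?_⟩
        simp only [c', m', and_self, if_true, map_zero, zero_add]
        refine Finset.sum_congr rfl fun k hk => ?_
        have := hs k hk
        simp only [c', m'] at this
        rw [this.1, this.2.2]
      · obtain ⟨h5, h6, -⟩ := H i' j' h1 (by omega) (by omega) (by omega)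
        simp only [c', m', if_neg hh]
        refine ⟨h5, ?_⟩
        rw [h6]
        congr 1
        refine Finset.sum_congr rfl fun k hk => ?_
        rw [mem_Ioo] at hk
        rw [if_neg (by omega), if_neg (by omega)])
    have b0 := hch i j le_rfl hij le_rfl le_rfl
    have hm0 : m' i j = ∑ k ∈ Ioo i j, LL κ A (c i k) (m k j) := by simp [m']
    have hb0 := hM _ b0.1
    rw [b0.2, hm0] at hb0
    have hb : ∀ i' j', i ≤ i' → i' < j' → j' ≤ j → ¬ (i' = i ∧ j' = j) → 
        M (m i' j') ∈ P ∧ D.d (M (m i' j')) = D.obs (fun i j => M (m i j)) i' j' := by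
      intro i' j' h0 h1 h2 h3
      have := hch i' j' h0 h1 h2 (by omega)
      have e := hM _ this.1
      rw [this.2, map_sum] at e
      simp only [m', if_neg h3] at e
      refine ⟨e.1, e.2.trans ?_⟩
      refine Finset.sum_congr rfl fun k hk => ?_
      rw [mem_Ioo] at hk
      rw [if_neg (by omega), if_neg (by omega), hB]
    have hh : ∀ i' j', i ≤ i' → i' < j' → j' ≤ j → ¬ (i' = i ∧ j' = j) → 
        D.d (h i' j') = a i' j' - M (m i' j') +
        ∑ k ∈ Ioo i' j', (a i' k * h k j' - D.inv (h i' k) * M (m k j')) := by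
      intro i' j' h0 h1 h2 h3
      obtain ⟨-, e1, e2⟩ := H i' j' h1 (by omega) (by omega) (by omega)
      rw [e2, e1]
      simp only [Y, map_add]
      abel
    have haa : ∀ i' j', i ≤ i' → i' < j' → j' ≤ j → ¬ (i' = i ∧ j' = j) → 
      a i' j' ∈ P ∧ D.d (a i' j') = D.obs a i' j' := by
      intro i' j' h0 h1 h2 h3
      exact ha i' j' h1 (by omega) (by omega)
    constructor
    · refine sub_mem (Submodule.sum_mem _ fun k hk => ?_) hb0.1
      rw [mem_Ioo] at hk
      exact sub_mem (hPr _ (haa i k (by omega) (by omega) (by omega) (by omega)).1 _)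
        (hPl _ _ (hb k j (by omega) (by omega) (by omega) (by omega)).1)
    · simp only [Y]
      rw [map_sub, hb0.2, map_sum, map_sum]
      have e : ∀ k ∈ Ioo i j, D.d (a i k * h k j - D.inv (h i k) * M (m k j)) =
        D.inv (a i k) * a k j - D.inv (M (m i k)) * M (m k j)
         + (- ∑ l ∈ Ioo i k, D.inv (a i l) * a l k * h k j
            + ∑ l ∈ Ioo k j, D.inv (a i k) * a k l * h l j)
         + (- ∑ l ∈ Ioo k j, D.inv (a i k) * D.inv (h k l) * M (m l j)
            + ∑ l ∈ Ioo i k, D.inv (a i l) * D.inv (h l k) * M (m k j))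
         + (- ∑ l ∈ Ioo i k, h i l * D.inv (M (m l k)) * M (m k j)
            + ∑ l ∈ Ioo k j, h i k * D.inv (M (m k l)) * M (m l j)) := by
        intro k hk
        rw [mem_Ioo] at hk
        rw [map_sub, D.leib, D.leib, D.inv_inv, D.d_inv,
          (haa i k (by omega) (by omega) (by omega) (by omega)).2,
          (hb k j (by omega) (by omega) (by omega) (by omega)).2,
          hh i k (by omega) (by omega) (by omega) (by omega),
          hh k j (by omega) (by omega) (by omega) (by omega)]
        simp only [obs, map_add, map_sub, map_sum, map_mul, D.inv_inv, mul_add, mul_sub, add_mul,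
          sub_mul, sum_mul, mul_sum, neg_mul, mul_neg, neg_add, sum_sub_distrib, sum_neg_distrib,
          neg_neg, ← mul_assoc]
        abel
      have e3 : ∀ k ∈ Ioo i j, B (m' i k ⊗ₜ m' k j) = - (D.inv (M (m i k)) * M (m k j)) := by
        intro k hk
        rw [(hs k hk).2.1, (hs k hk).2.2, hB, neg_mul]
      rw [Finset.sum_congr rfl e, Finset.sum_congr rfl e3]
      simp only [sum_add_distrib, sum_sub_distrib, sum_neg_distrib, obs, neg_mul]
      have s1 := sum_Ioo_swap i j (fun l k => D.inv (a i l) * a l k * h k j)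
      have s2 := sum_Ioo_swap i j (fun l k => D.inv (a i l) * D.inv (h l k) * M (m k j))
      have s3 := sum_Ioo_swap i j (fun l k => h i l * D.inv (M (m l k)) * M (m k j))
      rw [s1, s2, s3]
      abel
  have ex : ∀ n, ∃ c m h, (∀ i j, i < j → j ≤ p → j - i ≤ n → ¬ (i = 0 ∧ j = p) →
      c i j ∈ Finsupp.supported κ κ Z ∧
      m i j = ltr κ A (c i j) + ∑ k ∈ Ioo i j, LL κ A (c i k) (m k j) ∧
      D.d (h i j) = a i j - M (ltr κ A (c i j)) + Y c m h i j) := by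
    intro n
    induction n with
    | zero => exact ⟨fun _ _ => 0, fun _ _ => 0, fun _ _ => 0, fun i j h1 h2 h3 => by omega⟩
    | succ n ih =>
      obtain ⟨c, m, h, H⟩ := ih
      have K := key n c m h H
      have : ∀ i j, ∃ (ch : (A →₀ κ) × A), i < j → j ≤ p → j - i = n + 1 → ¬ (i = 0 ∧ j = p) →
          ch.1 ∈ Finsupp.supported κ κ Z ∧
          D.d ch.2 = a i j - M (ltr κ A ch.1) + Y c m h i j := by
        intro i j
        by_cases hc : i < j ∧ j ≤ p ∧ j - i = n + 1 ∧ ¬ (i = 0 ∧ j = p)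
        · obtain ⟨h1, h2, h3, h4⟩ := hc
          have k1 := K i j h1 h2 (by omega)
          have k2 := ha i j h1 h2 h4
          have := hspan (a i j + Y c m h i j) (add_mem k2.1 k1.1)
            (by rw [map_add, k1.2, k2.2]; simp)
          obtain ⟨x, hx, y, ⟨y, rfl⟩, hxy⟩ := Submodule.mem_sup.mp this
          obtain ⟨cc, hcc, hcx⟩ := hlift x hx
          refine ⟨(cc, y), fun _ _ _ _ => ⟨hcc, ?_⟩⟩
          simp only [hcx]
          rw [eq_sub_of_add_eq' hxy]; abel
        · exact ⟨(0, 0), fun h1 h2 h3 h4 => absurd ⟨h1, h2, h3, h4⟩ hc⟩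
      choose ch hch using this
      let c' : ℕ → ℕ → (A →₀ κ) := fun i j => if j - i = n + 1 then (ch i j).1 else c i j
      let h' : ℕ → ℕ → A := fun i j => if j - i = n + 1 then (ch i j).2 else h i j
      let m' : ℕ → ℕ → TT κ A := fun i j => if j - i = n + 1 then 
        ltr κ A (ch i j).1 + ∑ k ∈ Ioo i j, LL κ A (c i k) (m k j) else m i j
      have hsame : ∀ i j, j - i ≤ n + 1 → ∀ k ∈ Ioo i j, c' i k = c i k ∧ h' i k = h i k ∧
          h' k j = h k j ∧ m' k j = m k j := by
        intro i j hij k hk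
        rw [mem_Ioo] at hk
        exact ⟨if_neg (by omega), if_neg (by omega), if_neg (by omega), if_neg (by omega)⟩
      have hY : ∀ i j, j - i ≤ n + 1 → Y c' m' h' i j = Y c m h i j := by
        intro i j hij
        simp only [Y]
        congr 1
        · refine Finset.sum_congr rfl fun k hk => ?_
          obtain ⟨e1, e2, e3, e4⟩ := hsame i j hij k hk
          rw [e2, e3, e4]
        · congr 1
          refine Finset.sum_congr rfl fun k hk => ?_
          obtain ⟨e1, e2, e3, e4⟩ := hsame i j hij k hk
          rw [e1, e4]
      refine ⟨c', m', h', fun i j h1 h2 h3 h4 => ?_⟩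
      have hsum : ∑ k ∈ Ioo i j, LL κ A (c' i k) (m' k j) =
          ∑ k ∈ Ioo i j, LL κ A (c i k) (m k j) := by
        refine Finset.sum_congr rfl fun k hk => ?_
        obtain ⟨e1, e2, e3, e4⟩ := hsame i j h3 k hk
        rw [e1, e4]
      rw [hY i j h3, hsum]
      by_cases h5 : j - i = n + 1
      · simp only [c', m', h', if_pos h5]
        have := hch i j h1 h2 h5 h4
        exact ⟨this.1, trivial, this.2⟩
      · simp only [c', m', h', if_neg h5]
        exact H i j h1 h2 (by omega) h4
  obtain ⟨c, m, h, H⟩ := ex p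
  by_cases hp : 0 < p
  · have := key p c m h H 0 p hp le_rfl (by omega)
    exact ⟨- Y c m h 0 p, neg_mem this.1, by rw [map_neg, this.2, neg_neg]⟩
  · have : p = 0 := by omega
    subst this
    exact ⟨0, zero_mem _, by simp [obs]⟩
/-- ghost step -/
theorem S_ghost (P P' : Submodule κ A) (κ : A →ₗ[κ] A) (u : A)
    (hk : ∀ x y, κ (x * y) = κ x * y + D.inv x * κ y) (hku : κ u = 1)
    (hkd : ∀ x, κ (D.d x) = - D.d (κ x)) (hkk : ∀ x, κ (κ x) = 0)
    (hki : ∀ x, κ (D.inv x) = - D.inv (κ x)) (hu : ∀ y, u * y = D.inv y * u)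
    (huu : u * u = 0) (hdu : D.d u = 0) (hiu : D.inv u = - u)
    (hP' : ∀ x, x ∈ P' ↔ x ∈ P ∧ κ x = 0)
    (hkP : ∀ x ∈ P, κ x ∈ P) (huP : ∀ x ∈ P, u * x ∈ P) (hinv : ∀ x ∈ P, D.inv x ∈ P)
    (h : D.S P') : D.S P := by
  rintro o ⟨p, a, ha, rfl⟩
  let y : ℕ → ℕ → A := fun i j => κ (a i j)
  let x : ℕ → ℕ → A := fun i j => a i j - u * κ (a i j)
  have kx : ∀ z, κ (z - u * κ z) = 0 := by
    intro z
    rw [map_sub, hk, hku, hiu, hkk]; simp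
  have hxa : ∀ i j, a i j = x i j + u * y i j := fun i j => by simp [x, y]
  have hyeq : ∀ i j, D.obs a i j = D.obs x i j -
      u * (∑ k ∈ Ioo i j, (x i k * y k j - D.inv (y i k) * x k j)) := by
    intro i j
    simp only [obs, mul_sum, ← sum_sub_distrib]
    refine Finset.sum_congr rfl fun k hk => ?_
    rw [hxa i k, hxa k j]
    simp only [map_add, map_mul, hiu]
    have e1 : D.inv (x i k) * (u * y k j) = u * (x i k * y k j) := by
      rw [← mul_assoc, ← hu, mul_assoc]
    have e2 : u * D.inv (y i k) * (u * y k j) = 0 := by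
      rw [hu (D.inv (y i k)), D.inv_inv, mul_assoc, ← mul_assoc u u, huu]; simp
    simp only [add_mul, mul_add, neg_mul, mul_sub, neg_add, neg_neg]
    rw [e1, e2, mul_assoc]
    abel
  have hdy : ∀ i j, D.d (a i j) = D.obs a i j →
      D.d (y i j) = ∑ k ∈ Ioo i j, (x i k * y k j - D.inv (y i k) * x k j) := by
    intro i j hij
    have := hkd (a i j)
    rw [hij, obs, map_sum] at this
    rw [show D.d (y i j) = -(- D.d (κ (a i j))) by simp [y], ← this, ← sum_neg_distrib]
    refine Finset.sum_congr rfl fun k hk' => ?_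
    rw [neg_mul, map_neg, neg_neg, hk, hki, D.inv_inv]
    have e3 : D.inv (y i k) * (u * y k j) = u * (y i k) * y k j := by
      rw [← mul_assoc, ← hu]
    rw [hxa i k, hxa k j, ← hxa k j, ← hxa i k]
    change -D.inv (y i k) * a k j + a i k * y k j = _
    rw [hxa i k, hxa k j, mul_add, add_mul, neg_mul, neg_mul, e3]
    abel
  have hdx : ∀ i j, D.d (a i j) = D.obs a i j → D.d (x i j) = D.obs x i j := by
    intro i j hij
    have e : x i j = a i j - u * y i j := rfl
    rw [e, map_sub, D.leib, hdu, hiu, hdy i j hij, hij, hyeq]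
    simp
  have hxP : ∀ z ∈ P, z - u * κ z ∈ P' := fun z hz =>
    (hP' _).mpr ⟨sub_mem hz (huP _ (hkP _ hz)), kx z⟩
  have hyP : ∀ z ∈ P, κ z ∈ P' := fun z hz => (hP' _).mpr ⟨hkP _ hz, hkk z⟩
  by_cases hp : p = 0
  · subst hp; exact ⟨0, zero_mem _, by simp [obs]⟩
  obtain ⟨x0, hx0, hdx0⟩ := h (D.obs x 0 p) ⟨p, x, fun i j h1 h2 h3 =>
    ⟨hxP _ (ha i j h1 h2 h3).1, hdx i j (ha i j h1 h2 h3).2⟩, rfl⟩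
  let x' : ℕ → ℕ → A := fun i j => if i = 0 ∧ j = p then x0 else x i j
  have hx'obs : ∀ i j, j ≤ p → D.obs x' i j = D.obs x i j := by
    intro i j hj
    apply D.obs_congr
    intro k hk
    rw [mem_Ioo] at hk
    exact ⟨if_neg (by omega), if_neg (by omega)⟩
  have hx' : ∀ i j, i < j → j ≤ p → x' i j ∈ P' ∧ D.d (x' i j) = D.obs x' i j := by
    intro i j h1 h2
    rw [hx'obs i j h2]
    by_cases h3 : i = 0 ∧ j = p
    · obtain ⟨rfl, rfl⟩ := h3
      simp only [x', and_self, if_true]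
      exact ⟨hx0, hdx0⟩
    · simp only [x', if_neg h3]
      exact ⟨hxP _ (ha i j h1 h2 h3).1, hdx i j (ha i j h1 h2 h3).2⟩
  have hinv' : ∀ z ∈ P', D.inv z ∈ P' := by
    intro z hz
    rw [hP'] at hz ⊢
    exact ⟨hinv _ hz.1, by rw [hki, hz.2]; simp⟩
  let c : ℕ → ℕ → A := fun i j =>
    if j ≤ p then - D.inv (x' i j)
    else if p + 1 ≤ i then x' (i - (p+1)) (j - (p+1))
    else if i < j - (p+1) then y i (j - (p+1)) else 0
  have hmix : ∀ i j, i ≤ p → j ≤ p → D.obs c i (p + 1 + j) =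
      if i < j then ∑ k ∈ Ioo i j, (x i k * y k j - D.inv (y i k) * x k j) else 0 := by
    intro i j hi hj
    have hsplit : (Ioo i (p + 1 + j) : Finset ℕ) =
        Ioc i p ∪ (Ico 0 j).map (addLeftEmbedding (p + 1)) := by
      ext k
      simp only [mem_Ioo, mem_union, mem_Ioc, mem_map, mem_Ico, addLeftEmbedding_apply]
      constructor
      · intro hk
        by_cases h : k ≤ p
        · left; omega
        · right; exact ⟨k - (p + 1), by omega, by omega⟩
      · rintro (hk | ⟨k, hk, rfl⟩) <;> omega
    rw [obs, hsplit, Finset.sum_union, Finset.sum_map]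
    swap
    · rw [Finset.disjoint_left]
      intro k hk hk2
      simp only [mem_map, mem_Ico, addLeftEmbedding_apply, mem_Ioc] at hk hk2
      obtain ⟨k, hk, rfl⟩ := hk2
      omega
    have t1 : ∑ k ∈ Ioc i p, -(D.inv (c i k)) * c k (p + 1 + j) =
        ∑ k ∈ Ioo i j, x i k * y k j := by
      symm
      apply Finset.sum_subset_zero_on_sdiff
      · intro k; simp only [mem_Ioo, mem_Ioc]; omega
      · intro k hk
        simp only [mem_sdiff, mem_Ioo, mem_Ioc] at hk
        have : c k (p + 1 + j) = 0 := by
          simp only [c]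
          rw [if_neg (by omega), if_neg (by omega), if_neg (by omega)]
        rw [this, mul_zero]
      · intro k hk
        simp only [mem_Ioo] at hk
        have e1 : c k (p + 1 + j) = y k j := by
          simp only [c]
          rw [if_neg (by omega), if_neg (by omega), if_pos (by omega)]
          congr 1; omega
        have e2 : c i k = - D.inv (x i k) := by
          simp only [c]
          rw [if_pos (by omega)]
          simp only [x']
          rw [if_neg (by omega)]
        rw [e1, e2]; simp [D.inv_inv]
    have t2 : ∑ k ∈ Ico 0 j, -(D.inv (c i (addLeftEmbedding (p+1) k))) *
          c (addLeftEmbedding (p+1) k) (p + 1 + j) =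
        ∑ k ∈ Ioo i j, -(D.inv (y i k) * x k j) := by
      symm
      apply Finset.sum_subset_zero_on_sdiff
      · intro k; simp only [mem_Ioo, mem_Ico]; omega
      · intro k hk
        simp only [mem_sdiff, mem_Ioo, mem_Ico] at hk
        have : c i (p + 1 + k) = 0 := by
          simp only [c]
          rw [if_neg (by omega), if_neg (by omega), if_neg (by omega)]
        simp [this]
      · intro k hk
        simp only [mem_Ioo] at hk
        have e1 : c i (p + 1 + k) = y i k := by
          simp only [c]
          rw [if_neg (by omega), if_neg (by omega), if_pos (by omega)]
          congr 1; omega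
        have e2 : c (p + 1 + k) (p + 1 + j) = x k j := by
          simp only [c]
          rw [if_neg (by omega), if_pos (by omega)]
          simp only [x']
          rw [if_neg (by omega)]
          congr 1 <;> omega
        simp only [addLeftEmbedding_apply]
        rw [e1, e2]; simp
    rw [t1, t2, ← sum_add_distrib]
    split_ifs with hij
    · refine Finset.sum_congr rfl fun k _ => by abel
    · rw [Finset.Ioo_eq_empty (by omega), Finset.sum_empty]
  have hDec : D.Dec P' (D.obs c 0 (2 * p + 1)) := by
    refine ⟨2 * p + 1, c, ?_, rfl⟩
    intro i j h1 h2 h3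
    by_cases hj : j ≤ p
    · have e : ∀ k, k ≤ p → ∀ i, c i k = - D.inv (x' i k) := fun k hk i => if_pos hk
      refine ⟨?_, ?_⟩
      · rw [e j hj]; exact neg_mem (hinv' _ (hx' i j h1 hj).1)
      · rw [e j hj, map_neg, D.d_inv, neg_neg, (hx' i j h1 hj).2, obs, map_sum]
        refine Finset.sum_congr rfl fun k hk => ?_
        rw [mem_Ioo] at hk
        rw [e k (by omega), e j hj]; simp [D.inv_inv]
    · by_cases hi : p + 1 ≤ i
      · obtain ⟨i, rfl⟩ := Nat.exists_eq_add_of_le hi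
        obtain ⟨j, rfl⟩ := Nat.exists_eq_add_of_le (show p + 1 ≤ j by omega)
        have e : ∀ i j, c (p + 1 + i) (p + 1 + j) = x' i j := by
          intro i j
          simp only [c]
          rw [if_neg (by omega), if_pos (by omega)]
          congr 1 <;> omega
        have := hx' i j (by omega) (by omega)
        refine ⟨by rw [e]; exact this.1, ?_⟩
        rw [e, this.2, obs, obs]
        have hI : (Ioo (p + 1 + i) (p + 1 + j) : Finset ℕ) =
            (Ioo i j).map (addLeftEmbedding (p + 1)) := by
          rw [Finset.map_add_left_Ioo]
        rw [hI, Finset.sum_map]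
        simp only [addLeftEmbedding_apply, e]
      · obtain ⟨j, rfl⟩ := Nat.exists_eq_add_of_le (show p + 1 ≤ j by omega)
        have e : c i (p + 1 + j) = if i < j then y i j else 0 := by
          simp only [c]
          rw [if_neg (by omega), if_neg (by omega)]
          congr 1
          · simp
          · congr 1; omega
        have := hmix i j (by omega) (by omega)
        rw [Sys, e, this]
        split_ifs with hij
        · have := ha i j hij (by omega) (by omega)
          exact ⟨hyP _ this.1, hdy i j this.2⟩
        · exact ⟨zero_mem _, map_zero _⟩
  obtain ⟨y0, hy0, hdy0⟩ := h (D.obs c 0 (2 * p + 1)) hDec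
  · rw [show 2 * p + 1 = p + 1 + p by omega, hmix 0 p (by omega) le_rfl, if_pos (by omega)] at hdy0
    refine ⟨x0 + u * y0, add_mem ((hP' _).mp hx0).1 (huP _ ((hP' _).mp hy0).1), ?_⟩
    rw [map_add, D.leib, hdu, hiu, hdx0, hdy0, hyeq]
    simp [sub_eq_add_neg]
end DGA
set_option linter.unusedVariables false
set_option linter.unusedSimpArgs false
namespace KZ
variable (κ : Type) [Field κ] {σ : Type} [Fintype σ] [DecidableEq σ]
abbrev EE (σ : Type) := ExteriorAlgebra κ (σ → κ)
noncomputable def u (i : σ) : EE κ σ := ExteriorAlgebra.ι κ (Pi.single i 1)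
noncomputable def cphi (f : (σ → κ) →ₗ[κ] κ) : EE κ σ →ₗ[κ] EE κ σ :=
  CliffordAlgebra.contractLeft (Q := (0 : QuadraticForm κ (σ → κ))) f
noncomputable def ct (i : σ) : EE κ σ →ₗ[κ] EE κ σ :=
  CliffordAlgebra.contractLeft (Q := (0 : QuadraticForm κ (σ → κ))) (LinearMap.proj i)
noncomputable def ev : EE κ σ →ₐ[κ] EE κ σ :=
  CliffordAlgebra.involute (Q := (0 : QuadraticForm κ (σ → κ)))
variable {κ}
theorem left_ind {P : EE κ σ → Prop} (h1 : ∀ r : κ, P (algebraMap κ _ r))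
    (h2 : ∀ x y, P x → P y → P (x + y)) (h3 : ∀ m x, P x → P (ExteriorAlgebra.ι κ m * x)) (x) :
    P x :=
  CliffordAlgebra.left_induction (Q := (0 : QuadraticForm κ (σ → κ))) h1 h2
    (fun x m hx => h3 m x hx) x
theorem cphi_iota_mul (f : (σ → κ) →ₗ[κ] κ) (m : σ → κ) (e : EE κ σ) :
    cphi κ f (ExteriorAlgebra.ι κ m * e) = f m • e - ExteriorAlgebra.ι κ m * cphi κ f e :=
  CliffordAlgebra.contractLeft_ι_mul (Q := (0 : QuadraticForm κ (σ → κ))) f m e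
theorem cphi_algebraMap (f : (σ → κ) →ₗ[κ] κ) (r : κ) :
    cphi κ f (algebraMap κ (EE κ σ) r) = 0 :=
  CliffordAlgebra.contractLeft_algebraMap (Q := (0 : QuadraticForm κ (σ → κ))) _ r
theorem ct_eq (i : σ) : ct κ i = cphi κ (LinearMap.proj i) := rfl
theorem ct_iota_mul (i : σ) (m : σ → κ) (e : EE κ σ) :
    ct κ i (ExteriorAlgebra.ι κ m * e) = m i • e - ExteriorAlgebra.ι κ m * ct κ i e :=
  CliffordAlgebra.contractLeft_ι_mul (Q := (0 : QuadraticForm κ (σ → κ))) (LinearMap.proj i) m e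
theorem ct_algebraMap (i : σ) (r : κ) : ct κ i (algebraMap κ (EE κ σ) r) = 0 :=
  cphi_algebraMap _ r
theorem ct_one (i : σ) : ct κ i (1 : EE κ σ) = 0 := by
  have := ct_algebraMap i (1 : κ)
  simpa using this
theorem ct_u_mul (i j : σ) (e : EE κ σ) :
    ct κ i (u κ j * e) = (if i = j then e else 0) - u κ j * ct κ i e := by
  rw [u, ct_iota_mul, Pi.single_apply]
  split_ifs <;> simp
theorem ct_u_mul_self (i : σ) (e : EE κ σ) : ct κ i (u κ i * e) = e - u κ i * ct κ i e := by
  rw [ct_u_mul, if_pos rfl]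
theorem ct_u_mul_ne {i j : σ} (h : i ≠ j) (e : EE κ σ) :
    ct κ i (u κ j * e) = - (u κ j * ct κ i e) := by
  rw [ct_u_mul, if_neg h, zero_sub]
theorem ct_u (i j : σ) : ct κ i (u κ j) = if i = j then 1 else 0 := by
  have := ct_u_mul i j (1 : EE κ σ)
  simpa [ct_one] using this
theorem ct_ct (i : σ) (e : EE κ σ) : ct κ i (ct κ i e) = 0 :=
  CliffordAlgebra.contractLeft_contractLeft (Q := (0 : QuadraticForm κ (σ → κ))) _ e
theorem ct_comm (i j : σ) (e : EE κ σ) : ct κ i (ct κ j e) = - ct κ j (ct κ i e) :=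
  CliffordAlgebra.contractLeft_comm (Q := (0 : QuadraticForm κ (σ → κ))) (LinearMap.proj i) (LinearMap.proj j) e
theorem ev_iota (m : σ → κ) : ev κ (ExteriorAlgebra.ι κ m : EE κ σ) = - ExteriorAlgebra.ι κ m :=
  CliffordAlgebra.involute_ι m
theorem ev_u (i : σ) : ev κ (u κ i) = - u κ i := ev_iota _
theorem ev_ev (e : EE κ σ) : ev κ (ev κ e) = e := CliffordAlgebra.involute_involute e
theorem ct_mul (i : σ) (x y : EE κ σ) : ct κ i (x * y) = ct κ i x * y + ev κ x * ct κ i y := by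
  induction x using left_ind with
  | h1 r => 
    rw [ct_algebraMap, AlgHom.commutes, ← Algebra.smul_def, ← Algebra.smul_def, map_smul]; simp
  | h2 a b ha hb => simp only [map_add, add_mul, ha, hb]; abel
  | h3 m x hx =>
    rw [mul_assoc, ct_iota_mul, hx, ct_iota_mul, map_mul, ev_iota]
    simp only [mul_add, sub_mul, smul_mul_assoc, mul_assoc, neg_mul]
    abel
theorem ev_ct (i : σ) (x : EE κ σ) : ct κ i (ev κ x) = - ev κ (ct κ i x) := by
  induction x using left_ind with
  | h1 r => rw [AlgHom.commutes, ct_algebraMap]; simp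
  | h2 a b ha hb => simp only [map_add, ha, hb]; abel
  | h3 m x hx =>
    rw [map_mul, ev_iota, neg_mul, map_neg, ct_iota_mul, ct_iota_mul, hx, map_sub, map_mul, ev_iota,
      map_smul]
    simp only [neg_mul, mul_neg]
    
theorem iota_mul_eq (m : σ → κ) (x : EE κ σ) :
    ExteriorAlgebra.ι κ m * x = ev κ x * ExteriorAlgebra.ι κ m := by
  induction x using left_ind with
  | h1 r => rw [AlgHom.commutes]; exact (Algebra.commutes r _).symm
  | h2 a b ha hb => simp only [map_add, mul_add, add_mul, ha, hb]
  | h3 m' x hx =>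
    rw [map_mul, ev_iota, ← mul_assoc, eq_neg_of_add_eq_zero_left (ExteriorAlgebra.ι_add_mul_swap m m'),
      neg_mul, mul_assoc, hx, neg_mul, neg_mul, mul_assoc]
theorem u_mul_eq (i : σ) (x : EE κ σ) : u κ i * x = ev κ x * u κ i := iota_mul_eq _ x
theorem u_u (i : σ) : u κ i * u κ i = 0 := ExteriorAlgebra.ι_sq_zero _
theorem u_u_mul (i : σ) (e : EE κ σ) : u κ i * (u κ i * e) = 0 := by
  rw [← mul_assoc, u_u, zero_mul]
theorem u_comm (i j : σ) (e : EE κ σ) : u κ i * (u κ j * e) = - (u κ j * (u κ i * e)) := by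
  have h : u κ i * u κ j = - (u κ j * u κ i) :=
    eq_neg_of_add_eq_zero_left (ExteriorAlgebra.ι_add_mul_swap _ _)
  rw [← mul_assoc, ← mul_assoc, h, neg_mul]
theorem map_cphi {τ : Type} [Fintype τ] [DecidableEq τ] (l : (σ → κ) →ₗ[κ] (τ → κ))
    (f : (τ → κ) →ₗ[κ] κ) (e : EE κ σ) :
    cphi κ f (ExteriorAlgebra.map l e) = ExteriorAlgebra.map l (cphi κ (f ∘ₗ l) e) := by
  induction e using left_ind with
  | h1 r => rw [AlgHom.commutes, cphi_algebraMap, cphi_algebraMap, map_zero]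
  | h2 a b ha hb => simp only [map_add, ha, hb]
  | h3 m x hx =>
    rw [map_mul, ExteriorAlgebra.map_apply_ι, cphi_iota_mul, hx, cphi_iota_mul, map_sub, map_mul,
      map_smul, ExteriorAlgebra.map_apply_ι]
    rfl
theorem map_ev {τ : Type} [Fintype τ] [DecidableEq τ] (l : (σ → κ) →ₗ[κ] (τ → κ)) (e : EE κ σ) :
    ev κ (ExteriorAlgebra.map l e) = ExteriorAlgebra.map l (ev κ e) := by
  induction e using left_ind with
  | h1 r => simp only [AlgHom.commutes]
  | h2 a b ha hb => simp only [map_add, ha, hb]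
  | h3 m x hx =>
    rw [map_mul, map_mul, ExteriorAlgebra.map_apply_ι, ev_iota, hx, map_mul, ev_iota, neg_mul, neg_mul,
      map_neg, map_mul, ExteriorAlgebra.map_apply_ι]
/-- projection killing the coordinates in `G` -/
def kl (G : Finset σ) : (σ → κ) →ₗ[κ] (σ → κ) where
  toFun m := fun i => if i ∈ G then 0 else m i
  map_add' x y := by ext i; by_cases h : i ∈ G <;> simp [h]
  map_smul' r x := by ext i; by_cases h : i ∈ G <;> simp [h]
theorem map_kl_singleton (g : σ) (e : EE κ σ) :
    ExteriorAlgebra.map (kl {g}) e = ct κ g (u κ g * e) := by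
  induction e using left_ind with
  | h1 r => rw [AlgHom.commutes, ct_u_mul_self, ct_algebraMap]; simp
  | h2 a b ha hb => simp only [map_add, mul_add, ha, hb]
  | h3 m x hx =>
    rw [map_mul, ExteriorAlgebra.map_apply_ι, hx]
    have e1 : (kl {g} m : σ → κ) = m - m g • Pi.single g 1 := by
      ext i
      by_cases h : i = g
      · subst h; simp [kl]
      · simp [kl, h]
    have e2 : u κ g * ct κ g (u κ g * x) = u κ g * x := by
      rw [ct_u_mul_self, mul_sub, u_u_mul, sub_zero]
    have e3 : u κ g * (ExteriorAlgebra.ι κ m * x) = -(ExteriorAlgebra.ι κ m * (u κ g * x)) := by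
      rw [← mul_assoc, ← mul_assoc, u,
        eq_neg_of_add_eq_zero_left (ExteriorAlgebra.ι_add_mul_swap _ m), neg_mul]
    rw [e1, map_sub, map_smul, sub_mul, smul_mul_assoc]
    change _ - m g • (u κ g * _) = _
    rw [e2, e3, map_neg, ct_iota_mul]
    abel
theorem map_kl_eq (G : Finset σ) (e : EE κ σ) (h : ∀ g ∈ G, ct κ g e = 0) :
    ExteriorAlgebra.map (kl G) e = e := by
  induction G using Finset.induction_on with
  | empty =>
    have : (kl ∅ : (σ → κ) →ₗ[κ] (σ → κ)) = LinearMap.id := by ext; simp [kl]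
    rw [this, ExteriorAlgebra.map_id]; rfl
  | insert g G hg ih =>
    have : (kl (insert g G) : (σ → κ) →ₗ[κ] (σ → κ)) = kl G ∘ₗ kl {g} := by
      apply LinearMap.ext; intro m; ext i
      by_cases h1 : i = g <;> by_cases h2 : i ∈ G <;> simp [kl, h1, h2]
    have h3 : ExteriorAlgebra.map (kl {g}) e = e := by
      rw [map_kl_singleton, ct_u_mul_self, h g (by simp)]; simp
    rw [this, ← ExteriorAlgebra.map_comp_map, AlgHom.comp_apply, h3,
      ih fun g hg => h g (by simp [hg])]
theorem eq_algebraMap_of_ct (e : EE κ σ) (h : ∀ g, ct κ g e = 0) :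
    ∃ r : κ, e = algebraMap κ _ r := by
  have h1 := map_kl_eq Finset.univ e fun g _ => h g
  have h2 : (kl Finset.univ : (σ → κ) →ₗ[κ] (σ → κ)) = 0 := by
    apply LinearMap.ext; intro m; ext i; simp [kl]
  rw [h2] at h1
  have : ∀ e : EE κ σ, ∃ r : κ, ExteriorAlgebra.map (0 : (σ → κ) →ₗ[κ] (σ → κ)) e = algebraMap κ _ r := by
    intro e
    induction e using left_ind with
    | h1 r => exact ⟨r, AlgHom.commutes _ _⟩
    | h2 a b ha hb =>
      obtain ⟨r, hr⟩ := ha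
      obtain ⟨s, hs⟩ := hb
      exact ⟨r + s, by rw [map_add, map_add, hr, hs]⟩
    | h3 m x hx => exact ⟨0, by rw [map_mul, ExteriorAlgebra.map_apply_ι]; simp⟩
  obtain ⟨r, hr⟩ := this e
  exact ⟨r, by rw [← hr, h1]⟩
end KZ
namespace KZ
variable (κ : Type) [Field κ] [CharZero κ] {σ : Type} [Fintype σ] [DecidableEq σ]
noncomputable def nfI (N : Set (Finset σ)) : Ideal (MvPolynomial σ κ) :=
  Ideal.span ((fun s : Finset σ => ∏ i ∈ s, MvPolynomial.X i) '' N)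
abbrev KA (N : Set (Finset σ)) : Type := EE κ σ ⊗[κ] (MvPolynomial σ κ ⧸ nfI κ N)
noncomputable instance (N : Set (Finset σ)) : Ring (KA κ N) := Algebra.TensorProduct.instRing
noncomputable instance (N : Set (Finset σ)) : Algebra κ (KA κ N) := Algebra.TensorProduct.leftAlgebra
def fc (N : Set (Finset σ)) (t : Finset σ) : Prop := ∀ s ∈ N, ¬ s ⊆ t
theorem fc.mono {N : Set (Finset σ)} {s t : Finset σ} (h : fc N t) (hst : s ⊆ t) : fc N s :=
  fun r hr hrs => h r hr (hrs.trans hst)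
noncomputable def mn (N : Set (Finset σ)) (α : σ →₀ ℕ) : MvPolynomial σ κ ⧸ nfI κ N :=
  Ideal.Quotient.mk _ (MvPolynomial.monomial α 1)
/-- the basic linear map `e ↦ e ⊗ v^α` -/
noncomputable def tt (N : Set (Finset σ)) (α : σ →₀ ℕ) : EE κ σ →ₗ[κ] KA κ N :=
  (TensorProduct.mk κ _ _).flip (mn κ N α)
noncomputable def s1 (s : Finset σ) : σ →₀ ℕ := ∑ i ∈ s, Finsupp.single i 1
theorem s1_apply (s : Finset σ) (i : σ) : s1 s i = if i ∈ s then 1 else 0 := by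
  simp [s1, Finsupp.finsetSum_apply, Finsupp.single_apply]
theorem s1_supp (s : Finset σ) : (s1 s).support = s := by
  ext i; simp [s1_apply]
variable {κ}
theorem prodX (s : Finset σ) : (∏ i ∈ s, MvPolynomial.X i : MvPolynomial σ κ) =
    MvPolynomial.monomial (s1 s) 1 := by
  rw [s1, MvPolynomial.monomial_sum_one]; rfl
theorem mn_add (N : Set (Finset σ)) (α β : σ →₀ ℕ) : mn κ N α * mn κ N β = mn κ N (α + β) := by
  rw [mn, mn, mn, ← map_mul, MvPolynomial.monomial_mul, mul_one]
theorem mn_zero_of {N : Set (Finset σ)} {α : σ →₀ ℕ} (h : ¬ fc N α.support) : mn κ N α = 0 := by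
  simp only [fc, not_forall, not_not] at h
  obtain ⟨s, hs, hsα⟩ := h
  have h1 : s1 s ≤ α := by
    intro i; rw [s1_apply]; split_ifs with hi
    · have := hsα hi; rw [Finsupp.mem_support_iff] at this; omega
    · omega
  obtain ⟨β, rfl⟩ := exists_add_of_le h1
  rw [← mn_add, mn, ← prodX]
  have h2 : (∏ i ∈ s, MvPolynomial.X i : MvPolynomial σ κ) ∈ nfI κ N :=
    Ideal.subset_span ⟨s, hs, rfl⟩
  rw [Ideal.Quotient.eq_zero_iff_mem.2 h2, zero_mul]
theorem tt_apply (N : Set (Finset σ)) (α : σ →₀ ℕ) (e : EE κ σ) : tt κ N α e = e ⊗ₜ mn κ N α := rfl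
theorem tt_zero_of {N : Set (Finset σ)} {α : σ →₀ ℕ} (h : ¬ fc N α.support) (e : EE κ σ) :
    tt κ N α e = 0 := by rw [tt_apply, mn_zero_of h, TensorProduct.tmul_zero]
theorem tt_mul (N : Set (Finset σ)) (α β : σ →₀ ℕ) (e e' : EE κ σ) :
    tt κ N α e * tt κ N β e' = tt κ N (α + β) (e * e') := by
  rw [tt_apply, tt_apply, tt_apply, Algebra.TensorProduct.tmul_mul_tmul, mn_add]
theorem KA_ind {N : Set (Finset σ)} {P : KA κ N → Prop} (h0 : P 0)
    (ha : ∀ x y, P x → P y → P (x + y)) (ht : ∀ α e, fc N α.support → P (tt κ N α e)) (x) : P x := by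
  have ht' : ∀ α e, P (tt κ N α e) := fun α e => by
    by_cases h : fc N α.support
    · exact ht α e h
    · rw [tt_zero_of h]; exact h0
  induction x using TensorProduct.induction_on with
  | zero => exact h0
  | add x y hx hy => exact ha x y hx hy
  | tmul e r =>
    obtain ⟨p, rfl⟩ := Ideal.Quotient.mk_surjective r
    induction p using MvPolynomial.monomial_add_induction_on with
    | C a =>
      have := ht' 0 (a • e)
      rw [tt_apply, TensorProduct.smul_tmul, mn] at this
      convert this using 2
      rw [← Ideal.Quotient.mkₐ_eq_mk κ, ← map_smul, MvPolynomial.smul_monomial]; simp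
    | monomial_add α a p _ _ ih =>
      rw [map_add, TensorProduct.tmul_add]
      refine ha _ _ ?_ ih
      have := ht' α (a • e)
      rw [tt_apply, TensorProduct.smul_tmul, mn] at this
      convert this using 2
      rw [← Ideal.Quotient.mkₐ_eq_mk κ, ← map_smul, MvPolynomial.smul_monomial]; simp
section op
variable {M : Type} [AddCommGroup M] [Module κ M]
open Classical in
noncomputable def opP (N : Set (Finset σ)) (T : (σ →₀ ℕ) → M) : MvPolynomial σ κ →ₗ[κ] M :=
  (MvPolynomial.basisMonomials σ κ).constr κ (fun α => if fc N α.support then T α else 0)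
open Classical in
theorem opP_mon (N : Set (Finset σ)) (T : (σ →₀ ℕ) → M) (α) :
    opP (κ := κ) N T (MvPolynomial.monomial α 1) = if fc N α.support then T α else 0 := by
  have := (MvPolynomial.basisMonomials σ κ).constr_basis κ
    (fun α => if fc N α.support then T α else 0) α
  rwa [MvPolynomial.coe_basisMonomials] at this
theorem opP_ideal (N : Set (Finset σ)) (T : (σ →₀ ℕ) → M) (p) (hp : p ∈ nfI κ N) :
    opP (κ := κ) N T p = 0 := by
  suffices h : ∀ q : MvPolynomial σ κ, opP (κ := κ) N T (q * p) = 0 by simpa using h 1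
  refine Submodule.span_induction ?_ ?_ ?_ ?_ hp
  · rintro x ⟨s, hs, rfl⟩ q
    simp only [prodX]
    induction q using MvPolynomial.induction_on' with
    | monomial α a =>
      rw [MvPolynomial.monomial_mul, mul_one, ← mul_one a, ← smul_eq_mul, ← MvPolynomial.smul_monomial,
        map_smul, opP_mon, if_neg, smul_zero]
      intro h
      refine h s hs ?_
      intro i hi
      rw [Finsupp.mem_support_iff, Finsupp.add_apply, s1_apply, if_pos hi]; omega
    | add p q hp hq => rw [add_mul, map_add, hp, hq, add_zero]
  · simp
  · intro x y _ _ hx hy q; rw [mul_add, map_add, hx, hy, add_zero]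
  · intro a x _ hx q; rw [smul_eq_mul, ← mul_assoc, hx]
theorem exists_sec (N : Set (Finset σ)) :
    ∃ s : (MvPolynomial σ κ ⧸ nfI κ N) →ₗ[κ] MvPolynomial σ κ,
      (Ideal.Quotient.mkₐ κ (nfI κ N)).toLinearMap ∘ₗ s = LinearMap.id :=
  LinearMap.exists_rightInverse_of_surjective _
    (LinearMap.range_eq_top.2 Ideal.Quotient.mk_surjective)
/-- linear map out of the Koszul algebra given on `e ⊗ v^α`, `α` face -/
noncomputable def op (N : Set (Finset σ)) (T : (σ →₀ ℕ) → EE κ σ →ₗ[κ] M) : KA κ N →ₗ[κ] M :=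
  TensorProduct.lift (LinearMap.flip (opP N T ∘ₗ (exists_sec N).choose))
open Classical in
theorem op_tt' (N : Set (Finset σ)) (T : (σ →₀ ℕ) → EE κ σ →ₗ[κ] M) (α e) :
    op N T (tt κ N α e) = if fc N α.support then T α e else 0 := by
  rw [op, tt_apply, TensorProduct.lift.tmul, LinearMap.flip_apply, LinearMap.comp_apply]
  have h := LinearMap.congr_fun (exists_sec (κ := κ) N).choose_spec (mn κ N α)
  set q := (exists_sec (κ := κ) N).choose (mn κ N α)
  have h2 : q - MvPolynomial.monomial α 1 ∈ nfI κ N := by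
    rw [← Ideal.Quotient.eq]; exact h
  have h3 := opP_ideal N T _ h2
  rw [map_sub, opP_mon, sub_eq_zero] at h3
  rw [h3]; split_ifs <;> simp
theorem op_tt {N : Set (Finset σ)} (T : (σ →₀ ℕ) → EE κ σ →ₗ[κ] M) {α} (h : fc N α.support) (e) :
    op N T (tt κ N α e) = T α e := by rw [op_tt', if_pos h]
end op
noncomputable def cff (N : Set (Finset σ)) : KA κ N →ₗ[κ] ((σ →₀ ℕ) →₀ EE κ σ) :=
  op N fun α => Finsupp.lsingle α
noncomputable def cf (N : Set (Finset σ)) (α : σ →₀ ℕ) : KA κ N →ₗ[κ] EE κ σ :=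
  Finsupp.lapply α ∘ₗ cff N
open Classical in
theorem cf_tt {N : Set (Finset σ)} (α β : σ →₀ ℕ) (h : fc N β.support) (e : EE κ σ) :
    cf N α (tt κ N β e) = if β = α then e else 0 := by
  rw [cf, LinearMap.comp_apply, cff, op_tt _ h]; simp [Finsupp.single_apply]
theorem cf_zero_of {N : Set (Finset σ)} {α : σ →₀ ℕ} (h : ¬ fc N α.support) (x : KA κ N) :
    cf N α x = 0 := by
  induction x using KA_ind with
  | h0 => simp
  | ha x y hx hy => rw [map_add, hx, hy, add_zero]
  | ht β e hβ => rw [cf_tt _ _ hβ, if_neg]; rintro rfl; exact h hβ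
theorem expand {N : Set (Finset σ)} (x : KA κ N) :
    x = ∑ α ∈ (cff N x).support, tt κ N α (cf N α x) := by
  change x = (cff N x).sum fun α e => tt κ N α e
  induction x using KA_ind with
  | h0 => simp
  | ha x y hx hy =>
    rw [map_add, Finsupp.sum_add_index' (by simp) (by simp), ← hx, ← hy]
  | ht β e hβ => rw [cff, op_tt _ hβ]; simp
theorem ext_cf {N : Set (Finset σ)} {x y : KA κ N} (h : ∀ α, fc N α.support → cf N α x = cf N α y) :
    x = y := by
  rw [← sub_eq_zero, expand (x - y)]
  refine Finset.sum_eq_zero fun α _ => ?_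
  by_cases hα : fc N α.support
  · rw [map_sub, h α hα, sub_self, map_zero]
  · rw [tt_zero_of hα]
/-- restricted induction -/
theorem KA_ind' {N : Set (Finset σ)} {P : KA κ N → Prop} (x : KA κ N) (h0 : P 0)
    (ha : ∀ x y, P x → P y → P (x + y))
    (ht : ∀ α, fc N α.support → cf N α x ≠ 0 → P (tt κ N α (cf N α x))) : P x := by
  rw [expand x]
  refine Finset.sum_induction _ P ha h0 ?_
  intro α hα
  have : cf N α x ≠ 0 := Finsupp.mem_support_iff.1 hα
  refine ht α ?_ this
  by_contra hf
  exact this (cf_zero_of hf x)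
/-! ### differential -/
noncomputable def kD (N : Set (Finset σ)) : KA κ N →ₗ[κ] KA κ N :=
  ∑ i : σ, TensorProduct.map (ct κ i)
    (LinearMap.mulLeft κ (Ideal.Quotient.mk (nfI κ N) (MvPolynomial.X i)))
noncomputable def kI (κ) [Field κ] (N : Set (Finset σ)) : KA κ N →ₐ[κ] KA κ N :=
  Algebra.TensorProduct.map (ev κ) (AlgHom.id κ _)
noncomputable abbrev ei (i : σ) : σ →₀ ℕ := Finsupp.single i 1
theorem kD_tt (N : Set (Finset σ)) (α e) :
    kD N (tt κ N α e) = ∑ i, tt κ N (α + ei i) (ct κ i e) := by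
  rw [kD, LinearMap.sum_apply]
  refine Finset.sum_congr rfl fun i _ => ?_
  rw [tt_apply, TensorProduct.map_tmul, tt_apply, LinearMap.mulLeft_apply, add_comm, ← mn_add]
  rfl
theorem kI_tt (N : Set (Finset σ)) (α e) : kI κ N (tt κ N α e) = tt κ N α (ev κ e) := by
  rw [tt_apply, kI, Algebra.TensorProduct.map_tmul]; rfl
theorem kD_kD (N : Set (Finset σ)) (x : KA κ N) : kD N (kD N x) = 0 := by
  induction x using KA_ind with
  | h0 => simp
  | ha x y hx hy => rw [map_add, map_add, hx, hy, add_zero]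
  | ht α e hα =>
    rw [kD_tt, map_sum]
    simp only [kD_tt]
    have h : ∀ y : KA κ N, y = -y → y = 0 := fun y hy => by
      have : (2 : κ) • y = 0 := by rw [two_smul]; nth_rewrite 1 [hy]; exact neg_add_cancel y
      exact (smul_eq_zero.1 this).resolve_left two_ne_zero
    apply h
    conv_rhs => rw [Finset.sum_comm]
    simp only [← Finset.sum_neg_distrib]
    refine Finset.sum_congr rfl fun i _ => Finset.sum_congr rfl fun j _ => ?_
    rw [ct_comm, map_neg, add_right_comm]
theorem kD_leib (N : Set (Finset σ)) (x y : KA κ N) :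
    kD N (x * y) = kD N x * y + kI κ N x * kD N y := by
  induction x using KA_ind with
  | h0 => simp
  | ha x x' hx hx' => simp only [map_add, add_mul, hx, hx']; abel
  | ht α e hα =>
    induction y using KA_ind with
    | h0 => simp
    | ha y y' hy hy' => simp only [map_add, mul_add, hy, hy']; abel
    | ht β f hβ =>
      rw [tt_mul, kD_tt, kD_tt, kD_tt, kI_tt, Finset.sum_mul, Finset.mul_sum, ← Finset.sum_add_distrib]
      refine Finset.sum_congr rfl fun i _ => ?_
      rw [tt_mul, tt_mul, ct_mul, map_add, add_right_comm, ← add_assoc α β, add_right_comm α (ei i)]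
/-- the Koszul dg algebra -/
noncomputable def kd (N : Set (Finset σ)) : DGA κ (KA κ N) where
  d := kD N
  inv := kI κ N
  d_d := kD_kD N
  leib := kD_leib N
  inv_inv x := by
    induction x using KA_ind with
    | h0 => simp
    | ha x y hx hy => rw [map_add, map_add, hx, hy]
    | ht α e hα => rw [kI_tt, kI_tt, ev_ev]
  d_inv x := by
    induction x using KA_ind with
    | h0 => simp
    | ha x y hx hy => simp only [map_add, hx, hy]; abel
    | ht α e hα =>
      rw [kI_tt, kD_tt, kD_tt, map_sum, ← Finset.sum_neg_distrib]
      refine Finset.sum_congr rfl fun i _ => ?_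
      rw [kI_tt, ev_ct, map_neg]
/-! ### filtration -/
noncomputable def Fil (N : Set (Finset σ)) (j : ℕ) : Submodule κ (KA κ N) where
  carrier := {x | ∀ α : σ →₀ ℕ, α.degree < j → cf N α x = 0}
  add_mem' := fun hx hy α h => by rw [map_add, hx α h, hy α h, add_zero]
  zero_mem' := fun α _ => map_zero _
  smul_mem' := fun r x hx α h => by rw [map_smul, hx α h, smul_zero]
theorem Fil_mono {N : Set (Finset σ)} {i j : ℕ} (h : i ≤ j) : (Fil N j : Submodule κ (KA κ N)) ≤ Fil N i :=
  fun _ hx α hα => hx α (by omega)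
theorem tt_mem_Fil (N : Set (Finset σ)) {j : ℕ} {α : σ →₀ ℕ} (h : j ≤ α.degree) (e : EE κ σ) :
    tt κ N α e ∈ Fil N j := by
  by_cases hf : fc N α.support
  · intro β hβ
    rw [cf_tt _ _ hf, if_neg]; rintro rfl; omega
  · rw [tt_zero_of hf]; exact zero_mem _
theorem Fil_ind {N : Set (Finset σ)} {j : ℕ} {P : KA κ N → Prop} (h0 : P 0)
    (ha : ∀ x y, P x → P y → P (x + y))
    (ht : ∀ α e, fc N α.support → j ≤ α.degree → P (tt κ N α e)) (x) (hx : x ∈ Fil N j) : P x := by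
  refine KA_ind' x h0 ha fun α hα h => ht α _ hα ?_
  by_contra hd
  exact h (hx α (by omega))
theorem Fil_mul {N : Set (Finset σ)} {i j k : ℕ} (hk : k ≤ i + j) {x y : KA κ N} (hx : x ∈ Fil N i)
    (hy : y ∈ Fil N j) : x * y ∈ Fil N k := by
  refine Fil_ind (P := fun x => x * y ∈ Fil N k) (by simp) ?_ ?_ x hx
  · intro a b h1 h2; rw [add_mul]; exact add_mem h1 h2
  intro α e _ hα
  refine Fil_ind (P := fun y => tt κ N α e * y ∈ Fil N k) (by simp) ?_ ?_ y hy
  · intro a b h1 h2; rw [mul_add]; exact add_mem h1 h2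
  intro β f _ hβ
  rw [tt_mul]
  exact tt_mem_Fil N (by rw [map_add]; omega) _
theorem Fil_d {N : Set (Finset σ)} {j : ℕ} {x : KA κ N} (hx : x ∈ Fil N j) : kD N x ∈ Fil N (j + 1) := by
  refine Fil_ind (P := fun x => kD N x ∈ Fil N (j+1)) (by simp) ?_ ?_ x hx
  · intro a b h1 h2; rw [map_add]; exact add_mem h1 h2
  intro α e _ hα
  rw [kD_tt]
  exact sum_mem fun i _ => tt_mem_Fil N (by rw [map_add, Finsupp.degree_single]; omega) _
theorem Fil_inv {N : Set (Finset σ)} {j : ℕ} {x : KA κ N} (hx : x ∈ Fil N j) : kI κ N x ∈ Fil N j := by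
  refine Fil_ind (P := fun x => kI κ N x ∈ Fil N j) (by simp) ?_ ?_ x hx
  · intro a b h1 h2; rw [map_add]; exact add_mem h1 h2
  intro α e _ hα
  rw [kI_tt]; exact tt_mem_Fil N hα _
open Classical in
/-- keep the part with `C α` -/
noncomputable def tr (N : Set (Finset σ)) (C : (σ →₀ ℕ) → Prop) : KA κ N →ₗ[κ] KA κ N :=
  op N fun α => if C α then tt κ N α else 0
open Classical in
theorem tr_tt (N : Set (Finset σ)) (C : (σ →₀ ℕ) → Prop) (α e) :
    tr N C (tt κ N α e) = if C α then tt κ N α e else 0 := by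
  by_cases h : fc N α.support
  · rw [tr, op_tt _ h]; split_ifs <;> simp
  · rw [tt_zero_of h]; simp
open Classical in
theorem cf_tr (N : Set (Finset σ)) (C : (σ →₀ ℕ) → Prop) (α) (x : KA κ N) :
    cf N α (tr N C x) = if C α then cf N α x else 0 := by
  induction x using KA_ind with
  | h0 => simp
  | ha x y hx hy => rw [map_add, map_add, map_add, hx, hy]; split_ifs <;> simp
  | ht β e hβ =>
    rw [tr_tt]
    by_cases h : β = α
    · subst h; split_ifs <;> simp
    · rw [cf_tt _ _ hβ, if_neg h]; split_ifs
      · rw [cf_tt _ _ hβ, if_neg h]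
      · rw [cf_tt _ _ hβ, if_neg h]
      · rw [map_zero]
      · rw [map_zero]
theorem tr_d (N : Set (Finset σ)) (j : ℕ) (x : KA κ N) :
    tr N (fun α => j + 1 ≤ α.degree) (kD N x) = kD N (tr N (fun α => j ≤ α.degree) x) := by
  induction x using KA_ind with
  | h0 => simp
  | ha x y hx hy => simp only [map_add, hx, hy]
  | ht β e hβ =>
    rw [tr_tt, kD_tt, map_sum]
    simp only [tr_tt, map_add, Finsupp.degree_single]
    by_cases h : j ≤ β.degree
    · simp [h, kD_tt]
    · simp [h]
theorem tr_fil {N : Set (Finset σ)} {j : ℕ} {x : KA κ N} (hx : x ∈ Fil N j) :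
    tr N (fun α => j ≤ α.degree) x = x := by
  refine ext_cf fun α _ => ?_
  rw [cf_tr]; split_ifs with h
  · rfl
  · exact (hx α (by omega)).symm
theorem tr_mem (N : Set (Finset σ)) (j : ℕ) (x : KA κ N) : tr N (fun α => j ≤ α.degree) x ∈ Fil N j := by
  intro α h; rw [cf_tr, if_neg (by omega)]
theorem bdry_fil {N : Set (Finset σ)} {j : ℕ} {x : KA κ N} (hx : x ∈ Fil N (j + 1))
    (h : x ∈ LinearMap.range (kD N)) : ∃ y ∈ Fil N j, kD N y = x := by
  obtain ⟨y, rfl⟩ := h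
  exact ⟨_, tr_mem N j y, by rw [← tr_d, tr_fil hx]⟩
open Classical in
theorem cf_d {N : Set (Finset σ)} {α : σ →₀ ℕ} (hα : fc N α.support) (x : KA κ N) :
    cf N α (kD N x) = ∑ i ∈ α.support, ct κ i (cf N (α - ei i) x) := by
  induction x using KA_ind with
  | h0 => simp
  | ha x y hx hy => simp only [map_add, hx, hy, Finset.sum_add_distrib]
  | ht β e hβ =>
    rw [kD_tt, map_sum]
    have h1 : ∀ i, cf N α (tt κ N (β + ei i) (ct κ i e)) = if β + ei i = α then ct κ i e else 0 := by
      intro i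
      by_cases h : β + ei i = α
      · rw [cf_tt _ _ (h ▸ hα)]
      · rw [if_neg h]
        by_cases h' : fc N (β + ei i).support
        · rw [cf_tt _ _ h', if_neg h]
        · rw [tt_zero_of h', map_zero]
    simp only [h1, cf_tt _ _ hβ]
    rw [← Finset.sum_subset (Finset.subset_univ α.support)]
    · refine Finset.sum_congr rfl fun i hi => ?_
      have : β + ei i = α ↔ β = α - ei i := by
        constructor
        · rintro rfl; simp
        · rintro rfl
          refine tsub_add_cancel_of_le ?_
          rw [Finsupp.single_le_iff]
          rw [Finsupp.mem_support_iff] at hi; omega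
      by_cases h : β + ei i = α
      · rw [if_pos h, if_pos (this.1 h)]
      · rw [if_neg h, if_neg (fun h' => h (this.2 h')), map_zero]
    · intro i _ hi
      rw [if_neg]; rintro rfl
      simp at hi
end KZ
namespace KZ
variable {κ : Type} [Field κ] [CharZero κ] {σ : Type} [Fintype σ] [DecidableEq σ]
variable (κ) in
def SS (N : Set (Finset σ)) : Prop := (kd (κ := κ) N).S (Fil N 1)
theorem Fil_zero (N : Set (Finset σ)) (x : KA κ N) : x ∈ Fil N 0 := fun α h => by omega
theorem dec_fil {N : Set (Finset σ)} {x : KA κ N} (h : (kd N).Dec (Fil N 1) x) : x ∈ Fil N 2 :=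
  h.mem (P2 := Fil N 2) (fun x hx => Fil_inv hx) (fun x hx y hy => Fil_mul (by omega) hx hy)
theorem SS_of {N : Set (Finset σ)}
    (h : ∀ x, (kd N).Dec (Fil N 1) x → kD N x = 0 → x ∈ Fil N 2 → x ∈ LinearMap.range (kD (κ := κ) N)) :
    SS κ N :=
  fun x hx => bdry_fil (dec_fil hx) (h x hx hx.cycle (dec_fil hx))
/-! ### functoriality -/
section hom
variable {τ : Type} [Fintype τ] [DecidableEq τ]
noncomputable def lX (M : Set (Finset τ)) (l : (σ → κ) →ₗ[κ] (τ → κ)) (i : σ) :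
    MvPolynomial τ κ ⧸ nfI κ M := ∑ w, l (Pi.single i 1) w • mn κ M (ei w)
def HomOK (N : Set (Finset σ)) (M : Set (Finset τ)) (l : (σ → κ) →ₗ[κ] (τ → κ)) : Prop :=
  ∀ s ∈ N, ∏ i ∈ s, lX M l i = 0
noncomputable def rhom {N : Set (Finset σ)} {M : Set (Finset τ)} {l : (σ → κ) →ₗ[κ] (τ → κ)}
    (h : HomOK N M l) : (MvPolynomial σ κ ⧸ nfI κ N) →ₐ[κ] (MvPolynomial τ κ ⧸ nfI κ M) :=
  Ideal.Quotient.liftₐ _ (MvPolynomial.aeval (lX M l)) (by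
    intro a ha
    have : nfI κ N ≤ RingHom.ker (MvPolynomial.aeval (lX M l)) := by
      rw [nfI, Ideal.span_le]
      rintro _ ⟨s, hs, rfl⟩
      have := h s hs
      simpa using this
    exact this ha)
noncomputable def hom {N : Set (Finset σ)} {M : Set (Finset τ)} {l : (σ → κ) →ₗ[κ] (τ → κ)}
    (h : HomOK N M l) : KA κ N →ₐ[κ] KA κ M :=
  Algebra.TensorProduct.map (ExteriorAlgebra.map l) (rhom h)
theorem rhom_X {N : Set (Finset σ)} {M : Set (Finset τ)} {l : (σ → κ) →ₗ[κ] (τ → κ)}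
    (h : HomOK N M l) (i : σ) : rhom h (mn κ N (ei i)) = lX M l i := by
  change rhom h (Ideal.Quotient.mk _ (MvPolynomial.X i)) = _
  rw [rhom]
  change (MvPolynomial.aeval (lX M l)) (MvPolynomial.X i) = _
  rw [MvPolynomial.aeval_X]
theorem hom_tt {N : Set (Finset σ)} {M : Set (Finset τ)} {l : (σ → κ) →ₗ[κ] (τ → κ)}
    (h : HomOK N M l) (α e) :
    hom h (tt κ N α e) = ExteriorAlgebra.map l e ⊗ₜ rhom h (mn κ N α) := rfl
theorem kD_tmul (N : Set (Finset σ)) (e : EE κ σ) (r) :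
    kD N (e ⊗ₜ r) = ∑ i, ct κ i e ⊗ₜ (mn κ N (ei i) * r) := by
  rw [kD, LinearMap.sum_apply]; rfl
theorem hom_d {N : Set (Finset σ)} {M : Set (Finset τ)} {l : (σ → κ) →ₗ[κ] (τ → κ)}
    (h : HomOK N M l) (x) : hom h (kD N x) = kD M (hom h x) := by
  induction x using KA_ind with
  | h0 => simp only [map_zero]
  | ha x y hx hy => simp only [map_add, hx, hy]
  | ht α e hα =>
    rw [hom_tt, tt_apply, kD_tmul, kD_tmul, map_sum]
    have h1 : ∀ w : τ, ct κ w (ExteriorAlgebra.map l e) =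
        ∑ i, l (Pi.single i 1) w • ExteriorAlgebra.map l (ct κ i e) := by
      intro w
      rw [ct_eq, map_cphi]
      have : (LinearMap.proj w ∘ₗ l : (σ → κ) →ₗ[κ] κ) =
          ∑ i, l (Pi.single i 1) w • LinearMap.proj i := by
        apply LinearMap.pi_ext'
        intro i
        ext
        simp [Pi.single_apply]
      rw [this]
      simp only [ct, cphi, map_sum, map_smul, LinearMap.sum_apply, LinearMap.smul_apply]
    have h2 : ∀ i, hom h (ct κ i e ⊗ₜ (mn κ N (ei i) * mn κ N α)) =
        ∑ w, l (Pi.single i 1) w • (ExteriorAlgebra.map l (ct κ i e) ⊗ₜ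
          (mn κ M (ei w) * rhom h (mn κ N α))) := by
      intro i
      rw [hom, Algebra.TensorProduct.map_tmul, map_mul, rhom_X, lX, Finset.sum_mul,
        TensorProduct.tmul_sum]
      simp only [smul_mul_assoc, TensorProduct.tmul_smul]
    simp only [h1, h2]
    rw [Finset.sum_comm]
    refine Finset.sum_congr rfl fun w _ => ?_
    rw [TensorProduct.sum_tmul]
    simp only [TensorProduct.smul_tmul']
theorem hom_inv {N : Set (Finset σ)} {M : Set (Finset τ)} {l : (σ → κ) →ₗ[κ] (τ → κ)}
    (h : HomOK N M l) (x) : hom h (kI κ N x) = kI κ M (hom h x) := by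
  induction x using KA_ind with
  | h0 => simp only [map_zero]
  | ha x y hx hy => simp only [map_add, hx, hy]
  | ht α e hα =>
    rw [kI_tt, hom_tt, hom_tt, kI, Algebra.TensorProduct.map_tmul, map_ev]; rfl
theorem hom_fil {N : Set (Finset σ)} {M : Set (Finset τ)} {l : (σ → κ) →ₗ[κ] (τ → κ)}
    (h : HomOK N M l) (x) (hx : x ∈ Fil N 1) : hom h x ∈ Fil M 1 := by
  refine Fil_ind (P := fun x => hom h x ∈ Fil M 1) (by simp only [map_zero, zero_mem]) ?_ ?_ x hx
  · intro a b ha hb; rw [map_add]; exact add_mem ha hb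
  · intro α e _ hα
    have : α ≠ 0 := by rintro rfl; simp at hα
    obtain ⟨i, hi⟩ := Finsupp.support_nonempty_iff.2 this
    obtain ⟨β, rfl⟩ := exists_add_of_le (show ei i ≤ α by
      rw [Finsupp.single_le_iff]; rw [Finsupp.mem_support_iff] at hi; omega)
    rw [hom_tt, ← mn_add, map_mul, rhom_X, lX, Finset.sum_mul, TensorProduct.tmul_sum]
    refine sum_mem fun w _ => ?_
    rw [smul_mul_assoc, TensorProduct.tmul_smul]
    refine Submodule.smul_mem _ _ ?_
    have : ∀ (e : EE κ τ) r, e ⊗ₜ (mn κ M (ei w) * r) = (tt κ M (ei w) 1 * (e ⊗ₜ r) : KA κ M) := by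
      intro e r
      rw [tt_apply, Algebra.TensorProduct.tmul_mul_tmul, one_mul]
    rw [this]
    exact Fil_mul (i := 1) (j := 0) (by omega) (tt_mem_Fil _ (by simp) _) (Fil_zero _ _)
theorem hom_dec {N : Set (Finset σ)} {M : Set (Finset τ)} {l : (σ → κ) →ₗ[κ] (τ → κ)}
    (h : HomOK N M l) {P} (hP : P ≤ Fil N 1) {x} (hx : (kd N).Dec P x) : (kd M).Dec (Fil M 1) (hom h x) :=
  hx.map (hom h) (hom_d h) (hom_inv h) fun x hx => hom_fil h x (hP hx)
theorem KA_hom_ext {N : Set (Finset σ)} {B : Type} [Ring B] [Algebra κ B] {f g : KA κ N →ₐ[κ] B}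
    (h1 : ∀ m, f (ExteriorAlgebra.ι κ m ⊗ₜ 1) = g (ExteriorAlgebra.ι κ m ⊗ₜ 1))
    (h2 : ∀ i, f (1 ⊗ₜ mn κ N (ei i)) = g (1 ⊗ₜ mn κ N (ei i))) : f = g := by
  apply Algebra.TensorProduct.ext
  · apply ExteriorAlgebra.hom_ext
    ext m
    exact h1 _
  · apply Ideal.Quotient.algHom_ext
    apply MvPolynomial.algHom_ext
    intro i
    exact h2 i
end hom
/-- same vertex set, fewer faces -/
theorem id_ok {N M : Set (Finset σ)} (h : ∀ t, fc M t → fc N t) :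
    HomOK N M (LinearMap.id : (σ → κ) →ₗ[κ] (σ → κ)) := by
  intro s hs
  have : ∀ i, lX M (LinearMap.id : (σ → κ) →ₗ[κ] (σ → κ)) i = mn κ M (ei i) := by
    intro i; simp [lX, Pi.single_apply]
  simp only [this]
  have h2 : ∏ i ∈ s, mn κ M (ei i) = mn κ M (s1 s) := by
    rw [mn, ← prodX, map_prod]; rfl
  rw [h2]
  apply mn_zero_of
  intro h3
  rw [s1_supp] at h3
  exact h s h3 s hs subset_rfl
variable (κ) in
noncomputable def qt {N M : Set (Finset σ)} (h : ∀ t, fc M t → fc N t) : KA κ N →ₐ[κ] KA κ M :=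
  hom (id_ok h)
theorem qt_tt {N M : Set (Finset σ)} (h : ∀ t, fc M t → fc N t) (α e) :
    qt κ h (tt κ N α e) = tt κ M α e := by
  have h1 : rhom (id_ok (κ := κ) h) = Ideal.Quotient.liftₐ _ (Ideal.Quotient.mkₐ κ (nfI κ M)) (by
      intro a ha
      have : nfI κ N ≤ nfI κ M := by
        rw [nfI, Ideal.span_le]
        rintro _ ⟨s, hs, rfl⟩
        have h4 : mn κ M (s1 s) = 0 := mn_zero_of fun h3 => by
          rw [s1_supp] at h3
          exact h s h3 s hs subset_rfl
        rw [mn, ← prodX] at h4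
        exact Ideal.Quotient.eq_zero_iff_mem.1 h4
      exact Ideal.Quotient.eq_zero_iff_mem.2 (this ha)) := by
    apply Ideal.Quotient.algHom_ext
    apply MvPolynomial.algHom_ext
    intro i
    refine (rhom_X (id_ok h) i).trans ?_
    simp [lX, Pi.single_apply]
    rfl
  rw [qt, hom_tt, h1, ExteriorAlgebra.map_id]
  rfl
theorem qt_d {N M : Set (Finset σ)} (h : ∀ t, fc M t → fc N t) (x : KA κ N) :
    qt κ h (kD N x) = kD M (qt κ h x) := hom_d _ x
theorem qt_dec {N M : Set (Finset σ)} (h : ∀ t, fc M t → fc N t) {x : KA κ N}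
    (hx : (kd N).Dec (Fil N 1) x) : (kd M).Dec (Fil M 1) (qt κ h x) := hom_dec _ le_rfl hx
theorem cf_qt {N M : Set (Finset σ)} (h : ∀ t, fc M t → fc N t) (x : KA κ N) {α}
    (hα : fc M α.support) : cf M α (qt κ h x) = cf N α x := by
  induction x using KA_ind with
  | h0 => simp only [map_zero]
  | ha x y hx hy => simp only [map_add, hx, hy]
  | ht β e hβ =>
    rw [qt_tt, cf_tt _ _ hβ]
    by_cases h1 : β = α
    · rw [cf_tt _ _ (h1 ▸ hα)]
    · rw [if_neg h1]
      by_cases h2 : fc M β.support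
      · rw [cf_tt _ _ h2, if_neg h1]
      · rw [tt_zero_of h2, map_zero]
theorem SS_congr {N M : Set (Finset σ)} (h : ∀ t, fc M t ↔ fc N t) (hS : SS κ N) : SS κ M := by
  refine SS_of fun x hx _ _ => ?_
  obtain ⟨y, hy, hyx⟩ := hS _ (qt_dec (fun t => (h t).2) hx)
  refine ⟨qt κ (fun t => (h t).1) y, ?_⟩
  rw [← qt_d]
  erw [hyx]
  refine ext_cf fun α hα => ?_
  rw [cf_qt _ _ hα, cf_qt _ _ ((h _).1 hα)]
end KZ
namespace KZ
variable {κ : Type} [Field κ] [CharZero κ] {σ : Type} [Fintype σ] [DecidableEq σ]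
theorem prod_mn (N : Set (Finset σ)) (s : Finset σ) : ∏ i ∈ s, mn κ N (ei i) = mn κ N (s1 s) := by
  rw [mn, ← prodX, map_prod]; rfl
theorem hom_iota {τ : Type} [Fintype τ] [DecidableEq τ] {N : Set (Finset σ)} {M : Set (Finset τ)}
    {l : (σ → κ) →ₗ[κ] (τ → κ)} (h : HomOK N M l) (m) :
    hom h (ExteriorAlgebra.ι κ m ⊗ₜ 1) = ExteriorAlgebra.ι κ (l m) ⊗ₜ 1 := by
  rw [hom, Algebra.TensorProduct.map_tmul, ExteriorAlgebra.map_apply_ι, map_one]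
theorem hom_X {τ : Type} [Fintype τ] [DecidableEq τ] {N : Set (Finset σ)} {M : Set (Finset τ)}
    {l : (σ → κ) →ₗ[κ] (τ → κ)} (h : HomOK N M l) (i) :
    hom h (1 ⊗ₜ mn κ N (ei i)) = 1 ⊗ₜ lX M l i := by
  rw [hom, Algebra.TensorProduct.map_tmul, rhom_X, map_one]
section kap
noncomputable def kap (κ) [Field κ] (N : Set (Finset σ)) (g : σ) : KA κ N →ₗ[κ] KA κ N :=
  TensorProduct.map (ct κ g) LinearMap.id
theorem kap_tt (N : Set (Finset σ)) (g : σ) (α e) : kap κ N g (tt κ N α e) = tt κ N α (ct κ g e) := rfl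
theorem ghost_step (N : Set (Finset σ)) (g : σ) (hg : ¬ fc N {g}) (P P' : Submodule κ (KA κ N))
    (hP' : ∀ x, x ∈ P' ↔ x ∈ P ∧ kap κ N g x = 0)
    (hkP : ∀ x ∈ P, kap κ N g x ∈ P) (huP : ∀ x ∈ P, tt κ N 0 (u κ g) * x ∈ P)
    (hinv : ∀ x ∈ P, kI κ N x ∈ P) (h : (kd N).S P') : (kd N).S P := by
  refine (kd N).S_ghost P P' (kap κ N g) (tt κ N 0 (u κ g)) ?_ ?_ ?_ ?_ ?_ ?_ ?_ ?_ ?_ hP' hkP huP hinv h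
  · intro x y
    change _ = _ + kI κ N x * _
    induction x using KA_ind with
    | h0 => simp
    | ha x x' hx hx' => simp only [map_add, add_mul, hx, hx']; abel
    | ht α e hα =>
      induction y using KA_ind with
      | h0 => simp
      | ha y y' hy hy' => simp only [map_add, mul_add, hy, hy']; abel
      | ht β f hβ =>
        rw [tt_mul, kap_tt, kap_tt, kap_tt, kI_tt, tt_mul, tt_mul, ct_mul, map_add]
  · rw [kap_tt, ct_u, if_pos rfl]
    rw [tt_apply, mn]; rfl
  · intro x
    change kap κ N g (kD N x) = - kD N _
    induction x using KA_ind with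
    | h0 => simp only [map_zero, neg_zero]
    | ha x x' hx hx' => simp only [map_add, hx, hx']; abel
    | ht α e hα =>
      rw [kap_tt, kD_tt, kD_tt, map_sum, ← Finset.sum_neg_distrib]
      refine Finset.sum_congr rfl fun i _ => ?_
      rw [kap_tt, ct_comm, map_neg]
  · intro x
    induction x using KA_ind with
    | h0 => simp only [map_zero]
    | ha x x' hx hx' => simp only [map_add, hx, hx', add_zero]
    | ht α e hα => rw [kap_tt, kap_tt, ct_ct, map_zero]
  · intro x
    change kap κ N g (kI κ N x) = - kI κ N _
    induction x using KA_ind with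
    | h0 => simp only [map_zero, neg_zero]
    | ha x x' hx hx' => simp only [map_add, hx, hx']; abel
    | ht α e hα => rw [kap_tt, kI_tt, kap_tt, kI_tt, ev_ct, map_neg]
  · intro x
    change _ = kI κ N x * _
    induction x using KA_ind with
    | h0 => simp only [map_zero, zero_mul, mul_zero]
    | ha x x' hx hx' => simp only [map_add, hx, hx', mul_add, add_mul]
    | ht α e hα => rw [kI_tt, tt_mul, tt_mul, u_mul_eq, add_comm]
  · rw [tt_mul, u_u, map_zero]
  · change kD N _ = 0
    rw [kD_tt]
    refine Finset.sum_eq_zero fun i _ => ?_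
    rw [ct_u]
    split_ifs with h
    · subst h
      rw [tt_zero_of]; simpa [Finsupp.support_single] using hg
    · rw [map_zero]
  · change kI κ N _ = _
    rw [kI_tt, ev_u, map_neg]
noncomputable def PG (κ) [Field κ] [CharZero κ] (N : Set (Finset σ)) (G : Finset σ) : Submodule κ (KA κ N) where
  carrier := {x | x ∈ Fil N 1 ∧ ∀ g ∈ G, kap κ N g x = 0}
  add_mem' := fun hx hy => ⟨add_mem hx.1 hy.1, fun g hg => by rw [map_add, hx.2 g hg, hy.2 g hg, add_zero]⟩
  zero_mem' := ⟨zero_mem _, fun g _ => map_zero _⟩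
  smul_mem' := fun r x hx => ⟨Submodule.smul_mem _ _ hx.1, fun g hg => by rw [map_smul, hx.2 g hg, smul_zero]⟩
theorem ghost_all (N : Set (Finset σ)) (G : Finset σ) (hG : ∀ g ∈ G, ¬ fc N {g})
    (h : (kd N).S (PG κ N G)) : SS κ N := by
  induction G using Finset.induction_on with
  | empty =>
    have : PG κ N ∅ = Fil N 1 := by
      ext x; exact ⟨fun h => h.1, fun h => ⟨h, by simp⟩⟩
    rw [this] at h; exact h
  | insert g G hg ih =>
    refine ih (fun g hg => hG g (by simp [hg])) ?_
    refine ghost_step N g (hG g (by simp)) _ _ ?_ ?_ ?_ ?_ h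
    · intro x
      constructor
      · intro hx; exact ⟨⟨hx.1, fun g' hg' => hx.2 g' (by simp [hg'])⟩, hx.2 g (by simp)⟩
      · intro hx; refine ⟨hx.1.1, fun g' hg' => ?_⟩
        rcases Finset.mem_insert.1 hg' with rfl | h'
        · exact hx.2
        · exact hx.1.2 g' h'
    · intro x hx
      refine ⟨?_, fun g' hg' => ?_⟩
      · refine Fil_ind (P := fun x => kap κ N g x ∈ Fil N 1) (by simp only [map_zero, zero_mem]) ?_ ?_ x hx.1
        · intro a b ha hb; rw [map_add]; exact add_mem ha hb
        · intro α e _ hα; rw [kap_tt]; exact tt_mem_Fil _ hα _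
      · have : ∀ x, kap κ N g' (kap κ N g x) = - kap κ N g (kap κ N g' x) := by
          intro x
          induction x using KA_ind with
          | h0 => simp only [map_zero, neg_zero]
          | ha x x' hx hx' => simp only [map_add, hx, hx']; abel
          | ht α e hα => rw [kap_tt, kap_tt, kap_tt, kap_tt, ct_comm, map_neg]
        rw [this, hx.2 g' hg', map_zero, neg_zero]
    · intro x hx
      refine ⟨Fil_mul (i := 0) (j := 1) (by omega) (Fil_zero _ _) hx.1, fun g' hg' => ?_⟩
      have : ∀ x, kap κ N g' (tt κ N 0 (u κ g) * x) = - (tt κ N 0 (u κ g) * kap κ N g' x) := by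
        intro x
        induction x using KA_ind with
        | h0 => simp only [map_zero, mul_zero, neg_zero]
        | ha x x' hx hx' => simp only [map_add, mul_add, hx, hx']; abel
        | ht α e hα =>
          rw [tt_mul, kap_tt, kap_tt, tt_mul, ct_u_mul_ne, map_neg]
          rintro rfl; exact hg hg'
      rw [this, hx.2 g' hg', mul_zero, neg_zero]
    · intro x hx
      refine ⟨Fil_inv hx.1, fun g' hg' => ?_⟩
      have : ∀ x, kap κ N g' (kI κ N x) = - kI κ N (kap κ N g' x) := by
        intro x
        induction x using KA_ind with
        | h0 => simp only [map_zero, neg_zero]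
        | ha x x' hx hx' => simp only [map_add, hx, hx']; abel
        | ht α e hα => rw [kap_tt, kI_tt, kap_tt, kI_tt, ev_ct, map_neg]
      rw [this, hx.2 g' hg', map_zero, neg_zero]
end kap
section emb
variable {τ : Type} [Fintype τ] [DecidableEq τ] {N : Set (Finset σ)} {M : Set (Finset τ)} (j : σ ↪ τ)
variable (N M) in
def EmbOK : Prop := ∀ t, fc M t ↔ ∃ s, fc N s ∧ t = s.map j
theorem lX_p (w : τ) : lX N (LinearMap.funLeft κ κ j) w = ∑ i, if j i = w then mn κ N (ei i) else 0 := by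
  refine Finset.sum_congr rfl fun i _ => ?_
  rw [LinearMap.funLeft_apply, Pi.single_apply]; split_ifs <;> simp
theorem lX_p' (i : σ) : lX N (LinearMap.funLeft κ κ j) (j i) = mn κ N (ei i) := by
  rw [lX_p j]; simp
theorem lX_i (i : σ) : lX M (Function.ExtendByZero.linearMap κ j) i = mn κ M (ei (j i)) := by
  rw [lX, Finset.sum_eq_single (j i)]
  · change Function.extend j (Pi.single i (1:κ)) 0 (j i) • _ = _
    rw [j.injective.extend_apply]; simp
  · intro w _ hw
    have : Function.extend j (Pi.single i (1:κ)) 0 w = 0 := by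
      by_cases h : ∃ i', j i' = w
      · obtain ⟨i', rfl⟩ := h
        rw [j.injective.extend_apply, Pi.single_apply, if_neg]; rintro rfl; exact hw rfl
      · rw [Function.extend_apply' _ _ _ h]; rfl
    change Function.extend j (Pi.single i (1:κ)) 0 w • _ = _
    rw [this, zero_smul]
  · simp
variable (κ) in
theorem p_ok (hj : EmbOK N M j) : HomOK M N (LinearMap.funLeft κ κ j) := by
  intro s hs
  by_cases h : ∃ w ∈ s, ∀ i, j i ≠ w
  · obtain ⟨w, hw, hi⟩ := h
    refine Finset.prod_eq_zero hw ?_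
    rw [lX_p j]
    exact Finset.sum_eq_zero fun i _ => if_neg (hi i)
  · push Not at h
    have : ∃ s' : Finset σ, s = s'.map j := by
      refine ⟨s.preimage j j.injective.injOn, ?_⟩
      ext w; simp only [mem_map, mem_preimage]
      constructor
      · intro hw; obtain ⟨i, rfl⟩ := h w hw; exact ⟨i, hw, rfl⟩
      · rintro ⟨i, hi, rfl⟩; exact hi
    obtain ⟨s', rfl⟩ := this
    rw [Finset.prod_map]
    simp only [lX_p' j]
    rw [prod_mn]
    apply mn_zero_of
    intro h2
    rw [s1_supp] at h2
    exact (hj _).2 ⟨s', h2, rfl⟩ _ hs subset_rfl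
variable (κ) in
theorem i_ok (hj : EmbOK N M j) : HomOK N M (Function.ExtendByZero.linearMap κ j) := by
  intro s hs
  simp only [lX_i j]
  rw [← Finset.prod_map s j (fun w => mn κ M (ei w)), prod_mn]
  apply mn_zero_of
  intro h2
  rw [s1_supp, hj _] at h2
  obtain ⟨s', hs', h3⟩ := h2
  rw [Finset.map_inj] at h3
  subst h3
  exact hs' s hs subset_rfl
theorem pi_eq (hj : EmbOK N M j) (x : KA κ N) : hom (p_ok κ j hj) (hom (i_ok κ j hj) x) = x := by
  have : (hom (p_ok κ j hj)).comp (hom (i_ok κ j hj)) = AlgHom.id κ _ := by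
    apply KA_hom_ext
    · intro m
      rw [AlgHom.comp_apply, hom_iota, hom_iota]
      congr 2
      ext i
      exact j.injective.extend_apply m 0 i
    · intro i
      rw [AlgHom.comp_apply, hom_X, lX_i j, hom_X, lX_p' j]; rfl
  exact DFunLike.congr_fun this x
theorem ip_eq (hj : EmbOK N M j) (α e) : hom (i_ok κ j hj) (hom (p_ok κ j hj) (tt κ M α e)) =
    tt κ M α (ExteriorAlgebra.map (kl (Finset.univ.filter fun w => ∀ i, j i ≠ w)) e) := by
  set G := Finset.univ.filter fun w => ∀ i, j i ≠ w
  have h1 : (hom (i_ok κ j hj)).comp (hom (p_ok κ j hj)) =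
      Algebra.TensorProduct.map (ExteriorAlgebra.map (kl G)) (AlgHom.id κ _) := by
    apply KA_hom_ext
    · intro m
      rw [AlgHom.comp_apply, hom_iota, hom_iota, Algebra.TensorProduct.map_tmul,
        ExteriorAlgebra.map_apply_ι, map_one]
      congr 2
      ext w
      change Function.extend j (m ∘ j) 0 w = _
      by_cases h : ∃ i', j i' = w
      · obtain ⟨i', rfl⟩ := h
        rw [j.injective.extend_apply]; simp [kl, G]
      · rw [Function.extend_apply' _ _ _ h]; push Not at h; simp [kl, G, h]
    · intro w
      rw [AlgHom.comp_apply, hom_X, Algebra.TensorProduct.map_tmul, map_one]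
      by_cases h : ∃ i', j i' = w
      · obtain ⟨i', rfl⟩ := h
        rw [lX_p' j, hom_X, lX_i j]; rfl
      · push Not at h
        rw [lX_p j, Finset.sum_eq_zero fun i _ => if_neg (h i), TensorProduct.tmul_zero, map_zero,
          mn_zero_of, map_zero, TensorProduct.tmul_zero]
        intro h2
        obtain ⟨s, hs, h3⟩ := (hj _).1 h2
        have : w ∈ s.map j := by rw [← h3]; simp
        obtain ⟨i, _, hi⟩ := Finset.mem_map.1 this
        exact h i hi
  have := DFunLike.congr_fun h1 (tt κ M α e)
  exact this
theorem SS_emb (hj : EmbOK N M j) : SS κ N ↔ SS κ M := by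
  constructor
  · intro h
    refine ghost_all M (Finset.univ.filter fun w => ∀ i, j i ≠ w) ?_ ?_
    · intro w hw h2
      obtain ⟨s, hs, h3⟩ := (hj _).1 h2
      have : w ∈ s.map j := by rw [← h3]; simp
      obtain ⟨i, _, hi⟩ := Finset.mem_map.1 this
      simp at hw
      exact hw i hi
    · intro x hx
      obtain ⟨y, hy, hyx⟩ := h _ (hom_dec (p_ok κ j hj) (P := PG κ M (Finset.univ.filter fun w => ∀ i, j i ≠ w)) (fun z hz => hz.1) hx)
      have hxP : x ∈ PG κ M (Finset.univ.filter fun w => ∀ i, j i ≠ w) := by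
        obtain ⟨p, a, ha, rfl⟩ := hx
        refine Submodule.sum_mem _ fun k hk => ?_
        rw [Finset.mem_Ioo] at hk
        have h1 := (ha 0 k (by omega) (by omega) (by omega)).1
        have h2 := (ha k p (by omega) (by omega) (by omega)).1
        refine ⟨Fil_mul (i := 0) (j := 1) (by omega) (Fil_zero _ _) h2.1, fun g hg => ?_⟩
        have hkm : ∀ x y : KA κ M, kap κ M g (x * y) = kap κ M g x * y + kI κ M x * kap κ M g y := by
          intro x y
          induction x using KA_ind with
          | h0 => simp
          | ha x x' hx hx' => simp only [map_add, add_mul, hx, hx']; abel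
          | ht α e hα =>
            induction y using KA_ind with
            | h0 => simp
            | ha y y' hy hy' => simp only [map_add, mul_add, hy, hy']; abel
            | ht β f hβ =>
              rw [tt_mul, kap_tt, kap_tt, kap_tt, kI_tt, tt_mul, tt_mul, ct_mul, map_add]
        have hki : ∀ x, kap κ M g (kI κ M x) = - kI κ M (kap κ M g x) := by
          intro x
          induction x using KA_ind with
          | h0 => simp only [map_zero, neg_zero]
          | ha x x' hx hx' => simp only [map_add, hx, hx']; abel
          | ht α e hα => rw [kap_tt, kI_tt, kap_tt, kI_tt, ev_ct, map_neg]
        rw [neg_mul, map_neg, hkm, h2.2 g hg]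
        have : kap κ M g ((kd M).inv (a 0 k)) = 0 := by
          refine (hki _).trans ?_
          rw [h1.2 g hg, map_zero, neg_zero]
        rw [this]; simp
      have key : ∀ z : KA κ M, (∀ g ∈ Finset.univ.filter (fun w => ∀ i, j i ≠ w), kap κ M g z = 0) →
          hom (i_ok κ j hj) (hom (p_ok κ j hj) z) = z := by
        intro z hz
        have h4 : ∀ g ∈ Finset.univ.filter (fun w => ∀ i, j i ≠ w), ∀ α, ct κ g (cf M α z) = 0 := by
          intro g hg α
          have : cf M α (kap κ M g z) = ct κ g (cf M α z) := by
            clear hz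
            induction z using KA_ind with
            | h0 => simp only [map_zero]
            | ha x x' hx hx' => simp only [map_add, hx, hx']
            | ht β e hβ =>
              rw [kap_tt, cf_tt _ _ hβ, cf_tt _ _ hβ]; split_ifs <;> simp
          rw [← this, hz g hg, map_zero]
        conv_lhs => rw [expand z]
        conv_rhs => rw [expand z]
        rw [map_sum, map_sum]
        refine Finset.sum_congr rfl fun α _ => ?_
        rw [ip_eq j hj, map_kl_eq _ _ fun g hg => h4 g hg α]
      refine ⟨hom (i_ok κ j hj) y, ⟨hom_fil _ _ hy, fun g hg => ?_⟩, ?_⟩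
      · rw [← pi_eq j hj y]
        generalize hom (i_ok κ j hj) y = z
        induction z using KA_ind with
        | h0 => simp only [map_zero]
        | ha x x' hx hx' => simp only [map_add, hx, hx', add_zero]
        | ht α e hα =>
          rw [ip_eq j hj, kap_tt, ct_eq, map_cphi]
          have : (LinearMap.proj g ∘ₗ kl (Finset.univ.filter (fun w => ∀ i, j i ≠ w)) : (τ → κ) →ₗ[κ] κ) = 0 := by
            apply LinearMap.ext; intro m; exact if_pos hg
          rw [this]
          simp [cphi]
      · change kD M _ = x
        rw [← hom_d]
        refine (congrArg (hom (i_ok κ j hj)) hyx).trans (key x hxP.2)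
  · intro h
    refine SS_of fun x hx _ _ => ?_
    obtain ⟨y, hy, hyx⟩ := h _ (hom_dec (i_ok κ j hj) le_rfl hx)
    refine ⟨hom (p_ok κ j hj) y, ?_⟩
    rw [← hom_d]
    exact (congrArg (hom (p_ok κ j hj)) hyx).trans (pi_eq j hj x)
end emb
end KZ
namespace KZ
variable {κ : Type} [Field κ] [CharZero κ]
def NK {V : Type} [Fintype V] (K : SimComplex V) : Set (Finset K.VertexType) :=
  {s | s.Nonempty ∧ s.map (Function.Embedding.subtype _) ∉ K.faces}
theorem fc_NK {V : Type} [Fintype V] (K : SimComplex V) (t : Finset K.VertexType) :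
    fc (NK K) t ↔ t = ∅ ∨ t.map (Function.Embedding.subtype _) ∈ K.faces := by
  constructor
  · intro h
    rcases t.eq_empty_or_nonempty with h0 | h0
    · exact Or.inl h0
    · right; by_contra h1
      exact h t ⟨h0, h1⟩ subset_rfl
  · rintro (rfl | h) s hs hst
    · exact hs.1.ne_empty (Finset.subset_empty.1 hst)
    · exact hs.2 (K.down_closed h (Finset.map_subset_map.2 hst) (hs.1.map))
section aug
variable {σ : Type} [Fintype σ] [DecidableEq σ]
noncomputable def augE (κ σ : Type) [Field κ] : EE κ σ →ₐ[κ] κ := CliffordAlgebra.lift _ ⟨0, fun m => by simp⟩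
end aug
variable {V : Type} [Fintype V] (K : SimComplex V) [DecidableEq K.VertexType]
theorem aug_cf (x : KA κ (NK K)) : K.koszulAug κ x = augE κ _ (cf (NK K) 0 x) := by
  induction x using KA_ind with
  | h0 => simp only [map_zero]; exact map_zero _
  | ha x y hx hy => simp only [map_add, ← hx, ← hy]; exact map_add _ _ _
  | ht α e hα =>
    rw [cf_tt _ _ hα, tt_apply, mn]
    refine (Algebra.TensorProduct.lift_tmul _ _ _ _ _).trans ?_
    change _ * (MvPolynomial.aeval fun _ => (0 : κ)) (MvPolynomial.monomial α 1) = _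
    rw [MvPolynomial.aeval_monomial]
    split_ifs with h
    · subst h; simp; rfl
    · obtain ⟨i, hi⟩ := Finsupp.support_nonempty_iff.2 h
      rw [Finsupp.prod, Finset.prod_eq_zero hi (zero_pow (Finsupp.mem_support_iff.1 hi))]
      simp
theorem bar_eq (x : KA κ (NK K)) : K.koszulBar κ x = - kI κ (NK K) x := rfl
theorem mem_P {x : KA κ (NK K)} (h0 : K.koszulAug κ x = 0) (hd : kD (NK K) x ∈ Fil (NK K) 2) :
    x ∈ Fil (NK K) 1 := by
  intro α hα
  have : α = 0 := by rw [← Finsupp.degree_eq_zero_iff]; omega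
  subst this
  have h1 : ∀ i, ct κ i (cf (NK K) 0 x) = 0 := by
    intro i
    have h2 : fc (NK K) (ei i).support := by
      rw [fc_NK]; right
      rw [Finsupp.support_single _ one_ne_zero, Finset.map_singleton]
      exact i.2
    have h3 := cf_d h2 x
    rw [hd _ (by simp), Finsupp.support_single _ one_ne_zero, Finset.sum_singleton, tsub_self] at h3
    exact h3.symm
  obtain ⟨r, hr⟩ := eq_algebraMap_of_ct _ h1
  rw [aug_cf, hr, AlgHom.commutes] at h0
  rw [hr]
  have : r = 0 := h0
  rw [this, map_zero]
theorem aug_P {x : KA κ (NK K)} (hx : x ∈ Fil (NK K) 1) : K.koszulAug κ x = 0 := by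
  rw [aug_cf, hx 0 (by simp), map_zero]
theorem golod_def : K.IsGolod κ ↔ ∃ (Z : Set (KA κ (NK K))) (μ : List (KA κ (NK K)) → KA κ (NK K)),
    (∀ z ∈ Z, kD (NK K) z = 0 ∧ K.koszulAug κ z = 0) ∧
    (∀ x : KA κ (NK K), kD (NK K) x = 0 → K.koszulAug κ x = 0 →
      x ∈ Submodule.span κ Z ⊔ LinearMap.range (kD (NK K))) ∧
    (∀ z ∈ Z, μ [z] = z) ∧
    (∀ l : List (KA κ (NK K)), 2 ≤ l.length → (∀ z ∈ l, z ∈ Z) →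
      K.koszulAug κ (μ l) = 0 ∧
      kD (NK K) (μ l) =
        ∑ j ∈ Finset.Ioo 0 l.length, -(kI κ (NK K) (μ (l.take j))) * μ (l.drop j)) := Iff.rfl
theorem golod_iff : K.IsGolod κ ↔ SS κ (NK K) := by
  rw [golod_def]
  constructor
  · rintro ⟨Z, μ, hZ, hspan, h1, hμ⟩
    refine (kd (NK K)).S_of_G _ (fun x hx => Fil_inv hx)
      (fun x y hy => Fil_mul (i := 0) (j := 1) (by omega) (Fil_zero _ _) hy)
      (fun x hx y => Fil_mul (i := 1) (j := 0) (by omega) hx (Fil_zero _ _)) ⟨Z, μ, ?_, ?_, h1, ?_⟩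
    · intro z hz
      refine ⟨mem_P K (hZ z hz).2 ?_, (hZ z hz).1⟩
      have := (hZ z hz).1
      rw [this]; exact zero_mem _
    · intro x hx hd
      exact hspan x hd (aug_P K hx)
    · intro l hl hlZ
      have main : ∀ n, ∀ l : List (KA κ (NK K)), l.length ≤ n → l ≠ [] → (∀ z ∈ l, z ∈ Z) → μ l ∈ Fil (NK K) 1 := by
        intro n
        induction n with
        | zero => intro l hl h0; exact absurd (List.length_eq_zero_iff.1 (by omega)) h0
        | succ n ih =>
          intro l hl h0 hlZ
          by_cases h2 : 2 ≤ l.length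
          · obtain ⟨ha, hd⟩ := hμ l h2 hlZ
            refine mem_P K ha ?_
            rw [hd]
            refine sum_mem fun j hj => ?_
            rw [Finset.mem_Ioo] at hj
            rw [neg_mul]
            refine neg_mem (Fil_mul (i := 1) (j := 1) (by omega) (Fil_inv (ih _ ?_ ?_ ?_)) (ih _ ?_ ?_ ?_))
            · rw [List.length_take]; omega
            · rw [Ne, ← List.length_eq_zero_iff, List.length_take]; omega
            · intro z hz; exact hlZ z (List.mem_of_mem_take hz)
            · rw [List.length_drop]; omega
            · rw [Ne, ← List.length_eq_zero_iff, List.length_drop]; omega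
            · intro z hz; exact hlZ z (List.mem_of_mem_drop hz)
          · have : l.length = 1 := by
              have := List.length_pos_iff.2 h0; omega
            obtain ⟨z, rfl⟩ := List.length_eq_one_iff.1 this
            have hz := hlZ z (by simp)
            rw [h1 z hz]
            have := (hZ z hz).1
            refine mem_P K (hZ z hz).2 ?_
            rw [this]; exact zero_mem _
      refine ⟨main _ l le_rfl hl hlZ, ?_⟩
      by_cases h2 : 2 ≤ l.length
      · exact (hμ l h2 hlZ).2
      · have : l.length = 1 := by
          have := List.length_pos_iff.2 hl; omega
        obtain ⟨z, rfl⟩ := List.length_eq_one_iff.1 this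
        have hz := hlZ z (by simp)
        rw [h1 z hz]
        refine ((hZ z hz).1).trans ?_
        have : Finset.Ioo 0 [z].length = ∅ := rfl
        rw [this, Finset.sum_empty]
  · intro h
    obtain ⟨Z, μ, hZ, hspan, h1, hμ⟩ := (kd (NK K)).G_of_S _ h
    refine ⟨Z, μ, ?_, ?_, h1, ?_⟩
    · intro z hz; exact ⟨(hZ z hz).2, aug_P K (hZ z hz).1⟩
    · intro x hd ha
      refine hspan x (mem_P K ha ?_) hd
      rw [hd]; exact zero_mem _
    · intro l hl hlZ
      have h0 : l ≠ [] := by rintro rfl; simp at hl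
      exact ⟨aug_P K (hμ l h0 hlZ).1, (hμ l h0 hlZ).2⟩
/-- Golodness expressed on an arbitrary larger vertex set -/
theorem golod_emb {W : Type} [Fintype W] [DecidableEq W] (N : Set (Finset W)) (j : V ↪ W)
    (h : ∀ t, fc N t ↔ t = ∅ ∨ ∃ s ∈ K.faces, t = s.map j) : K.IsGolod κ ↔ SS κ N := by
  rw [golod_iff]
  refine SS_emb ((Function.Embedding.subtype _).trans j) ?_
  intro t
  rw [h]
  constructor
  · rintro (rfl | ⟨s, hs, rfl⟩)
    · exact ⟨∅, (fc_NK K _).2 (Or.inl rfl), rfl⟩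
    · have hv : ∀ v ∈ s, {v} ∈ K.faces := fun v hv =>
        K.down_closed hs (Finset.singleton_subset_iff.2 hv) (Finset.singleton_nonempty v)
      have : ∃ s' : Finset K.VertexType, s = s'.map (Function.Embedding.subtype _) := by
        classical
        refine ⟨s.subtype _, ?_⟩
        rw [Finset.subtype_map, Finset.filter_true_of_mem hv]
      obtain ⟨s', rfl⟩ := this
      exact ⟨s', (fc_NK K _).2 (Or.inr hs), by rw [Finset.map_map]⟩
  · rintro ⟨s, hs, rfl⟩
    rcases (fc_NK K _).1 hs with rfl | hs
    · left; rfl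
    · right; exact ⟨_, hs, by rw [Finset.map_map]⟩
end KZ
namespace KZ
variable {κ : Type} [Field κ] [CharZero κ] {σ : Type} [Fintype σ] [DecidableEq σ]
/-- `pu g e = ι_g (u_g e)` -/
noncomputable def pu (κ : Type) [Field κ] (g : σ) : EE κ σ →ₗ[κ] EE κ σ := ct κ g ∘ₗ LinearMap.mulLeft κ (u κ g)
theorem pu_apply (g : σ) (e : EE κ σ) : pu κ g e = ct κ g (u κ g * e) := rfl
theorem pu_eq (g : σ) (e : EE κ σ) : pu κ g e = e - u κ g * ct κ g e := ct_u_mul_self g e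
theorem pu_add (g : σ) (e : EE κ σ) : pu κ g e + u κ g * ct κ g e = e := by rw [pu_eq]; abel
theorem u_pu (g : σ) (e : EE κ σ) : u κ g * pu κ g e = u κ g * e := by
  rw [pu_eq, mul_sub, u_u_mul, sub_zero]
theorem ct_pu (g : σ) (e : EE κ σ) : ct κ g (pu κ g e) = 0 := by rw [pu_apply, ct_ct]
theorem ct_pu_ne {g i : σ} (h : i ≠ g) (e : EE κ σ) : ct κ i (pu κ g e) = pu κ g (ct κ i e) := by
  rw [pu_apply, ct_comm, ct_u_mul_ne h, map_neg, neg_neg, pu_apply]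
theorem u_ct {g i : σ} (h : i ≠ g) (e : EE κ σ) : u κ g * ct κ i e = - ct κ i (u κ g * e) := by
  rw [ct_u_mul_ne h, neg_neg]
theorem u_pu_ne {g i : σ} (h : i ≠ g) (e : EE κ σ) : u κ i * pu κ g e = pu κ g (u κ i * e) := by
  rw [pu_apply, u_ct h.symm, u_comm, map_neg, neg_neg, pu_apply]
theorem pu_of_ct {g : σ} {e : EE κ σ} (h : ct κ g e = 0) : pu κ g e = e := by
  rw [pu_eq, h, mul_zero, sub_zero]
theorem sub_add_ei {α : σ →₀ ℕ} {i : σ} (h : α i ≠ 0) : α - ei i + ei i = α := by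
  ext j; by_cases hj : i = j
  · subst hj; simp; omega
  · simp [Finsupp.single_apply, hj]
theorem deg_add (α β : σ →₀ ℕ) : (α + β).degree = α.degree + β.degree := map_add _ _ _
theorem deg_ei (i : σ) : (ei i).degree = 1 := by simp
theorem supp_add (α : σ →₀ ℕ) (g : σ) : (α + ei g).support = insert g α.support := by
  ext j; by_cases hj : g = j
  · subst hj; simp
  · simp [Finsupp.single_apply, hj, Ne.symm hj]
/-- diagonal operators -/
noncomputable def dg (N : Set (Finset σ)) (L : (σ →₀ ℕ) → EE κ σ →ₗ[κ] EE κ σ) : KA κ N →ₗ[κ] KA κ N :=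
  op N fun α => tt κ N α ∘ₗ L α
theorem cf_dg (N : Set (Finset σ)) (L : (σ →₀ ℕ) → EE κ σ →ₗ[κ] EE κ σ) (α) (x : KA κ N) :
    cf N α (dg N L x) = L α (cf N α x) := by
  induction x using KA_ind with
  | h0 => simp
  | ha x y hx hy => simp only [map_add, hx, hy]
  | ht β e hβ =>
    rw [dg, op_tt _ hβ, LinearMap.comp_apply, cf_tt _ _ hβ, cf_tt _ _ hβ]
    split_ifs with h
    · rw [h]
    · rw [map_zero]
theorem dg_fil {N : Set (Finset σ)} {L : (σ →₀ ℕ) → EE κ σ →ₗ[κ] EE κ σ} {j} {x : KA κ N}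
    (hx : x ∈ Fil N j) : dg N L x ∈ Fil N j := fun α h => by rw [cf_dg, hx α h, map_zero]
open Classical in
noncomputable def hh (N : Set (Finset σ)) (g : σ) (C : (σ →₀ ℕ) → Prop) : KA κ N →ₗ[κ] KA κ N :=
  op N fun α => if C α ∧ α g ≠ 0 then tt κ N (α - ei g) ∘ₗ LinearMap.mulLeft κ (u κ g) else 0
open Classical in
theorem cf_hh (N : Set (Finset σ)) (g : σ) (C : (σ →₀ ℕ) → Prop) (β) (x : KA κ N) :
    cf N β (hh N g C x) = if C (β + ei g) then u κ g * cf N (β + ei g) x else 0 := by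
  induction x using KA_ind with
  | h0 => simp
  | ha x y hx hy => simp only [map_add, hx, hy, mul_add]; split_ifs <;> simp
  | ht α e hα =>
    rw [hh, op_tt _ hα, cf_tt _ _ hα]
    by_cases h1 : α g = 0
    · rw [if_neg (by tauto)]
      have : ¬ α = β + ei g := by rintro rfl; simp at h1
      rw [if_neg this]; simp
    · have h2 : fc N (α - ei g).support := hα.mono (Finsupp.support_mono tsub_le_self)
      by_cases h3 : α = β + ei g
      · subst h3
        rw [if_pos rfl]
        split_ifs with h4 h5 h5
        · rw [LinearMap.comp_apply, cf_tt _ _ h2, if_pos (by simp)]; rfl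
        · tauto
        · tauto
        · simp
      · rw [if_neg h3]
        have : ¬ α - ei g = β := by
          intro h; apply h3; rw [← h, sub_add_ei h1]
        split_ifs
        · rw [LinearMap.comp_apply, cf_tt _ _ h2, if_neg this, mul_zero]
        · rw [LinearMap.comp_apply, cf_tt _ _ h2, if_neg this]
        · simp
        · simp
noncomputable def HD (N : Set (Finset σ)) (g : σ) (C : (σ →₀ ℕ) → Prop) : KA κ N →ₗ[κ] KA κ N :=
  kD N ∘ₗ hh N g C + hh N g C ∘ₗ kD N
theorem HD_apply (N : Set (Finset σ)) (g : σ) (C : (σ →₀ ℕ) → Prop) (x : KA κ N) :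
    HD N g C x = kD N (hh N g C x) + hh N g C (kD N x) := rfl
open Classical in
theorem cf_HD {N : Set (Finset σ)} (g : σ) (C : (σ →₀ ℕ) → Prop) {α : σ →₀ ℕ} (hα : fc N α.support)
    (x : KA κ N) : cf N α (HD N g C x) =
      (if α g ≠ 0 ∧ C α then pu κ g (cf N α x) else 0) +
      (if fc N (α + ei g).support ∧ C (α + ei g) then u κ g * ct κ g (cf N α x) else 0) +
      ∑ i ∈ α.support.erase g, ((if fc N (α + ei g).support ∧ C (α + ei g) then (1 : κ) else 0) -
        (if C (α + ei g - ei i) then 1 else 0)) • (u κ g * ct κ i (cf N (α + ei g - ei i) x)) := by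
  rw [HD_apply, map_add, cf_d hα, cf_hh]
  have e1 : ∑ i ∈ α.support, ct κ i (cf N (α - ei i) (hh N g C x)) =
      (if α g ≠ 0 ∧ C α then pu κ g (cf N α x) else 0) + ∑ i ∈ α.support.erase g,
        -((if C (α + ei g - ei i) then (1 : κ) else 0) • (u κ g * ct κ i (cf N (α + ei g - ei i) x))) := by
    have e2 : ∑ i ∈ α.support.erase g, ct κ i (cf N (α - ei i) (hh N g C x)) =
        ∑ i ∈ α.support.erase g,
        -((if C (α + ei g - ei i) then (1 : κ) else 0) • (u κ g * ct κ i (cf N (α + ei g - ei i) x))) := by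
      refine Finset.sum_congr rfl fun i hi => ?_
      rw [Finset.mem_erase, Finsupp.mem_support_iff] at hi
      have h3 : α - ei i + ei g = α + ei g - ei i := by
        ext j; simp [Finsupp.single_apply]; split_ifs with h4 <;> simp <;> subst h4 <;> omega
      rw [cf_hh, h3]
      split_ifs
      · rw [ct_u_mul_ne hi.1, one_smul]
      · simp
    by_cases h : α g ≠ 0
    · rw [← Finset.add_sum_erase _ _ (Finsupp.mem_support_iff.2 h), e2, cf_hh, sub_add_ei h]
      congr 1
      by_cases hC : C α
      · rw [if_pos hC, if_pos ⟨h, hC⟩]; rfl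
      · rw [if_neg hC, if_neg (by tauto), map_zero]
    · rw [if_neg (by tauto), zero_add, ← e2, Finset.erase_eq_of_notMem (by simpa using h)]
  have e3 : (if C (α + ei g) then u κ g * cf N (α + ei g) (kD N x) else 0) =
      (if fc N (α + ei g).support ∧ C (α + ei g) then u κ g * ct κ g (cf N α x) else 0) +
      ∑ i ∈ α.support.erase g, (if fc N (α + ei g).support ∧ C (α + ei g) then (1 : κ) else 0) •
         (u κ g * ct κ i (cf N (α + ei g - ei i) x)) := by
    by_cases h : fc N (α + ei g).support
    · by_cases hC : C (α + ei g)
      · rw [if_pos hC, if_pos ⟨h, hC⟩, if_pos ⟨h, hC⟩, cf_d h,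
          ← Finset.add_sum_erase _ _ (show g ∈ (α + ei g).support by simp), supp_add,
          Finset.erase_insert_eq_erase, add_tsub_cancel_right, mul_add, Finset.mul_sum]
        simp only [one_smul]
      · simp [hC]
    · simp [h, cf_zero_of h]
  rw [e1, e3, Finset.sum_neg_distrib]
  simp only [sub_smul, Finset.sum_sub_distrib]
  abel
end KZ
namespace KZ
variable {κ : Type} [Field κ] [CharZero κ] {σ : Type} [Fintype σ] [DecidableEq σ]
theorem HD_cyc {N : Set (Finset σ)} (g : σ) (C : (σ →₀ ℕ) → Prop) {x : KA κ N} (hx : kD N x = 0) :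
    HD N g C x = kD N (hh N g C x) := by rw [HD_apply, hx, map_zero, add_zero]
/-- two cycles are equivalent -/
def Cq (N : Set (Finset σ)) (x y : KA κ N) : Prop := x - y ∈ LinearMap.range (kD (κ := κ) N) ∧ kD N y = 0
theorem Cq.trans {N : Set (Finset σ)} {x y z : KA κ N} (h : Cq N x y) (h' : Cq N y z) : Cq N x z :=
  ⟨by have := add_mem h.1 h'.1; simpa using this, h'.2⟩
theorem Cq.rng {N : Set (Finset σ)} {x y : KA κ N} (h : Cq N x y) (h' : y ∈ LinearMap.range (kD (κ := κ) N)) :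
    x ∈ LinearMap.range (kD (κ := κ) N) := by
  have := add_mem h.1 h'; simpa using this
theorem Cq.refl {N : Set (Finset σ)} {x : KA κ N} (h : kD N x = 0) : Cq N x x :=
  ⟨by simp, h⟩
theorem Cq_HD {N : Set (Finset σ)} (g : σ) (C : (σ →₀ ℕ) → Prop) {x y : KA κ N} (hx : kD N x = 0)
    (hy : y = x - HD N g C x) : Cq N x y := by
  subst hy
  rw [HD_cyc g C hx]
  exact ⟨⟨hh N g C x, by abel⟩, by rw [map_sub, hx, kD_kD, sub_zero]⟩
open Classical in
noncomputable def sq (N : Set (Finset σ)) (g : σ) : KA κ N →ₗ[κ] KA κ N :=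
  dg N fun α => if α g = 0 then LinearMap.id else if α g = 1 then pu κ g else 0
open Classical in
noncomputable def qq (N : Set (Finset σ)) (g : σ) : KA κ N →ₗ[κ] KA κ N :=
  dg N fun α => if α g = 0 then pu κ g else 0
theorem sq_eq {N : Set (Finset σ)} (g : σ) (x : KA κ N) : sq N g x = x - HD N g (fun α => 2 ≤ α g) x := by
  classical
  refine ext_cf fun α hα => ?_
  rw [sq, cf_dg, map_sub, cf_HD _ _ hα]
  rw [Finset.sum_eq_zero (s := α.support.erase g), add_zero]
  swap
  · intro i hi
    rw [Finset.mem_erase] at hi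
    have h1 : (α + ei g - ei i) g = α g + 1 := by simp [Finsupp.single_apply, hi.1]
    have h2 : (α + ei g) g = α g + 1 := by simp
    rw [h1, h2]
    by_cases h : α g = 0
    · simp [h]
    · have : fc N (α + ei g).support := by
        rw [supp_add, Finset.insert_eq_of_mem (by simpa using h)]; exact hα
      simp [this]
  have h2 : (α + ei g) g = α g + 1 := by simp
  simp only [h2]
  by_cases h : α g = 0
  · simp [h]
  · have h3 : fc N (α + ei g).support := by
      rw [supp_add, Finset.insert_eq_of_mem (by simpa using h)]; exact hα
    have h4 : 2 ≤ α g + 1 := by omega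
    rw [if_neg h, if_pos (show _ ∧ _ from ⟨h3, h4⟩)]
    by_cases h5 : α g = 1
    · simp [h5, pu_eq]
    · rw [if_neg h5, if_pos (show _ ∧ _ from ⟨h, by omega⟩), pu_add]; simp
theorem Cq_sq {N : Set (Finset σ)} (g : σ) {x : KA κ N} (hx : kD N x = 0) : Cq N x (sq N g x) :=
  Cq_HD g _ hx (sq_eq g x)
theorem kD_sq {N : Set (Finset σ)} (g : σ) (x : KA κ N) : kD N (sq N g x) = sq N g (kD N x) := by
  rw [sq_eq, sq_eq, map_sub, HD_apply, HD_apply, map_add, kD_kD, kD_kD, map_zero, zero_add, add_zero]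
theorem kD_qq {N : Set (Finset σ)} (g : σ) (x : KA κ N) : kD N (qq N g x) = qq N g (kD N x) := by
  classical
  refine ext_cf fun α hα => ?_
  rw [cf_d hα, qq, cf_dg, cf_d hα]
  by_cases h : α g = 0
  · rw [if_pos h, map_sum]
    refine Finset.sum_congr rfl fun i hi => ?_
    have hig : i ≠ g := by rintro rfl; exact Finsupp.mem_support_iff.1 hi h
    rw [cf_dg, if_pos (by simp [h]), ct_pu_ne hig]
  · rw [if_neg h, LinearMap.zero_apply]
    refine Finset.sum_eq_zero fun i hi => ?_
    rw [cf_dg]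
    split_ifs with h1
    · by_cases hig : i = g
      · subst hig; rw [ct_pu]
      · simp [Finsupp.single_apply, hig] at h1; exact absurd h1 h
    · simp
/-- lift along a quotient -/
noncomputable def lf (M N : Set (Finset σ)) : KA κ M →ₗ[κ] KA κ N := op M fun α => tt κ N α
theorem cf_lf {N M : Set (Finset σ)} (h : ∀ t, fc M t → fc N t) (x : KA κ M) (α) :
    cf N α (lf M N x) = cf M α x := by
  classical
  induction x using KA_ind with
  | h0 => simp
  | ha x y hx hy => simp only [map_add, hx, hy]
  | ht β e hβ => rw [lf, op_tt _ hβ, cf_tt _ _ (h _ hβ), cf_tt _ _ hβ]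
theorem qt_lf {N M : Set (Finset σ)} (h : ∀ t, fc M t → fc N t) (x : KA κ M) :
    qt κ h (lf M N x) = x := ext_cf fun α hα => by rw [cf_qt h _ hα, cf_lf h]
theorem lf_fil {N M : Set (Finset σ)} (h : ∀ t, fc M t → fc N t) {x : KA κ M} {j} (hx : x ∈ Fil M j) :
    lf M N x ∈ Fil N j := fun α hα => by rw [cf_lf h, hx α hα]
/-- detection by deletion of a vertex -/
theorem qq_detect {N M : Set (Finset σ)} (g : σ) (hM : ∀ t, fc M t ↔ fc N t ∧ g ∉ t) {x : KA κ N}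
    (hx : qt κ (fun t h => ((hM t).1 h).1) x ∈ LinearMap.range (kD (κ := κ) M)) :
    qq N g x ∈ LinearMap.range (kD (κ := κ) N) := by
  classical
  have hMN := fun t h => ((hM t).1 h).1
  obtain ⟨y, hy⟩ := hx
  refine ⟨qq N g (lf M N y), ?_⟩
  rw [kD_qq]
  refine ext_cf fun α hα => ?_
  rw [qq, cf_dg, cf_dg]
  split_ifs with h
  · have hα' : fc M α.support := (hM _).2 ⟨hα, by simpa using h⟩
    have : cf N α (kD N (lf M N y)) = cf N α x := by
      rw [← cf_qt hMN _ hα', qt_d, qt_lf, hy, cf_qt hMN _ hα']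
    rw [this]
  · rfl
/-- multidegree one at every `g ∈ S` -/
def M1 (N : Set (Finset σ)) (g : σ) (x : KA κ N) : Prop := ∀ α,
  (α g = 0 → u κ g * cf N α x = 0) ∧ (α g ≠ 0 → ct κ g (cf N α x) = 0) ∧ (2 ≤ α g → cf N α x = 0)
noncomputable def MM (κ : Type) [Field κ] [CharZero κ] (N : Set (Finset σ)) : Submodule κ (KA κ N) where
  carrier := {x | ∀ g, M1 N g x}
  add_mem' := by
    intro x y hx hy g α
    obtain ⟨h1, h2, h3⟩ := hx g α
    obtain ⟨k1, k2, k3⟩ := hy g α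
    refine ⟨fun h => ?_, fun h => ?_, fun h => ?_⟩
    · rw [map_add, mul_add, h1 h, k1 h, add_zero]
    · rw [map_add, map_add, h2 h, k2 h, add_zero]
    · rw [map_add, h3 h, k3 h, add_zero]
  zero_mem' := by intro g α; simp
  smul_mem' := by
    intro c x hx g α
    obtain ⟨h1, h2, h3⟩ := hx g α
    refine ⟨fun h => ?_, fun h => ?_, fun h => ?_⟩
    · rw [map_smul, mul_smul_comm, h1 h, smul_zero]
    · rw [map_smul, map_smul, h2 h, smul_zero]
    · rw [map_smul, h3 h, smul_zero]
theorem mp_cf {N : Set (Finset σ)} (g : σ) (y : KA κ N) (α) : cf N α (sq N g y - qq N g y) =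
    if α g = 0 then u κ g * ct κ g (cf N α y) else if α g = 1 then pu κ g (cf N α y) else 0 := by
  rw [map_sub, sq, qq, cf_dg, cf_dg]
  split_ifs with h
  · rw [LinearMap.id_apply, pu_eq]; abel
  · simp
  · simp
theorem mp_M1 {N : Set (Finset σ)} (g j : σ) (y : KA κ N) (h1 : j ≠ g → M1 N j y) :
    M1 N j (sq N g y - qq N g y) := by
  intro α
  rw [mp_cf]
  by_cases hjg : j = g
  · subst hjg
    refine ⟨fun h => ?_, fun h => ?_, fun h => ?_⟩
    · rw [if_pos h, u_u_mul]
    · rw [if_neg h]; split_ifs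
      · rw [ct_pu]
      · simp
    · rw [if_neg (by omega), if_neg (by omega)]
  · obtain ⟨k1, k2, k3⟩ := h1 hjg α
    refine ⟨fun h => ?_, fun h => ?_, fun h => ?_⟩
    · split_ifs
      · rw [u_comm, u_ct (Ne.symm hjg), k1 h]; simp
      · rw [u_pu_ne hjg, k1 h, map_zero]
      · simp
    · split_ifs
      · rw [ct_u_mul_ne hjg, ct_comm, k2 h]; simp
      · rw [ct_pu_ne hjg, k2 h, map_zero]
      · simp
    · rw [k3 h]; simp
theorem mp_fix {N : Set (Finset σ)} (g : σ) (y : KA κ N) (h1 : M1 N g y) : sq N g y - qq N g y = y := by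
  refine ext_cf fun α hα => ?_
  obtain ⟨k1, k2, k3⟩ := h1 α
  rw [mp_cf]
  split_ifs with h h'
  · have := pu_eq g (cf N α y)
    rw [pu_apply, k1 h, map_zero] at this
    exact (sub_eq_zero.1 this.symm).symm
  · exact pu_of_ct (k2 h)
  · exact (k3 (by omega)).symm
theorem kD_mp {N : Set (Finset σ)} (g : σ) (y : KA κ N) :
    kD N (sq N g y - qq N g y) = sq N g (kD N y) - qq N g (kD N y) := by
  rw [map_sub, kD_sq, kD_qq]
theorem MM_d {N : Set (Finset σ)} {x : KA κ N} (hx : x ∈ MM κ N) : kD N x ∈ MM κ N := fun g => by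
  rw [← mp_fix g x (hx g), kD_mp]; exact mp_M1 _ _ _ (fun h => absurd rfl h)
theorem MM_prim {N : Set (Finset σ)} {x : KA κ N} (hx : x ∈ MM κ N) (hr : x ∈ LinearMap.range (kD (κ := κ) N)) :
    ∃ y ∈ MM κ N, kD N y = x := by
  classical
  suffices h : ∀ S : Finset σ, ∃ y : KA κ N, (∀ g ∈ S, M1 N g y) ∧ kD N y = x by
    obtain ⟨y, h1, h2⟩ := h Finset.univ
    exact ⟨y, fun g => h1 g (Finset.mem_univ g), h2⟩
  intro S
  induction S using Finset.induction_on with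
  | empty => obtain ⟨y, hy⟩ := hr; exact ⟨y, by simp, hy⟩
  | insert g S hg ih =>
    obtain ⟨y, h1, h2⟩ := ih
    refine ⟨_, fun j hj => mp_M1 g j y fun h => h1 j ((Finset.mem_insert.1 hj).resolve_left h), ?_⟩
    rw [kD_mp, h2, mp_fix g x (hx g)]
theorem MM_exists {N : Set (Finset σ)} {x : KA κ N} (hx : kD N x = 0)
    (hq : ∀ g, qq N g x ∈ LinearMap.range (kD (κ := κ) N)) : ∃ y ∈ MM κ N, Cq N x y := by
  classical
  suffices h : ∀ S : Finset σ, ∃ y : KA κ N, (∀ g ∈ S, M1 N g y) ∧ Cq N x y by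
    obtain ⟨y, h1, h2⟩ := h Finset.univ
    exact ⟨y, fun g => h1 g (Finset.mem_univ g), h2⟩
  intro S
  induction S using Finset.induction_on with
  | empty => exact ⟨x, by simp, Cq.refl hx⟩
  | insert g S hg ih =>
    obtain ⟨y, h1, h2⟩ := ih
    refine ⟨sq N g y - qq N g y, fun j hj => mp_M1 g j y fun h =>
      h1 j ((Finset.mem_insert.1 hj).resolve_left h), h2.trans ((Cq_sq g h2.2).trans ?_)⟩
    have : qq N g y ∈ LinearMap.range (kD (κ := κ) N) := by
      obtain ⟨w, hw⟩ := h2.1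
      have e : qq N g y = qq N g x - kD N (qq N g w) := by
        rw [kD_qq, hw, map_sub]; abel
      rw [e]; exact sub_mem (hq g) ⟨_, rfl⟩
    refine ⟨by simpa using this, ?_⟩
    rw [map_sub, (Cq_sq g h2.2).2, kD_qq, h2.2, map_zero, sub_zero]
theorem SQ_exists {N : Set (Finset σ)} {x : KA κ N} (hx : kD N x = 0) {j : ℕ} (hj : x ∈ Fil N j) :
    ∃ y ∈ Fil N j, (∀ g α, (α g ≠ 0 → ct κ g (cf N α y) = 0) ∧ (2 ≤ α g → cf N α y = 0)) ∧ Cq N x y := by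
  classical
  suffices h : ∀ S : Finset σ, ∃ y ∈ Fil N j, (∀ g ∈ S, ∀ α, (α g ≠ 0 → ct κ g (cf N α y) = 0) ∧
      (2 ≤ α g → cf N α y = 0)) ∧ Cq N x y by
    obtain ⟨y, h0, h1, h2⟩ := h Finset.univ
    exact ⟨y, h0, fun g => h1 g (Finset.mem_univ g), h2⟩
  intro S
  induction S using Finset.induction_on with
  | empty => exact ⟨x, hj, by simp, Cq.refl hx⟩
  | insert g S hg ih =>
    obtain ⟨y, h0, h1, h2⟩ := ih
    refine ⟨sq N g y, dg_fil h0, ?_, h2.trans (Cq_sq g h2.2)⟩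
    intro j hj α
    rw [sq, cf_dg]
    by_cases hjg : j = g
    · subst hjg
      refine ⟨fun h => ?_, fun h => ?_⟩
      · rw [if_neg h]; split_ifs
        · rw [ct_pu]
        · simp
      · rw [if_neg (by omega), if_neg (by omega)]; rfl
    · obtain ⟨k2, k3⟩ := h1 j ((Finset.mem_insert.1 hj).resolve_left hjg) α
      refine ⟨fun h => ?_, fun h => ?_⟩
      · split_ifs
        · exact k2 h
        · rw [ct_pu_ne hjg, k2 h, map_zero]
        · simp
      · rw [k3 h, map_zero]
theorem s1_of_le {α : σ →₀ ℕ} (h : ∀ g, α g ≤ 1) : α = s1 α.support := by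
  ext i; rw [s1_apply]; have := h i; split_ifs with h1
  · rw [Finsupp.mem_support_iff] at h1; omega
  · simpa using h1
theorem s1_deg (s : Finset σ) : (s1 s).degree = s.card := by
  rw [s1, map_sum]; simp
/-- top vanishing for a face -/
def PF (κ : Type) [Field κ] [CharZero κ] (N : Set (Finset σ)) (G : Finset σ) : Prop :=
  ∀ e : EE κ σ, (∀ j ∈ G, ct κ j e = 0) → tt κ N (s1 G) e ∈ LinearMap.range (kD (κ := κ) N)
def TV (κ : Type) [Field κ] [CharZero κ] (N : Set (Finset σ)) (δ : ℕ) : Prop :=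
  ∀ x ∈ Fil N δ, kD N x = 0 → x ∈ LinearMap.range (kD (κ := κ) N)
theorem TV_of {N : Set (Finset σ)} {δ : ℕ} (h1 : ∀ t, fc N t → t.card ≤ δ)
    (h2 : ∀ G, fc N G → G.card = δ → PF κ N G) : TV κ N δ := by
  intro x hx hd
  obtain ⟨y, hy, hy2, hq⟩ := SQ_exists hd hx
  refine hq.rng ?_
  rw [expand y]
  refine sum_mem fun α _ => ?_
  by_cases h0 : cf N α y = 0
  · rw [h0, map_zero]; exact zero_mem _
  have hα : fc N α.support := by
    by_contra h; exact h0 (cf_zero_of h y)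
  have h3 : ∀ g, α g ≤ 1 := fun g => by
    by_contra h; exact h0 ((hy2 g α).2 (by omega))
  have h4 := s1_of_le h3
  have h5 : δ ≤ α.degree := by
    by_contra h; exact h0 (hy α (by omega))
  have h6 : α.degree = α.support.card := by
    conv_lhs => rw [h4]
    exact s1_deg _
  have := h2 α.support hα (le_antisymm (h1 _ hα) (by omega)) (cf N α y) fun j hj =>
    (hy2 j α).1 (Finsupp.mem_support_iff.1 hj)
  rwa [← h4] at this
theorem PF_step {N : Set (Finset σ)} {G : Finset σ} {g : σ} (hg : g ∈ G)
    (h : ∀ i, i ∉ G → fc N (insert i (G.erase g)) → PF κ N (insert i (G.erase g))) : PF κ N G := by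
  classical
  intro e he
  have key : kD N (tt κ N (s1 (G.erase g)) (u κ g * e)) = ∑ i, tt κ N (s1 (G.erase g) + ei i) (ct κ i (u κ g * e)) :=
    kD_tt _ _ _
  have hs : ∀ i, i ∉ G.erase g → s1 (G.erase g) + ei i = s1 (insert i (G.erase g)) := by
    intro i hi; rw [s1, s1, Finset.sum_insert hi, add_comm]
  rw [← Finset.add_sum_erase _ _ (Finset.mem_univ g), ct_u_mul_self, he g hg, mul_zero, sub_zero,
    hs g (Finset.notMem_erase g G), Finset.insert_erase hg] at key
  have : tt κ N (s1 G) e = kD N (tt κ N (s1 (G.erase g)) (u κ g * e)) -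
      ∑ i ∈ Finset.univ.erase g, tt κ N (s1 (G.erase g) + ei i) (ct κ i (u κ g * e)) := by
    rw [key]; abel
  rw [this]
  refine sub_mem ⟨_, rfl⟩ (sum_mem fun i hi => ?_)
  have hig : i ≠ g := (Finset.mem_erase.1 hi).1
  rw [ct_u_mul_ne hig]
  by_cases hiG : i ∈ G
  · rw [he i hiG]; simp
  have hi2 : i ∉ G.erase g := fun h => hiG (Finset.mem_of_mem_erase h)
  rw [hs i hi2]
  by_cases hf : fc N (insert i (G.erase g))
  · refine h i hiG hf _ fun j hj => ?_
    rcases Finset.mem_insert.1 hj with rfl | hj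
    · rw [map_neg, ct_u_mul_ne hig, ct_ct]; simp
    · rw [Finset.mem_erase] at hj
      rw [map_neg, ct_u_mul_ne hj.1, ct_comm, he j hj.2]; simp
  · rw [tt_zero_of (by rwa [s1_supp])]; exact zero_mem _
theorem SS_of_TV2 {N : Set (Finset σ)} (h : TV κ N 2) : SS κ N :=
  SS_of fun x _ h1 h2 => h x h2 h1
end KZ
namespace KZ
variable {κ : Type} [Field κ] [CharZero κ] {σ : Type} [Fintype σ] [DecidableEq σ]
/-- attaching a cone over a simplex preserves the strong Golod property -/
theorem SS_cone {N M : Set (Finset σ)} (n : σ) (s0 : Finset σ) (hn : ∀ t, fc N t → n ∉ t) (hs : n ∉ s0)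
    (hM : ∀ t, fc M t ↔ fc N t ∨ (n ∈ t ∧ t.erase n ⊆ s0)) (hS : SS κ N) : SS κ M := by
  classical
  refine SS_of fun x hx hd h2 => ?_
  have hNM : ∀ t, fc N t → fc M t := fun t h => (hM t).2 (Or.inl h)
  obtain ⟨y, hy, hyx⟩ := hS _ (qt_dec hNM hx)
  have main : ∀ S ⊆ s0, ∃ y ∈ Fil M 2, Cq M x y ∧ (∀ α, α n = 0 → cf M α y = 0) ∧
      ∀ g ∈ S, ∀ α, α g ≠ 0 → cf M α y = 0 := by
    intro S
    induction S using Finset.induction_on with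
    | empty =>
      intro _
      refine ⟨x - kD M (lf N M y), sub_mem h2 (Fil_d (lf_fil hNM hy)), ⟨⟨lf N M y, by abel⟩, ?_⟩, ?_, by simp⟩
      · rw [map_sub, hd, kD_kD, sub_zero]
      · intro α hα
        by_cases hf : fc M α.support
        · have hf' : fc N α.support := by
            rcases (hM _).1 hf with h | h
            · exact h
            · exact absurd hα (Finsupp.mem_support_iff.1 h.1)
          rw [← cf_qt hNM _ hf', map_sub, qt_d, qt_lf]
          have : kD N y = qt κ hNM x := hyx
          rw [this, sub_self, map_zero]
        · exact cf_zero_of hf _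
    | insert g S hg ih =>
      intro hS
      have hgs : g ∈ s0 := hS (Finset.mem_insert_self _ _)
      have hgn : g ≠ n := fun h => hs (h ▸ hgs)
      obtain ⟨y, h1, h3, h4, h5⟩ := ih (fun i hi => hS (Finset.mem_insert_of_mem hi))
      have hcf : ∀ α, cf M α (y - HD M g (fun _ => True) y) = if α g = 0 then pu κ g (cf M α y) else 0 := by
        intro α
        by_cases hf : fc M α.support
        swap
        · rw [cf_zero_of hf, cf_zero_of hf, map_zero]; simp
        rw [map_sub, cf_HD _ _ hf]
        by_cases hα : α n = 0
        · rw [h4 α hα, Finset.sum_eq_zero]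
          · simp
          · intro i hi
            rw [h4 (α + ei g - ei i) (by simp [hα, hgn]), map_zero, mul_zero, smul_zero]
        · have hf2 : fc M (α + ei g).support := by
            rw [hM, supp_add]
            right
            rcases (hM _).1 hf with h | h
            · exact absurd (Finsupp.mem_support_iff.2 hα) (hn _ h)
            · refine ⟨Finset.mem_insert_of_mem h.1, ?_⟩
              rw [Finset.erase_insert_of_ne hgn]
              exact Finset.insert_subset hgs h.2
          rw [Finset.sum_eq_zero]
          · simp only [hf2, and_true, if_true, add_zero]
            by_cases hg0 : α g = 0
            · simp [hg0, pu_eq]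
            · simp [hg0, pu_add]
          · intro i hi
            simp [hf2]
      refine ⟨y - HD M g (fun _ => True) y, ?_, h3.trans (Cq_HD g _ h3.2 rfl), ?_, ?_⟩
      · intro α hα; rw [hcf, h1 α hα, map_zero]; simp
      · intro α hα; rw [hcf, h4 α hα, map_zero]; simp
      · intro j hj α hα
        rw [hcf]
        rcases Finset.mem_insert.1 hj with rfl | hj
        · rw [if_neg hα]
        · rw [h5 j hj α hα, map_zero]; simp
  obtain ⟨y, h1, h3, h4, h5⟩ := main s0 subset_rfl
  refine h3.rng ((Cq_sq n h3.2).rng ?_)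
  have : sq M n y = 0 := by
    refine ext_cf fun α hα => ?_
    rw [map_zero, sq, cf_dg]
    by_cases hα0 : α n = 0
    · rw [h4 α hα0, map_zero]
    rw [if_neg hα0]
    split_ifs with hα1
    · have : cf M α y = 0 := by
        by_contra h0
        have h6 : ∀ i, i ≠ n → α i = 0 := by
          intro i hi
          by_contra hi2
          rcases (hM _).1 hα with h | h
          · exact hn _ h (Finsupp.mem_support_iff.2 hα0)
          · exact h0 (h5 i (h.2 (Finset.mem_erase.2 ⟨hi, Finsupp.mem_support_iff.2 hi2⟩)) α hi2)
        have h7 : α = ei n := by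
          ext i; by_cases hi : n = i
          · subst hi; simp [hα1]
          · rw [h6 i (Ne.symm hi)]; simp [Finsupp.single_apply, hi]
        exact h0 (h1 α (by rw [h7, deg_ei]; omega))
      rw [this, map_zero]
    · rfl
  rw [this]; exact zero_mem _
set_option maxHeartbeats 1600000 in
/-- removing a face, when top vanishing holds -/
theorem SS_cut {N M : Set (Finset σ)} (F : Finset σ) (δ : ℕ) (hδ : 2 ≤ δ) (hF : F.card = δ)
    (hM : ∀ t, fc M t ↔ fc N t ∧ ¬ F ⊆ t) (hTV : TV κ M δ) (hS : SS κ N) : SS κ M := by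
  classical
  have hMN : ∀ t, fc M t → fc N t := fun t h => ((hM t).1 h).1
  obtain ⟨Z, μ, hZ, hspan, hμ1, hμ⟩ := (kd N).G_of_S _ hS
  refine (kd M).S_of_G _ (fun x hx => Fil_inv hx)
      (fun x y hy => Fil_mul (i := 0) (j := 1) (by omega) (Fil_zero _ _) hy)
      (fun x hx y => Fil_mul (i := 1) (j := 0) (by omega) hx (Fil_zero _ _)) ?_
  set π := qt κ hMN with hπ
  let Z1 : Set (KA κ M) := π '' Z
  let X : Set (KA κ M) := {x | x ∈ Fil M (δ - 1) ∧ kD M x = 0}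
  let se : KA κ M → KA κ N := fun z => if h : ∃ w ∈ Z, π w = z then h.choose else 0
  have hse : ∀ z ∈ Z1, se z ∈ Z ∧ π (se z) = z := by
    rintro z ⟨w, hw, hwz⟩
    have h : ∃ w ∈ Z, π w = z := ⟨w, hw, hwz⟩
    simp only [se, dif_pos h]
    exact h.choose_spec
  have hfil1 : (Fil M (δ - 1) : Submodule κ (KA κ M)) ≤ Fil M 1 := Fil_mono (by omega)
  -- words in Z1
  have hZ1 : ∀ l : List (KA κ M), l ≠ [] → (∀ z ∈ l, z ∈ Z1) →
      π (μ (l.map se)) ∈ Fil M 1 ∧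
      (kd M).WordEq (fun l => π (μ (l.map se))) l (π (μ (l.map se))) := by
    intro l hl hlZ
    obtain ⟨h1, h2⟩ := hμ (l.map se) (by simpa using hl) (by
      intro z hz
      obtain ⟨w, hw, rfl⟩ := List.mem_map.1 hz
      exact (hse w (hlZ w hw)).1)
    refine ⟨hom_fil _ _ h1, ?_⟩
    change kD M (π (μ (l.map se))) = _
    rw [← qt_d hMN]
    refine (congrArg π h2).trans ?_
    rw [map_sum, List.length_map]
    refine Finset.sum_congr rfl fun j _ => ?_
    rw [map_mul, map_neg, ← List.map_take, ← List.map_drop]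
    congr 2
    exact hom_inv _ _
  obtain ⟨ν, hν⟩ := DGA.exists_rec (X := KA κ M) (Y := KA κ M)
    (fun f l y => y ∈ Fil M 1 ∧ (kd M).WordEq f l y ∧ (∀ z, l = [z] → y = z) ∧
      ((∀ z ∈ l, z ∈ Z1) → y = π (μ (l.map se))) ∧ (¬ (∀ z ∈ l, z ∈ Z1) → y ∈ Fil M (δ - 1)))
    (fun f g l y h1 h2 => ⟨h2.1, (kd M).WordEq_congr h1 h2.2.1, h2.2.2⟩)
    (fun l => l ≠ [] ∧ ∀ z ∈ l, z ∈ Z1 ∪ X) (by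
      rintro f l ⟨hl, hlZ⟩ ih
      by_cases hall : ∀ z ∈ l, z ∈ Z1
      · obtain ⟨h1, h2⟩ := hZ1 l hl hall
        refine ⟨π (μ (l.map se)), h1, ?_, ?_, fun _ => rfl, fun h => absurd hall h⟩
        · change kD M _ = _
          refine Eq.trans h2 (Finset.sum_congr rfl fun j hj => ?_)
          rw [Finset.mem_Ioo] at hj
          have a1 := (ih (l.take j) (by simp; omega) ⟨by
            rw [Ne, ← List.length_eq_zero_iff, List.length_take]; omega, fun z hz =>
              hlZ z (List.mem_of_mem_take hz)⟩).2.2.2.1 (fun z hz => hall z (List.mem_of_mem_take hz))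
          have a2 := (ih (l.drop j) (by simp; omega) ⟨by
            rw [Ne, ← List.length_eq_zero_iff, List.length_drop]; omega, fun z hz =>
              hlZ z (List.mem_of_mem_drop hz)⟩).2.2.2.1 (fun z hz => hall z (List.mem_of_mem_drop hz))
          rw [a1, a2]
        · rintro z rfl
          have := hse z (hall z (by simp))
          rw [List.map_singleton, hμ1 _ this.1, this.2]
      · by_cases h1 : ∃ z, l = [z]
        · obtain ⟨z, rfl⟩ := h1
          have hzX : z ∈ X := by
            rcases hlZ z (by simp) with h | h
            · exact absurd (fun w hw => by rw [List.mem_singleton.1 hw]; exact h) hall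
            · exact h
          refine ⟨z, hfil1 hzX.1, ?_, ?_, fun h => absurd h hall, fun _ => hzX.1⟩
          · change kD M z = _
            rw [hzX.2]; exact (Finset.sum_empty).symm
          · rintro w hw; simpa using hw
        · have hdec := (kd M).word_sys (Fil M 1) f l (by
            intro l' hl' hne hsub
            have := ih l' hl' ⟨hne, fun z hz => hlZ z (hsub z hz)⟩
            exact ⟨this.1, this.2.1⟩)
          have hfil : (∑ j ∈ Finset.Ioo 0 l.length, -((kd M).inv (f (l.take j))) * f (l.drop j)) ∈ Fil M ((δ - 1) + 1) := by
            refine sum_mem fun j hj => ?_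
            rw [Finset.mem_Ioo] at hj
            have a1 := ih (l.take j) (by simp; omega) ⟨by
              rw [Ne, ← List.length_eq_zero_iff, List.length_take]; omega, fun z hz =>
                hlZ z (List.mem_of_mem_take hz)⟩
            have a2 := ih (l.drop j) (by simp; omega) ⟨by
              rw [Ne, ← List.length_eq_zero_iff, List.length_drop]; omega, fun z hz =>
                hlZ z (List.mem_of_mem_drop hz)⟩
            by_cases ht : ∀ z ∈ l.take j, z ∈ Z1
            · have hdr : ¬ ∀ z ∈ l.drop j, z ∈ Z1 := by
                intro hdr; apply hall
                intro z hz
                rw [← List.take_append_drop j l, List.mem_append] at hz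
                exact hz.elim (ht z) (hdr z)
              exact Fil_mul (i := 1) (j := δ - 1) (by omega) (neg_mem (Fil_inv a1.1)) (a2.2.2.2.2 hdr)
            · exact Fil_mul (i := δ - 1) (j := 1) (by omega) (neg_mem (Fil_inv (a1.2.2.2.2 ht))) a2.1
          obtain ⟨y, hy, hyx⟩ := bdry_fil hfil (hTV _ (Fil_mono (by omega) hfil) hdec.cycle)
          exact ⟨y, hfil1 hy, hyx, fun z hz => absurd ⟨z, hz⟩ h1, fun h => absurd h hall, fun _ => hy⟩)
  refine ⟨Z1 ∪ X, ν, ?_, ?_, ?_, ?_⟩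
  · rintro z (⟨w, hw, rfl⟩ | hz)
    · refine ⟨hom_fil _ _ (hZ w hw).1, ?_⟩
      change kD M (π w) = 0
      rw [← qt_d hMN]
      have : kD N w = 0 := (hZ w hw).2
      rw [this, map_zero]
    · exact ⟨hfil1 hz.1, hz.2⟩
  · intro x hx hd
    have hd : kD M x = 0 := hd
    set xh := tr M (fun α => δ - 1 ≤ α.degree) x with hxh
    have hxh0 : kD M xh = 0 := by rw [hxh, ← tr_d, hd, map_zero]
    have h1 : xh ∈ X := ⟨tr_mem _ _ _, hxh0⟩
    have hlow : ∀ α : σ →₀ ℕ, δ - 1 ≤ α.degree → cf M α (x - xh) = 0 := by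
      intro α hα
      rw [map_sub, hxh, cf_tr, if_pos hα, sub_self]
    have hld : kD M (x - xh) = 0 := by rw [map_sub, hd, hxh0, sub_zero]
    have hlf : x - xh ∈ Fil M 1 := sub_mem hx (hfil1 h1.1)
    have h2 : kD N (lf M N (x - xh)) = 0 := by
      refine ext_cf fun β hβ => ?_
      rw [map_zero]
      by_cases hb : δ ≤ β.degree
      · rw [cf_d hβ]
        refine Finset.sum_eq_zero fun i hi => ?_
        rw [cf_lf hMN, hlow, map_zero]
        have : (β - ei i + ei i).degree = β.degree := by rw [sub_add_ei (Finsupp.mem_support_iff.1 hi)]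
        rw [deg_add, deg_ei] at this
        omega
      · have hβ' : fc M β.support := by
          refine (hM _).2 ⟨hβ, fun hFβ => hb ?_⟩
          have h3 : s1 F ≤ β := by
            intro i; rw [s1_apply]; split_ifs with h
            · exact Nat.one_le_iff_ne_zero.2 (Finsupp.mem_support_iff.1 (hFβ h))
            · exact Nat.zero_le _
          have h4 := deg_add (β - s1 F) (s1 F)
          rw [tsub_add_cancel_of_le h3, s1_deg, hF] at h4
          omega
        rw [← cf_qt hMN _ hβ', qt_d, qt_lf, hld, map_zero]
    have h3 := hspan _ (lf_fil hMN hlf) h2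
    obtain ⟨p, hp, q, ⟨w, hw⟩, hpq⟩ := Submodule.mem_sup.1 h3
    have h4 : x = π p + xh + kD M (π w) := by
      have : π (lf M N (x - xh)) = x - xh := qt_lf hMN _
      rw [← hpq, ← hw, map_add] at this
      have h5 : π ((kd N).d w) = kD M (π w) := qt_d hMN w
      rw [h5] at this
      rw [add_right_comm, this]; abel
    rw [h4]
    refine add_mem (add_mem ?_ ?_) ?_
    · refine Submodule.mem_sup_left ?_
      have := Submodule.mem_map_of_mem (f := π.toLinearMap) hp
      rw [Submodule.map_span] at this
      exact Submodule.span_mono Set.subset_union_left this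
    · exact Submodule.mem_sup_left (Submodule.subset_span (Or.inr h1))
    · exact Submodule.mem_sup_right ⟨_, rfl⟩
  · intro z hz
    exact (hν [z] ⟨by simp, by simpa using hz⟩).2.2.1 z rfl
  · intro l hl hlZ
    have := hν l ⟨hl, hlZ⟩
    exact ⟨this.1, this.2.1⟩
end KZ
namespace KZ
variable {κ : Type} [Field κ] [CharZero κ] {σ : Type} [Fintype σ] [DecidableEq σ]
/-- shelling-type data -/
structure Sh (N : Set (Finset σ)) (ρ : Finset σ → ℝ) (gg : ℝ → σ) : Prop where
  mono : ∀ s s', fc N s' → s ⊆ s' → ρ s ≤ ρ s'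
  ins : ∀ s, fc N s → fc N (insert (gg (ρ s)) s) ∧ ρ (insert (gg (ρ s)) s) = ρ s
  exch : ∀ s i, fc N s → gg (ρ s) ∈ s → fc N (insert i (s.erase (gg (ρ s)))) →
    ρ (insert i (s.erase (gg (ρ s)))) ≤ ρ s → fc N (insert i s) ∧ ρ (insert i s) = ρ s
theorem MM_hh {N : Set (Finset σ)} {x : KA κ N} (hx : x ∈ MM κ N) (g C) : hh N g C x ∈ MM κ N := by
  intro j β
  rw [cf_hh]
  split_ifs
  swap
  · simp
  by_cases hj : j = g
  · subst hj
    refine ⟨fun h => u_u_mul _ _, fun h => ?_, fun h => ?_⟩ <;>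
    rw [(hx j (β + ei j)).2.2 (by simp; omega)] <;> simp
  · obtain ⟨k1, k2, k3⟩ := hx j (β + ei g)
    have e : (β + ei g) j = β j := by simp [Finsupp.single_apply, Ne.symm hj]
    rw [e] at k1 k2 k3
    refine ⟨fun h => ?_, fun h => ?_, fun h => ?_⟩
    · rw [u_comm, k1 h]; simp
    · rw [ct_u_mul_ne hj, k2 h]; simp
    · rw [k3 h, mul_zero]
theorem acyc_step {N : Set (Finset σ)} {ρ gg} (hS : Sh N ρ gg) {x : KA κ N} (hx : x ∈ MM κ N) {t : ℝ} {s0 : Finset σ}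
    (hs0 : fc N s0) (hts : ρ s0 = t) (hlow : ∀ α : σ →₀ ℕ, ρ α.support < t → cf N α x = 0) (α : σ →₀ ℕ)
    (hα : fc N α.support) (hle : ρ α.support ≤ t)
    (hsq : ∀ j, α j ≤ 1) :
    cf N α (x - HD N (gg t) (fun α => ρ α.support = t) x) = 0 := by
  classical
  set g := gg t with hg
  rw [map_sub, cf_HD _ _ hα]
  rw [Finset.sum_eq_zero (s := α.support.erase g), add_zero]
  swap
  · intro i hi
    rw [Finset.mem_erase, Finsupp.mem_support_iff] at hi
    have hi1 : α i = 1 := by have := hsq i; omega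
    have hig : g ≠ i := Ne.symm hi.1
    by_cases h0 : cf N (α + ei g - ei i) x = 0
    · rw [h0]; simp
    have hgα : α g = 0 := by
      by_contra h
      exact h0 ((hx g _).2.2 (by simp [Finsupp.single_apply, hi.1]; omega))
    have hs'' : (α + ei g - ei i).support = insert g (α.support.erase i) := by
      ext j
      by_cases hj : j = i
      · subst hj; simp [Finsupp.single_apply, hi1, hig.symm, hig]
      · by_cases hj' : j = g
        · subst hj'; simp [Finsupp.single_apply, hig.symm, hig]
        · simp [Finsupp.single_apply, Ne.symm hj, Ne.symm hj', hj, hj']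
    have hf : fc N (α + ei g - ei i).support := by
      by_contra h; exact h0 (cf_zero_of h x)
    have hsub : (α + ei g - ei i).support ⊆ (α + ei g).support := by
      rw [hs'', supp_add]; exact Finset.insert_subset_insert _ (Finset.erase_subset _ _)
    by_cases ht : ρ (α + ei g - ei i).support = t
    · have h1 := hS.exch _ i hf (by rw [ht, ← hg, hs'']; simp)
      rw [ht, ← hg, hs''] at h1
      rw [Finset.erase_insert (by simp [hgα]), Finset.insert_erase (by simp [hi1]), Finset.insert_comm,
        Finset.insert_erase (by simp [hi1]), ← supp_add] at h1
      rw [if_pos (h1 hα hle), if_pos ht]; simp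
    · by_cases h2 : fc N (α + ei g).support ∧ ρ (α + ei g).support = t
      · have := hS.mono _ _ h2.1 hsub
        exact absurd (hlow _ (lt_of_le_of_ne (this.trans_eq h2.2) ht)) h0
      · rw [if_neg h2, if_neg ht]; simp
  rcases hle.lt_or_eq with h | h
  · rw [hlow _ h]; simp
  have h1 := hS.ins _ hα
  rw [h, ← hg, ← supp_add] at h1
  by_cases hgα : α g = 0
  · rw [if_neg (by simp [hgα]), if_pos h1, zero_add]
    have := pu_eq g (cf N α x)
    rw [pu_apply, (hx g α).1 hgα, map_zero] at this
    exact this.symm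
  · rw [if_pos ⟨hgα, h⟩, if_pos h1, (hx g α).2.1 hgα, pu_of_ct ((hx g α).2.1 hgα)]; simp
theorem acyc {N : Set (Finset σ)} {ρ gg} (hS : Sh N ρ gg) : ∀ x ∈ MM κ N, kD N x = 0 →
    x ∈ LinearMap.range (kD (κ := κ) N) := by
  classical
  suffices H : ∀ U : Finset (Finset σ), (∀ s ∈ U, fc N s) → (∀ s ∈ U, ∀ s', fc N s' → ρ s ≤ ρ s' → s' ∈ U) →
      ∀ x ∈ MM κ N, kD N x = 0 → (∀ α, cf N α x ≠ 0 → α.support ∈ U) → x ∈ LinearMap.range (kD (κ := κ) N) by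
    intro x hx hd
    refine H (Finset.univ.filter fun s => fc N s) (by simp) (by simp +contextual) x hx hd fun α h => ?_
    simp only [Finset.mem_filter, Finset.mem_univ, true_and]
    by_contra h'; exact h (cf_zero_of h' x)
  intro U
  induction U using Finset.strongInduction with
  | H U ih =>
    intro hU hup x hx hd hsupp
    rcases U.eq_empty_or_nonempty with rfl | hne
    · have : x = 0 := ext_cf fun α _ => by
        by_contra h; rw [map_zero] at h; simpa using hsupp α h
      rw [this]; exact zero_mem _
    obtain ⟨s0, hs0, hmin⟩ := U.exists_min_image ρ hne
    set t := ρ s0 with ht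
    have hCq := Cq_HD (gg t) (fun α => ρ α.support = t) hd rfl
    refine hCq.rng ?_
    have hm : x - HD N (gg t) (fun α => ρ α.support = t) x ∈ MM κ N := by
      rw [HD_cyc _ _ hd]; exact sub_mem hx (MM_d (MM_hh hx _ _))
    refine ih (U.filter fun s => t < ρ s) ?_ ?_ ?_ _ hm hCq.2 ?_
    · exact Finset.filter_ssubset.2 ⟨s0, hs0, lt_irrefl _⟩
    · exact fun s hs => hU s (Finset.mem_filter.1 hs).1
    · intro s hs s' hs' hle
      rw [Finset.mem_filter] at hs ⊢
      exact ⟨hup s hs.1 s' hs' hle, hs.2.trans_le hle⟩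
    · intro α h0
      have hα : fc N α.support := by by_contra h; exact h0 (cf_zero_of h _)
      have hlt : t < ρ α.support := by
        by_contra hle
        refine h0 (acyc_step hS hx (hU _ hs0) ht.symm ?_ α hα (not_lt.1 hle) fun j => ?_)
        · intro β hβ
          by_contra h
          exact absurd (hmin _ (hsupp β h)) (not_le.2 hβ)
        · by_contra h; exact h0 ((hm j α).2.2 (by omega))
      exact Finset.mem_filter.2 ⟨hup _ hs0 _ hα hlt.le, hlt⟩
/-- top exterior line on `T` -/
def Ln (κ : Type) [Field κ] [CharZero κ] (T : Finset σ) (e : EE κ σ) : Prop :=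
  (∀ g ∈ T, u κ g * e = 0) ∧ ∀ g, g ∉ T → ct κ g e = 0
theorem exists_Ln (T : Finset σ) : ∃ U : EE κ σ, U ≠ 0 ∧ Ln κ T U ∧ ∀ e, Ln κ T e → ∃ r : κ, e = r • U := by
  induction T using Finset.induction_on with
  | empty =>
    refine ⟨1, one_ne_zero, ⟨by simp, fun g _ => ct_one g⟩, fun e he => ?_⟩
    obtain ⟨r, hr⟩ := eq_algebraMap_of_ct e (fun g => he.2 g (by simp))
    exact ⟨r, by rw [hr, Algebra.algebraMap_eq_smul_one]⟩
  | insert g T hg ih =>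
    obtain ⟨U, h0, h1, h2⟩ := ih
    have hc : ct κ g (u κ g * U) = U := by rw [← pu_apply, pu_of_ct (h1.2 g hg)]
    refine ⟨u κ g * U, fun h => h0 (by rw [← hc, h, map_zero]), ⟨fun j hj => ?_, fun j hj => ?_⟩, fun e he => ?_⟩
    · rcases Finset.mem_insert.1 hj with rfl | hj
      · exact u_u_mul _ _
      · rw [u_comm, h1.1 j hj]; simp
    · rw [Finset.mem_insert, not_or] at hj
      rw [ct_u_mul_ne hj.1, h1.2 j hj.2]; simp
    · have e1 : e = u κ g * ct κ g e := by
        have := pu_eq g e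
        rw [pu_apply, he.1 g (by simp), map_zero] at this
        exact sub_eq_zero.1 this.symm
      have hL : Ln κ T (ct κ g e) := by
        refine ⟨fun j hj => ?_, fun j hj => ?_⟩
        · rw [u_ct (by rintro rfl; exact hg hj), he.1 j (by simp [hj])]; simp
        · by_cases hjg : j = g
          · rw [hjg, ct_ct]
          · rw [ct_comm, he.2 j (by simp [hj, hjg])]; simp
      obtain ⟨r, hr⟩ := h2 _ hL
      exact ⟨r, by rw [← mul_smul_comm, ← hr]; exact e1⟩
theorem tt_MM {N : Set (Finset σ)} {s : Finset σ} (hs : fc N s) {e : EE κ σ} (he : Ln κ sᶜ e) :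
    tt κ N (s1 s) e ∈ MM κ N := by
  intro g α
  rw [cf_tt _ _ (by rwa [s1_supp])]
  split_ifs with h
  swap
  · simp
  subst h
  rw [s1_apply]
  split_ifs with h
  · exact ⟨by simp, fun _ => he.2 g (by simpa using h), by simp⟩
  · exact ⟨fun _ => he.1 g (by simpa using h), by simp, by simp⟩
theorem MM_Ln {N : Set (Finset σ)} {x : KA κ N} (hx : x ∈ MM κ N) (s : Finset σ) : Ln κ sᶜ (cf N (s1 s) x) :=
  ⟨fun g hg => (hx g _).1 (by rw [s1_apply, if_neg (by simpa using hg)]),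
   fun g hg => (hx g _).2.1 (by rw [s1_apply, if_pos (by simpa using hg)]; simp)⟩
theorem MM_sq {N : Set (Finset σ)} {x : KA κ N} (hx : x ∈ MM κ N) {α} (h : cf N α x ≠ 0) : α = s1 α.support :=
  s1_of_le fun g => by by_contra h'; exact h ((hx g α).2.2 (by omega))
theorem MM_even {N : Set (Finset σ)} (hex : ∀ x ∈ MM κ N, kD N x = 0 → x ∈ LinearMap.range (kD (κ := κ) N)) :
    Even (Nat.card {s : Finset σ // fc N s}) := by
  classical
  choose U hU0 hU1 hU2 using fun s : Finset σ => exists_Ln (κ := κ) sᶜ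
  let b : {s : Finset σ // fc N s} → KA κ N := fun s => tt κ N (s1 s.1) (U s.1)
  have hcf : ∀ s t : {s : Finset σ // fc N s}, cf N (s1 t.1) (b s) = if s = t then U t.1 else 0 := by
    intro s t
    rw [cf_tt _ _ (by rw [s1_supp]; exact s.2)]
    by_cases h : s = t
    · subst h; simp
    · rw [if_neg h, if_neg]
      intro h'; apply h
      have := congrArg Finsupp.support h'
      rw [s1_supp, s1_supp] at this
      exact Subtype.ext this
  have hli : LinearIndependent κ b := by
    rw [Fintype.linearIndependent_iff]
    intro c hc t
    have := congrArg (cf N (s1 t.1)) hc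
    rw [map_sum, map_zero] at this
    simp only [map_smul, hcf] at this
    simpa [hU0] using this
  have hspan : Submodule.span κ (Set.range b) = MM κ N := by
    refine le_antisymm (Submodule.span_le.2 ?_) fun x hx => ?_
    · rintro _ ⟨s, rfl⟩; exact tt_MM s.2 (hU1 _)
    · rw [expand x]
      refine sum_mem fun α _ => ?_
      by_cases h0 : cf N α x = 0
      · rw [h0, map_zero]; exact zero_mem _
      have hα : fc N α.support := by by_contra h; exact h0 (cf_zero_of h _)
      have h1 := MM_sq hx h0
      obtain ⟨r, hr⟩ := hU2 _ _ (MM_Ln hx α.support)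
      rw [← h1] at hr
      rw [hr, map_smul]
      refine Submodule.smul_mem _ _ (Submodule.subset_span ⟨⟨_, hα⟩, ?_⟩)
      simp only [b]; rw [← h1]
  have hfr : finrank κ (MM κ N) = Nat.card {s : Finset σ // fc N s} := by
    rw [← hspan, finrank_span_eq_card hli, Nat.card_eq_fintype_card]
  have : FiniteDimensional κ (MM κ N) := by
    rw [← hspan]; exact FiniteDimensional.span_of_finite κ (Set.finite_range b)
  let D : MM κ N →ₗ[κ] MM κ N := (kD (κ := κ) N).restrict fun x hx => MM_d hx
  have hD : LinearMap.range D = LinearMap.ker D := by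
    ext ⟨x, hx⟩
    rw [LinearMap.mem_ker]
    constructor
    · rintro ⟨y, hy⟩; rw [← hy]; exact Subtype.ext (kD_kD _ _)
    · intro h
      obtain ⟨y, hy, hy2⟩ := MM_prim hx (hex x hx (congrArg Subtype.val h))
      exact ⟨⟨y, hy⟩, Subtype.ext hy2⟩
  have := D.finrank_range_add_finrank_ker
  rw [hD, hfr] at this
  exact ⟨_, this.symm⟩
theorem top_nonbdry {N M : Set (Finset σ)} {F : Finset σ} (hF : fc N F) (hmax : ∀ t, fc N t → F ⊆ t → t = F)
    (hM : ∀ t, fc M t ↔ fc N t ∧ ¬ F ⊆ t)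
    (hex : ∀ x ∈ MM κ M, kD M x = 0 → x ∈ LinearMap.range (kD (κ := κ) M))
    {U : EE κ σ} (hU0 : U ≠ 0) (hU : Ln κ Fᶜ U) (hr : tt κ N (s1 F) U ∈ LinearMap.range (kD (κ := κ) N)) : False := by
  classical
  have hMN : ∀ t, fc M t → fc N t := fun t h => ((hM t).1 h).1
  have h1 := MM_even hex
  have h2 : Even (Nat.card {s : Finset σ // fc N s}) := by
    refine MM_even (κ := κ) fun x hx hd => ?_
    have hq : qt κ hMN x ∈ MM κ M := by
      intro g α
      by_cases hα : fc M α.support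
      · rw [cf_qt hMN _ hα]; exact hx g α
      · rw [cf_zero_of hα]; simp
    obtain ⟨y, hy, hyx⟩ := MM_prim hq (hex _ hq (by rw [← qt_d, hd, map_zero]))
    have hl : lf M N y ∈ MM κ N := by
      intro g α; rw [cf_lf hMN]; exact hy g α
    have hz := sub_mem hx (MM_d hl)
    have hx' : x = (x - kD N (lf M N y)) + kD N (lf M N y) := by abel
    rw [hx']
    refine add_mem ?_ ⟨_, rfl⟩
    set z := x - kD N (lf M N y) with hzd
    rw [expand z]
    refine sum_mem fun α _ => ?_
    by_cases h0 : cf N α z = 0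
    · rw [h0, map_zero]; exact zero_mem _
    have hα : fc N α.support := by by_contra h; exact h0 (cf_zero_of h _)
    have hαF : α.support = F := by
      refine hmax _ hα ?_
      by_contra h
      have hα' := (hM _).2 ⟨hα, h⟩
      apply h0
      rw [hzd, ← cf_qt hMN _ hα', map_sub, qt_d, qt_lf, hyx, sub_self, map_zero]
    have e1 := MM_sq hz h0
    rw [hαF] at e1
    obtain ⟨V, -, -, hV⟩ := exists_Ln (κ := κ) Fᶜ
    obtain ⟨r, hr1⟩ := hV _ (MM_Ln hz F)
    obtain ⟨r', hr2⟩ := hV _ hU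
    have hr' : r' ≠ 0 := by rintro rfl; exact hU0 (by rw [hr2, zero_smul])
    rw [e1, hr1, show r • V = (r * r'⁻¹) • U by rw [hr2, smul_smul, inv_mul_cancel_right₀ hr'], map_smul]
    exact Submodule.smul_mem _ _ hr
  have h3 : Nat.card {s : Finset σ // fc N s} = Nat.card {s : Finset σ // fc M s} + 1 := by
    rw [Nat.card_eq_fintype_card, Nat.card_eq_fintype_card, Fintype.card_subtype, Fintype.card_subtype]
    have : (Finset.univ.filter fun s => fc N s) = insert F (Finset.univ.filter fun s => fc M s) := by
      ext s
      simp only [Finset.mem_filter, Finset.mem_univ, true_and, Finset.mem_insert, hM]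
      constructor
      · intro h; by_cases h' : F ⊆ s
        · exact Or.inl (hmax s h h')
        · exact Or.inr ⟨h, h'⟩
      · rintro (rfl | h)
        · exact hF
        · exact h.1
    rw [this, Finset.card_insert_of_notMem]
    simp [hM]
  rw [h3, Nat.even_add_one] at h2
  exact h2 h1
end KZ
namespace Geo
variable {E V : Type} [AddCommGroup E] [Module ℝ E] [FiniteDimensional ℝ E] [Fintype V]
structure PT (p : V → E) : Prop where
  sum : ∑ v, p v = 0
  span : ∀ φ : E →ₗ[ℝ] ℝ, (∀ v, φ (p v) = 0) → φ = 0
  ind : ∀ φ : E →ₗ[ℝ] ℝ, (∀ v, φ (p v) ≤ 1) → LinearIndependent ℝ (fun v : {v // φ (p v) = 1} => p v)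
variable {p : V → E}
theorem ext_lem (h : PT p) {φ ψ : E →ₗ[ℝ] ℝ} (hφ : ∀ v, φ (p v) ≤ 1) (hψ : ψ ≠ 0)
    (hle : ∀ v, φ (p v) = 1 → ψ (p v) ≤ 0) : ∃ t : ℝ, 0 < t ∧ (∀ v, (φ + t • ψ) (p v) ≤ 1) ∧
      ∃ v, 0 < ψ (p v) ∧ φ (p v) < 1 ∧ (φ + t • ψ) (p v) = 1 := by
  classical
  have hex : ∃ v, 0 < ψ (p v) := by
    by_contra hc
    push Not at hc
    refine hψ (h.span ψ fun v => ?_)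
    have h0 : ∑ v, ψ (p v) = 0 := by rw [← map_sum, h.sum, map_zero]
    exact (Finset.sum_eq_zero_iff_of_nonpos fun v _ => hc v).1 h0 v (Finset.mem_univ v)
  obtain ⟨v0, hv0⟩ := hex
  obtain ⟨w, hw, hmin⟩ := (Finset.univ.filter fun v => 0 < ψ (p v)).exists_min_image
    (fun v => (1 - φ (p v)) / ψ (p v)) ⟨v0, by simpa using hv0⟩
  have hw' : 0 < ψ (p w) := by simpa using hw
  have hlt : φ (p w) < 1 := by
    refine lt_of_le_of_ne (hφ w) fun h1 => ?_
    exact absurd (hle w h1) (not_le.2 hw')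
  refine ⟨(1 - φ (p w)) / ψ (p w), div_pos (by linarith) hw', fun v => ?_, w, hw', hlt, ?_⟩
  · rw [LinearMap.add_apply, LinearMap.smul_apply, smul_eq_mul]
    by_cases hv : 0 < ψ (p v)
    · have := hmin v (by simpa using hv)
      have h2 := mul_le_mul_of_nonneg_right this hv.le
      rw [div_mul_cancel₀ _ hv.ne'] at h2
      linarith
    · have : (1 - φ (p w)) / ψ (p w) * ψ (p v) ≤ 0 :=
        mul_nonpos_of_nonneg_of_nonpos (div_pos (by linarith) hw').le (not_lt.1 hv)
      linarith [hφ v]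
  · rw [LinearMap.add_apply, LinearMap.smul_apply, smul_eq_mul, div_mul_cancel₀ _ hw'.ne']; ring
/-- facet functionals -/
def Fct (p : V → E) (G : Finset V) (φ : E →ₗ[ℝ] ℝ) : Prop :=
  (∀ v, φ (p v) ≤ 1) ∧ (∀ v, v ∈ G ↔ φ (p v) = 1) ∧ ∀ ψ : E →ₗ[ℝ] ℝ, (∀ v ∈ G, ψ (p v) = 0) → ψ = 0
theorem Fct_ext (h : PT p) (φ : E →ₗ[ℝ] ℝ) (hφ : ∀ v, φ (p v) ≤ 1) :
    ∃ G φ', Fct p G φ' ∧ ∀ v, φ (p v) = 1 → v ∈ G := by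
  classical
  suffices H : ∀ n : ℕ, ∀ φ : E →ₗ[ℝ] ℝ, (∀ v, φ (p v) ≤ 1) →
      Fintype.card V - (Finset.univ.filter fun v => φ (p v) = 1).card = n →
      ∃ G φ', Fct p G φ' ∧ ∀ v, φ (p v) = 1 → v ∈ G from H _ φ hφ rfl
  intro n
  induction n using Nat.strong_induction_on with
  | _ n ih =>
    intro φ hφ hn
    by_cases hψ : ∃ ψ : E →ₗ[ℝ] ℝ, ψ ≠ 0 ∧ ∀ v, φ (p v) = 1 → ψ (p v) = 0
    · obtain ⟨ψ, h0, hz⟩ := hψ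
      obtain ⟨t, ht, h1, v, hv, hlt, he⟩ := ext_lem h hφ h0 (fun v hv => (hz v hv).le)
      have hsub : ∀ w, φ (p w) = 1 → (φ + t • ψ) (p w) = 1 := fun w hw => by
        simp [hw, hz w hw]
      have hss : (Finset.univ.filter fun v => φ (p v) = 1).card < (Finset.univ.filter fun v => (φ + t • ψ) (p v) = 1).card := by
        refine Finset.card_lt_card (Finset.ssubset_iff_of_subset ?_ |>.2 ⟨v, ?_, ?_⟩)
        · intro w hw
          simp only [Finset.mem_filter, Finset.mem_univ, true_and] at hw ⊢
          exact hsub w hw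
        · simpa using he
        · simpa using hlt.ne
      obtain ⟨G, φ', hG, hs⟩ := ih _ (by have := Finset.card_le_univ (Finset.univ.filter fun v => (φ + t • ψ) (p v) = 1); omega) _ h1 rfl
      exact ⟨G, φ', hG, fun w hw => hs w (hsub w hw)⟩
    · push Not at hψ
      refine ⟨Finset.univ.filter fun v => φ (p v) = 1, φ, ⟨hφ, by simp, fun ψ hz => ?_⟩, by simp⟩
      by_contra h0
      obtain ⟨v, hv, hv'⟩ := hψ ψ h0
      exact hv' (hz v (by simpa using hv))
theorem Fct_coord [DecidableEq V] (h : PT p) {G : Finset V} {φ : E →ₗ[ℝ] ℝ} (hG : Fct p G φ) : G.card = finrank ℝ E ∧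
    ∃ c : V → (E →ₗ[ℝ] ℝ), (∀ g ∈ G, ∀ k ∈ G, c g (p k) = if g = k then 1 else 0) ∧
      ∀ x, x = ∑ g ∈ G, c g x • p g := by
  classical
  obtain ⟨h1, h2, h3⟩ := hG
  have hli : LinearIndependent ℝ (fun v : G => p v) := by
    have := h.ind φ h1
    exact this.comp (fun v : G => ⟨v.1, (h2 v.1).1 v.2⟩) (fun a b hab => Subtype.ext (by simpa using hab))
  have hsp : ⊤ ≤ Submodule.span ℝ (Set.range fun v : G => p v) := by
    by_contra hc
    obtain ⟨f, hf, hle⟩ := Submodule.exists_le_ker_of_lt_top _ (lt_top_iff_ne_top.2 fun h => hc h.ge)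
    refine hf (h3 f fun v hv => ?_)
    exact hle (Submodule.subset_span ⟨⟨v, hv⟩, rfl⟩)
  let b := Basis.mk hli hsp
  refine ⟨?_, fun g => if hg : g ∈ G then b.coord ⟨g, hg⟩ else 0, ?_, fun x => ?_⟩
  · rw [finrank_eq_card_basis b, Fintype.card_coe]
  · intro g hg k hk
    simp only [dif_pos hg]
    have : p k = b ⟨k, hk⟩ := by simp [b]
    rw [this, Basis.coord_apply, Basis.repr_self, Finsupp.single_apply]
    simp only [Subtype.mk.injEq, eq_comm]
  · conv_lhs => rw [← b.sum_repr x]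
    rw [← Finset.sum_coe_sort G]
    refine Finset.sum_congr rfl fun g _ => ?_
    simp [b, Basis.coord_apply]
theorem exists_generic (S : Finset (E →ₗ[ℝ] ℝ)) (hS : ∀ f ∈ S, f ≠ 0) (T : Finset (E →ₗ[ℝ] ℝ)) (x0 : E)
    (hT : ∀ f ∈ T, 0 < f x0) : ∃ x, (∀ f ∈ S, f x ≠ 0) ∧ ∀ f ∈ T, 0 < f x := by
  classical
  obtain ⟨y, hy⟩ : ∃ y, ∀ f ∈ S, f y ≠ 0 := by
    obtain ⟨y, hy⟩ := Module.Dual.exists_forall_ne_zero_of_forall_exists (K := ℝ) (M := E) (fun f : S => f.1)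
      (fun f => by
        by_contra hc; push Not at hc
        exact hS f.1 f.2 (LinearMap.ext hc))
    exact ⟨y, fun f hf => hy ⟨f, hf⟩⟩
  have hc : ∀ f : E →ₗ[ℝ] ℝ, Filter.Tendsto (fun ε : ℝ => f x0 + ε * f y) (nhdsWithin 0 (Set.Ioi 0)) (nhds (f x0)) := by
    intro f
    have : Continuous fun ε : ℝ => f x0 + ε * f y := by fun_prop
    have h2 := (this.tendsto 0).mono_left (nhdsWithin_le_nhds (s := Set.Ioi 0))
    simpa using h2
  have e1 : ∀ᶠ ε in nhdsWithin (0:ℝ) (Set.Ioi 0), ∀ f ∈ S, f x0 + ε * f y ≠ 0 := by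
    rw [Filter.eventually_all_finset]
    intro f hf
    by_cases h0 : f x0 = 0
    · filter_upwards [self_mem_nhdsWithin] with ε hε
      rw [h0, zero_add]; exact mul_ne_zero (ne_of_gt hε) (hy f hf)
    · exact (hc f).eventually_ne h0
  have e2 : ∀ᶠ ε in nhdsWithin (0:ℝ) (Set.Ioi 0), ∀ f ∈ T, 0 < f x0 + ε * f y := by
    rw [Filter.eventually_all_finset]
    intro f hf
    exact (hc f).eventually_const_lt (hT f hf)
  obtain ⟨ε, h1, h2⟩ := (e1.and e2).exists
  exact ⟨x0 + ε • y, fun f hf => by simpa using h1 f hf, fun f hf => by simpa using h2 f hf⟩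
end Geo
namespace Geo
variable {E V : Type} [AddCommGroup E] [Module ℝ E] [FiniteDimensional ℝ E] [Fintype V] {p : V → E}
/-- line shelling data with last facet `F0` -/
structure ShD (Fa : Finset V → Prop) (F0 : Finset V) (val : Finset V → ℝ) (R : Finset V → Finset V) : Prop where
  inj : ∀ G, Fa G → ∀ G', Fa G' → val G = val G' → G = G'
  lt : ∀ G, Fa G → ∀ G', Fa G' → ∀ s, R G ⊆ s → s ⊆ G → s ⊆ G' → G' ≠ G → val G < val G'
  own : ∀ G, Fa G → ∀ s, s ⊆ G → (∀ G', Fa G' → s ⊆ G' → val G ≤ val G') → R G ⊆ s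
  R0 : F0 ⊆ R F0
  R1 : ∀ G, Fa G → G ≠ F0 → ∃ g ∈ G, g ∉ R G
theorem exists_ShD [DecidableEq V] (h : PT p) (F0 : Finset V) (hF0 : ∃ φ, Fct p F0 φ) :
    ∃ val R, ShD (fun G => ∃ φ, Fct p G φ) F0 val R := by
  classical
  let Fa : Finset V → Prop := fun G => ∃ φ, Fct p G φ
  let Φ : Finset V → (E →ₗ[ℝ] ℝ) := fun G => if hG : Fa G then hG.choose else 0
  have hΦ : ∀ G, Fa G → Fct p G (Φ G) := fun G hG => by
    simp only [Φ, dif_pos hG]; exact hG.choose_spec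
  let c : Finset V → V → (E →ₗ[ℝ] ℝ) := fun G => if hG : Fa G then (Fct_coord h hG.choose_spec).2.choose else 0
  have hc : ∀ G, Fa G → (∀ g ∈ G, ∀ k ∈ G, c G g (p k) = if g = k then 1 else 0) ∧
      ∀ x, x = ∑ g ∈ G, c G g x • p g := fun G hG => by
    simp only [c, dif_pos hG]; exact (Fct_coord h hG.choose_spec).2.choose_spec
  have hΦne : ∀ G, Fa G → ∀ G', Fa G' → Φ G = Φ G' → G = G' := fun G hG G' hG' he => by
    ext v; rw [(hΦ G hG).2.1, (hΦ G' hG').2.1, he]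
  obtain ⟨x, hx1, hx2⟩ := exists_generic
    (((Finset.univ ×ˢ Finset.univ : Finset (Finset V × Finset V)).image (fun q => Φ q.1 - Φ q.2) ∪
      (Finset.univ ×ˢ Finset.univ : Finset (Finset V × V)).image (fun q => c q.1 q.2)).erase 0)
    (fun f hf => (Finset.mem_erase.1 hf).1) (F0.image (c F0)) (∑ g ∈ F0, p g) (by
      intro f hf
      obtain ⟨g, hg, rfl⟩ := Finset.mem_image.1 hf
      rw [map_sum, Finset.sum_congr rfl fun k hk => (hc F0 hF0).1 g hg k hk]
      simp [hg])
  have hval : ∀ G, Fa G → ∀ G', Fa G' → Φ G x = Φ G' x → G = G' := by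
    intro G hG G' hG' he
    by_contra hne
    refine hx1 (Φ G - Φ G') (Finset.mem_erase.2 ⟨fun h0 => hne (hΦne G hG G' hG' (sub_eq_zero.1 h0)), ?_⟩) ?_
    · exact Finset.mem_union_left _ (Finset.mem_image.2 ⟨(G, G'), by simp, rfl⟩)
    · rw [LinearMap.sub_apply, he, sub_self]
  have hcx : ∀ G, Fa G → ∀ g ∈ G, c G g x ≠ 0 := by
    intro G hG g hg
    refine hx1 _ (Finset.mem_erase.2 ⟨fun h0 => ?_, ?_⟩)
    · have := (hc G hG).1 g hg g hg
      rw [h0] at this; simp at this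
    · exact Finset.mem_union_right _ (Finset.mem_image.2 ⟨(G, g), by simp, rfl⟩)
  have hΦx : ∀ G, Fa G → ∀ f : E →ₗ[ℝ] ℝ, f x = ∑ g ∈ G, c G g x * f (p g) := by
    intro G hG f
    conv_lhs => rw [(hc G hG).2 x, map_sum]
    simp
  have hΦs : ∀ G, Fa G → Φ G x = ∑ g ∈ G, c G g x := by
    intro G hG
    rw [hΦx G hG]
    refine Finset.sum_congr rfl fun g hg => ?_
    rw [((hΦ G hG).2.1 g).1 hg, mul_one]
  refine ⟨fun G => Φ G x, fun G => G.filter fun g => 0 < c G g x, hval, ?_, ?_, ?_, ?_⟩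
  · intro G hG G' hG' s hRs hsG hsG' hne
    refine lt_of_le_of_ne ?_ fun he => hne (hval G hG G' hG' he).symm
    show Φ G x ≤ Φ G' x
    rw [hΦs G hG, hΦx G hG (Φ G')]
    refine Finset.sum_le_sum fun g hg => ?_
    by_cases hgs : g ∈ s
    · rw [((hΦ G' hG').2.1 g).1 (hsG' hgs), mul_one]
    · have h1 : c G g x ≤ 0 := by
        by_contra h0; exact hgs (hRs (Finset.mem_filter.2 ⟨hg, not_le.1 h0⟩))
      nlinarith [(hΦ G' hG').1 g]
  · intro G hG s hsG hmin g hg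
    rw [Finset.mem_filter] at hg
    by_contra hgs
    obtain ⟨hφ, heq, hsp⟩ := hΦ G hG
    have hcg := (hc G hG).1 g hg.1
    obtain ⟨t, ht, h1, v, hv, hlt, hev⟩ := ext_lem h (φ := Φ G) (ψ := - c G g) hφ (by
        intro h0
        have := hcg g hg.1
        rw [neg_eq_zero.1 h0] at this; simp at this) (by
        intro w hw
        rw [LinearMap.neg_apply, hcg w ((heq w).2 hw)]; split_ifs <;> simp)
    have hF' : Fct p (Finset.univ.filter fun w => (Φ G + t • - c G g) (p w) = 1) (Φ G + t • - c G g) := by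
      refine ⟨h1, by simp, fun χ hχ => ?_⟩
      have hz : ∀ k ∈ G, k ≠ g → χ (p k) = 0 := by
        intro k hk hkg
        refine hχ k ?_
        rw [Finset.mem_filter]
        refine ⟨Finset.mem_univ _, ?_⟩
        simp [(heq k).1 hk, hcg k hk, Ne.symm hkg]
      have e1 : ∀ y, χ y = c G g y * χ (p g) := by
        intro y
        conv_lhs => rw [(hc G hG).2 y, map_sum]
        rw [Finset.sum_eq_single_of_mem g hg.1]
        · simp
        · intro k hk hkg; simp [hz k hk hkg]
      have e2 := hχ v (by rw [Finset.mem_filter]; exact ⟨Finset.mem_univ _, hev⟩)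
      rw [e1] at e2
      have e3 : χ (p g) = 0 := by
        refine (mul_eq_zero.1 e2).resolve_left fun h0 => ?_
        rw [LinearMap.neg_apply, h0] at hv; simp at hv
      ext y; rw [e1, e3]; simp
    have hFa' : Fa _ := ⟨_, hF'⟩
    have hle := hmin _ hFa' (by
      intro k hk
      rw [Finset.mem_filter]
      refine ⟨Finset.mem_univ _, ?_⟩
      have : g ≠ k := by rintro rfl; exact hgs hk
      simp [(heq k).1 (hsG hk), hcg k (hsG hk), this])
    have huniq : Φ (Finset.univ.filter fun w => (Φ G + t • - c G g) (p w) = 1) = Φ G + t • - c G g := by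
      refine sub_eq_zero.1 (hF'.2.2 _ fun k hk => ?_)
      rw [LinearMap.sub_apply, (hF'.2.1 k).1 hk, ((hΦ _ hFa').2.1 k).1 hk, sub_self]
    have hle' : Φ G x ≤ (Φ G + t • - c G g) x := by rw [← huniq]; exact hle
    simp at hle'
    nlinarith [hg.2]
  · intro g hg
    exact Finset.mem_filter.2 ⟨hg, hx2 _ (Finset.mem_image_of_mem _ hg)⟩
  · intro G hG hne
    by_contra hcon
    push Not at hcon
    refine hne (hval G hG F0 hF0 (le_antisymm ?_ ?_))
    · rw [hΦs F0 hF0, hΦx F0 hF0 (Φ G)]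
      refine Finset.sum_le_sum fun g hg => ?_
      nlinarith [(hΦ G hG).1 g, hx2 _ (Finset.mem_image_of_mem (c F0) hg)]
    · rw [hΦs G hG, hΦx G hG (Φ F0)]
      refine Finset.sum_le_sum fun g hg => ?_
      nlinarith [(hΦ F0 hF0).1 g, (Finset.mem_filter.1 (hcon g hg)).2]
/-- summary of the combinatorics of the boundary complex -/
structure Cmb (fa : Finset V → Prop) (d : ℕ) : Prop where
  card : ∀ G, fa G → G.card = d
  shell : ∀ F0, fa F0 → ∃ val R, ShD fa F0 val R
theorem PT_of {d : ℕ} (Q : SimplicialPolytope d V) : ∃ p : V → EuclideanSpace ℝ (Fin d), PT p ∧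
    ∀ s, (s = ∅ ∨ s ∈ Q.boundaryComplex.faces) ↔ ∃ φ : EuclideanSpace ℝ (Fin d) →ₗ[ℝ] ℝ,
      (∀ v, φ (p v) ≤ 1) ∧ ∀ v ∈ s, φ (p v) = 1 := by
  classical
  have hne : Nonempty V := by
    by_contra h
    rw [not_nonempty_iff] at h
    have := Q.full_dim
    rw [Set.range_eq_empty, AffineSubspace.span_empty] at this
    exact absurd this (AffineSubspace.bot_ne_top _ _ _)
  set n : ℝ := (Fintype.card V : ℝ) with hn
  have hn0 : 0 < n := by rw [hn]; exact_mod_cast Fintype.card_pos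
  set q : EuclideanSpace ℝ (Fin d) := n⁻¹ • ∑ v, Q.vert v with hq
  have hsum : ∑ v, (Q.vert v - q) = 0 := by
    rw [Finset.sum_sub_distrib, Finset.sum_const, Finset.card_univ, ← Nat.cast_smul_eq_nsmul ℝ, ← hn, hq, smul_smul,
      mul_inv_cancel₀ hn0.ne', one_smul, sub_self]
  have hface : ∀ φ : EuclideanSpace ℝ (Fin d) →ₗ[ℝ] ℝ, (∀ v, φ (Q.vert v - q) ≤ 1) →
      (Finset.univ.filter fun v => φ (Q.vert v - q) = 1) ≠ Finset.univ ∧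
      IsFaceOf Q.vert (Finset.univ.filter fun v => φ (Q.vert v - q) = 1) := by
    intro φ hφ
    refine ⟨fun h => ?_, φ, 1 + φ q, fun v hv => ?_, fun v hv => ?_⟩
    · have h1 : ∑ v, φ (Q.vert v - q) = 0 := by rw [← map_sum, hsum, map_zero]
      have h2 : ∀ v, φ (Q.vert v - q) = 1 := fun v => by
        have := Finset.mem_univ v
        rw [← h] at this; exact (Finset.mem_filter.1 this).2
      rw [Finset.sum_congr rfl fun v _ => h2 v] at h1
      simp at h1
    · have := (Finset.mem_filter.1 hv).2
      rw [map_sub] at this; linarith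
    · have h1 : φ (Q.vert v - q) ≠ 1 := fun h => hv (by simpa using h)
      have := lt_of_le_of_ne (hφ v) h1
      rw [map_sub] at this; linarith
  refine ⟨fun v => Q.vert v - q, ⟨hsum, fun φ hφ => ?_, fun φ hφ => ?_⟩, fun s => ⟨?_, ?_⟩⟩
  · have h1 : vectorSpan ℝ (Set.range Q.vert) = ⊤ := by
      rw [← direction_affineSpan, Q.full_dim, AffineSubspace.direction_top]
    have h2 : vectorSpan ℝ (Set.range Q.vert) ≤ LinearMap.ker φ := by
      rw [vectorSpan_def, Submodule.span_le]
      rintro _ ⟨_, ⟨v, rfl⟩, _, ⟨w, rfl⟩, rfl⟩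
      have a := hφ v
      have b := hφ w
      rw [map_sub] at a b
      show φ (Q.vert v -ᵥ Q.vert w) = 0
      rw [vsub_eq_sub, map_sub]; linarith
    rw [h1, top_le_iff, LinearMap.ker_eq_top] at h2
    exact h2
  · obtain ⟨h1, h2⟩ := hface φ hφ
    have h3 := Q.simplicial _ h1 h2
    have h4 : AffineIndependent ℝ (fun v : {v // φ (Q.vert v - q) = 1} => Q.vert v) :=
      h3.comp_embedding ⟨fun v : {v // φ (Q.vert v - q) = 1} => (⟨v.1, by simpa using v.2⟩ : {x // x ∈ Finset.univ.filter fun v => φ (Q.vert v - q) = 1}), fun a b hab => Subtype.ext (by simpa using hab)⟩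
    rw [Fintype.linearIndependent_iff]
    intro c hc i
    have h5 : ∑ v : {v // φ (Q.vert v - q) = 1}, c v = 0 := by
      have := congrArg φ hc
      rw [map_sum, map_zero] at this
      rw [← this]
      refine Finset.sum_congr rfl fun v _ => ?_
      rw [map_smul, v.2]; simp
    rw [affineIndependent_iff] at h4
    refine h4 Finset.univ c h5 ?_ i (Finset.mem_univ i)
    simp only [smul_sub, Finset.sum_sub_distrib, ← Finset.sum_smul, h5, zero_smul, sub_zero] at hc
    exact hc
  · rintro (rfl | ⟨hs, t, ht, ⟨f, c, h1, h2⟩, hst⟩)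
    · exact ⟨0, by simp, by simp⟩
    · have hle : ∀ v, f (Q.vert v) ≤ c := fun v => by
        by_cases hv : v ∈ t
        · exact (h1 v hv).le
        · exact (h2 v hv).le
      obtain ⟨w, hw⟩ : ∃ w, w ∉ t := by
        by_contra hc; push Not at hc; exact ht (Finset.eq_univ_iff_forall.2 hc)
      have hlt : f q < c := by
        rw [hq, map_smul, map_sum, smul_eq_mul, inv_mul_lt_iff₀ hn0]
        calc ∑ v, f (Q.vert v) < ∑ v : V, c := Finset.sum_lt_sum (fun v _ => hle v) ⟨w, Finset.mem_univ _, h2 w hw⟩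
          _ = n * c := by simp [hn]
      have hpos : 0 < c - f q := by linarith
      refine ⟨(c - f q)⁻¹ • f, fun v => ?_, fun v hv => ?_⟩
      · rw [LinearMap.smul_apply, map_sub, smul_eq_mul, inv_mul_le_iff₀ hpos]; linarith [hle v]
      · rw [LinearMap.smul_apply, map_sub, smul_eq_mul, h1 v (hst hv), inv_mul_cancel₀ hpos.ne']
  · rintro ⟨φ, hφ, hs⟩
    by_cases h0 : s = ∅
    · exact Or.inl h0
    · exact Or.inr ⟨Finset.nonempty_iff_ne_empty.2 h0, _, (hface φ hφ).1, (hface φ hφ).2, fun v hv => by simpa using hs v hv⟩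
theorem Cmb_of {d : ℕ} (Q : SimplicialPolytope d V) : ∃ fa : Finset V → Prop, Cmb fa d ∧
    ∀ s, (s = ∅ ∨ s ∈ Q.boundaryComplex.faces) ↔ ∃ G, fa G ∧ s ⊆ G := by
  classical
  obtain ⟨p, hp, hs⟩ := PT_of Q
  refine ⟨fun G => ∃ φ, Fct p G φ, ⟨fun G hG => ?_, fun F0 hF0 => exists_ShD hp F0 hF0⟩, fun s => ?_⟩
  · obtain ⟨φ, hφ⟩ := hG
    rw [(Fct_coord hp hφ).1]; simp
  · rw [hs]
    constructor
    · rintro ⟨φ, h1, h2⟩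
      obtain ⟨G, φ', h3, h4⟩ := Fct_ext hp φ h1
      exact ⟨G, ⟨φ', h3⟩, fun v hv => h4 v (h2 v hv)⟩
    · rintro ⟨G, ⟨φ, h1⟩, h2⟩
      exact ⟨φ, h1.1, fun v hv => (h1.2.1 v).1 (h2 hv)⟩
end Geo
namespace KZ
open Geo
variable {κ : Type} [Field κ] [CharZero κ] {σ : Type} [Fintype σ] [DecidableEq σ]
def cx (P : Finset σ → Prop) : Set (Finset σ) := {s | ¬ P s}
def DC (P : Finset σ → Prop) : Prop := ∀ s t, P t → s ⊆ t → P s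
theorem fc_cx {P : Finset σ → Prop} (hP : DC P) (t : Finset σ) : fc (cx P) t ↔ P t := by
  constructor
  · intro h
    by_contra h2
    exact h t h2 subset_rfl
  · intro h s hs hst
    exact hs (hP s t h hst)
def cK (fa : Finset σ → Prop) (t : Finset σ) : Prop := ∃ G, fa G ∧ t ⊆ G
def cKF (fa : Finset σ → Prop) (F t : Finset σ) : Prop := cK fa t ∧ ¬ F ⊆ t
def cL (fa : Finset σ → Prop) (F : Finset σ) (n : σ) (t : Finset σ) : Prop :=
  (cK fa t ∧ ¬ F ⊆ t) ∨ (n ∈ t ∧ t.erase n ⊂ F)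
def cdel (P : Finset σ → Prop) (v : σ) (t : Finset σ) : Prop := P t ∧ v ∉ t
theorem DC_K (fa : Finset σ → Prop) : DC (cK fa) := by
  rintro s t ⟨G, h1, h2⟩ hst
  exact ⟨G, h1, hst.trans h2⟩
theorem DC_KF (fa : Finset σ → Prop) (F) : DC (cKF fa F) := by
  rintro s t ⟨h1, h2⟩ hst
  exact ⟨DC_K fa s t h1 hst, fun h => h2 (h.trans hst)⟩
theorem DC_L {fa : Finset σ → Prop} {F} (hF : fa F) (n) : DC (cL fa F n) := by
  rintro s t (⟨h1, h2⟩ | ⟨h1, h2⟩) hst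
  · exact Or.inl ⟨DC_K fa s t h1 hst, fun h => h2 (h.trans hst)⟩
  · by_cases hn : n ∈ s
    · exact Or.inr ⟨hn, lt_of_le_of_lt (Finset.erase_subset_erase n hst) h2⟩
    · have : s ⊆ t.erase n := Finset.subset_erase.2 ⟨hst, hn⟩
      exact Or.inl ⟨⟨F, hF, this.trans h2.subset⟩, fun h => h2.2 (h.trans this)⟩
theorem DC_del {P : Finset σ → Prop} (hP : DC P) (v) : DC (cdel P v) := by
  rintro s t ⟨h1, h2⟩ hst
  exact ⟨hP s t h1 hst, fun h => h2 (hst h)⟩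
theorem Cmb_eq {fa : Finset σ → Prop} {d} (h : Cmb fa d) {t} (ht : cK fa t) (hc : t.card = d) : fa t := by
  obtain ⟨G, h1, h2⟩ := ht
  rw [Finset.eq_of_subset_of_card_le h2 (by rw [h.card G h1, hc])]
  exact h1
theorem Cmb_sub {fa : Finset σ → Prop} {d} (h : Cmb fa d) {F G} (hF : fa F) (hG : fa G) (hs : F ⊆ G) : F = G :=
  Finset.eq_of_subset_of_card_le hs (by rw [h.card G hG, h.card F hF])
theorem exists_rho (fa : Finset σ → Prop) (val : Finset σ → ℝ) : ∃ ρ : Finset σ → ℝ,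
    ∀ s, cK fa s → ∃ G, fa G ∧ s ⊆ G ∧ ρ s = val G ∧ ∀ G', fa G' → s ⊆ G' → val G ≤ val G' := by
  classical
  have : ∀ s, ∃ r : ℝ, cK fa s → ∃ G, fa G ∧ s ⊆ G ∧ r = val G ∧ ∀ G', fa G' → s ⊆ G' → val G ≤ val G' := by
    intro s
    by_cases h : cK fa s
    · obtain ⟨G0, h1, h2⟩ := h
      obtain ⟨G, hG, hm⟩ := Finset.exists_min_image (Finset.univ.filter fun G => fa G ∧ s ⊆ G) val
        ⟨G0, by simp [h1, h2]⟩
      simp only [Finset.mem_filter, Finset.mem_univ, true_and] at hG hm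
      exact ⟨val G, fun _ => ⟨G, hG.1, hG.2, rfl, fun G' a b => hm G' ⟨a, b⟩⟩⟩
    · exact ⟨0, fun h' => absurd h' h⟩
  choose ρ hρ using this
  exact ⟨ρ, hρ⟩
theorem Sh_of {fa : Finset σ → Prop} {d} (h : Cmb fa d) {F} (hF : fa F) (f0 : σ) :
    ∃ ρ gg, Sh (cx (cKF fa F)) ρ gg := by
  classical
  obtain ⟨val, R, hS⟩ := h.shell F hF
  obtain ⟨ρ, hρ⟩ := exists_rho fa val
  have hg : ∀ t : ℝ, ∃ g : σ, ∀ G, fa G → G ≠ F → val G = t → g ∈ G ∧ g ∉ R G := by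
    intro t
    by_cases h1 : ∃ G, fa G ∧ G ≠ F ∧ val G = t
    · obtain ⟨G, a, b, c⟩ := h1
      obtain ⟨g, hg1, hg2⟩ := hS.R1 G a b
      refine ⟨g, fun G' a' b' c' => ?_⟩
      have := hS.inj G a G' a' (c.trans c'.symm)
      subst this
      exact ⟨hg1, hg2⟩
    · exact ⟨f0, fun G a b c => absurd ⟨G, a, b, c⟩ h1⟩
  choose gg hgg using hg
  have key : ∀ s, cKF fa F s → ∃ G, fa G ∧ s ⊆ G ∧ ρ s = val G ∧ G ≠ F ∧ R G ⊆ s ∧ gg (ρ s) ∈ G ∧ gg (ρ s) ∉ R G := by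
    rintro s ⟨hs, hs2⟩
    obtain ⟨G, a, b, c, e⟩ := hρ s hs
    have hR := hS.own G a s b e
    have hne : G ≠ F := by
      rintro rfl
      exact hs2 (hS.R0.trans hR)
    obtain ⟨g1, g2⟩ := hgg (ρ s) G a hne c.symm
    exact ⟨G, a, b, c, hne, hR, g1, g2⟩
  have up : ∀ s G i, cKF fa F s → fa G → s ⊆ G → ρ s = val G → G ≠ F → i ∈ G →
      cKF fa F (insert i s) ∧ ρ (insert i s) = ρ s := by
    intro s G i hs hG hsG hρs hne hi
    have hsub : insert i s ⊆ G := Finset.insert_subset hi hsG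
    refine ⟨⟨⟨G, hG, hsub⟩, fun hh => hne (Cmb_sub h hF hG (hh.trans hsub)).symm⟩, ?_⟩
    obtain ⟨G1, a1, b1, c1, e1⟩ := hρ (insert i s) ⟨G, hG, hsub⟩
    obtain ⟨G2, a2, b2, c2, e2⟩ := hρ s hs.1
    apply le_antisymm
    · rw [c1, hρs]; exact e1 G hG hsub
    · rw [c1, c2]; exact e2 G1 a1 ((Finset.subset_insert _ _).trans b1)
  refine ⟨ρ, gg, ⟨?_, ?_, ?_⟩⟩
  · intro s s' hs' hss
    rw [fc_cx (DC_KF fa F)] at hs'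
    obtain ⟨G1, a1, b1, c1, e1⟩ := hρ s' hs'.1
    obtain ⟨G2, a2, b2, c2, e2⟩ := hρ s (DC_K fa _ _ hs'.1 hss)
    rw [c1, c2]; exact e2 G1 a1 (hss.trans b1)
  · intro s hs
    rw [fc_cx (DC_KF fa F)] at hs ⊢
    obtain ⟨G, a, b, c, hne, hR, g1, g2⟩ := key s hs
    exact up s G _ hs a b c hne g1
  · intro s i hs hgs ht hle
    rw [fc_cx (DC_KF fa F)] at hs ht ⊢
    obtain ⟨G, a, b, c, hne, hR, g1, g2⟩ := key s hs
    obtain ⟨G', a', b', c', hne', hR', g1', g2'⟩ := key _ ht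
    have hEq : G' = G := by
      by_contra hn
      have := hS.lt G a G' a' (s.erase (gg (ρ s))) (Finset.subset_erase.2 ⟨hR, g2⟩)
        ((Finset.erase_subset _ _).trans b) ((Finset.subset_insert _ _).trans b') hn
      rw [← c, ← c'] at this
      linarith
    subst hEq
    exact up s _ i hs a b c hne (b' (Finset.mem_insert_self _ _))
theorem walk {fa : Finset σ → Prop} {d} (h : Cmb fa d) {F0 : Finset σ} {v : σ} (hF0 : fa F0) (hv : v ∈ F0)
    (X : Finset σ → Prop)
    (step : ∀ G, fa G → v ∉ G → ∀ g ∈ G, (∀ G', fa G' → G.erase g ⊆ G' → G' ≠ G → v ∉ G' → X G') → X G) :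
    ∀ G, fa G → v ∉ G → X G := by
  classical
  obtain ⟨val, R, hS⟩ := h.shell F0 hF0
  suffices H : ∀ m G, (Finset.univ.filter fun G' => fa G' ∧ val G < val G').card = m → fa G → v ∉ G → X G from
    fun G => H _ G rfl
  intro m
  induction m using Nat.strong_induction_on with
  | _ m ih =>
    intro G hm hG hvG
    obtain ⟨g, hg, hgR⟩ := hS.R1 G hG (by rintro rfl; exact hvG hv)
    refine step G hG hvG g hg fun G' hG' hsub hne hv' => ?_
    have hR : R G ⊆ G.erase g :=
      Finset.subset_erase.2 ⟨hS.own G hG G subset_rfl (fun G'' h1 h2 => by rw [Cmb_sub h hG h1 h2]), hgR⟩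
    have hlt := hS.lt G hG G' hG' (G.erase g) hR (Finset.erase_subset _ _) hsub hne
    refine ih _ ?_ G' rfl hG' hv'
    rw [← hm]
    apply Finset.card_lt_card
    rw [Finset.ssubset_iff_of_subset]
    · exact ⟨G', by simp [hG', hlt], by simp⟩
    · intro H hH
      simp only [Finset.mem_filter, Finset.mem_univ, true_and] at hH ⊢
      exact ⟨hH.1, hlt.trans hH.2⟩
theorem TV_D {fa : Finset σ → Prop} {d} (h : Cmb fa d) {F F0 : Finset σ} {v : σ} (hF : fa F) (hvF : v ∉ F)
    (hF0 : fa F0) (hv : v ∈ F0) : TV κ (cx (cdel (cKF fa F) v)) d := by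
  have hfc := fc_cx (DC_del (DC_KF fa F) v)
  have W := walk h hF0 hv (fun G => G ≠ F → PF κ (cx (cdel (cKF fa F) v)) G) ?_
  · refine TV_of ?_ ?_
    · intro t ht
      obtain ⟨⟨⟨G, h1, h2⟩, _⟩, _⟩ := (hfc t).1 ht
      rw [← h.card G h1]; exact Finset.card_le_card h2
    · intro G hG hc
      obtain ⟨⟨h1, h2⟩, h3⟩ := (hfc G).1 hG
      exact W G (Cmb_eq h h1 hc) h3 (by rintro rfl; exact h2 subset_rfl)
  · intro G hG hvG g hg hyp hne
    refine PF_step hg fun i hi hfi => ?_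
    obtain ⟨⟨h1, h2⟩, h3⟩ := (hfc _).1 hfi
    have hc : (insert i (G.erase g)).card = d := by
      rw [Finset.card_insert_of_notMem (fun hh => hi (Finset.mem_of_mem_erase hh)),
        Finset.card_erase_of_mem hg, h.card G hG]
      have := Finset.card_pos.2 ⟨g, hg⟩
      rw [h.card G hG] at this; omega
    exact hyp _ (Cmb_eq h h1 hc) (Finset.subset_insert _ _)
      (fun hh => hi (hh ▸ Finset.mem_insert_self _ _)) h3 (fun hh => h2 hh.symm.subset)
theorem ssub_erase {S F : Finset σ} (h : S ⊂ F) (hc : F.card = S.card + 1) : ∃ f ∈ F, S = F.erase f := by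
  obtain ⟨f, hf, hf'⟩ := Finset.exists_of_ssubset h
  refine ⟨f, hf, Finset.eq_of_subset_of_card_le (Finset.subset_erase.2 ⟨h.subset, hf'⟩) ?_⟩
  rw [Finset.card_erase_of_mem hf]; omega
theorem TV_C {fa : Finset σ → Prop} {d} (h : Cmb fa d) {F F0 : Finset σ} {v n : σ} (hF : fa F) (hvF : v ∉ F)
    (hF0 : fa F0) (hv : v ∈ F0) (hn : ∀ G, fa G → n ∉ G) : TV κ (cx (cdel (cL fa F n) v)) d := by
  have hfc := fc_cx (DC_del (DC_L hF n) v)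
  set N := cx (cdel (cL fa F n) v) with hN
  have hFc := h.card F hF
  have hnF := hn F hF
  have W := walk h hF0 hv (fun G => (G ≠ F → PF κ N G) ∧ (G = F → ∀ f ∈ F, PF κ N (insert n (F.erase f)))) ?_
  · refine TV_of ?_ ?_
    · intro t ht
      obtain ⟨⟨⟨G, h1, h2⟩, _⟩ | ⟨h1, h2⟩, _⟩ := (hfc t).1 ht
      · rw [← h.card G h1]; exact Finset.card_le_card h2
      · have := Finset.card_lt_card h2
        rw [Finset.card_erase_of_mem h1, hFc] at this
        omega
    · intro G hG hc
      obtain ⟨⟨h1, h2⟩ | ⟨h1, h2⟩, h3⟩ := (hfc G).1 hG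
      · exact (W G (Cmb_eq h h1 hc) h3).1 (by rintro rfl; exact h2 subset_rfl)
      · obtain ⟨f, hf, hE⟩ := ssub_erase h2 (by rw [Finset.card_erase_add_one h1, hFc, hc])
        have := (W F hF hvF).2 rfl f hf
        rwa [← hE, Finset.insert_erase h1] at this
  · intro G hG hvG g hg hyp
    have hcard : ∀ i, i ∉ G → (insert i (G.erase g)).card = d := by
      intro i hi
      rw [Finset.card_insert_of_notMem (fun hh => hi (Finset.mem_of_mem_erase hh)),
        Finset.card_erase_of_mem hg, h.card G hG]
      have := Finset.card_pos.2 ⟨g, hg⟩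
      rw [h.card G hG] at this; omega
    constructor
    · intro hne
      refine PF_step hg fun i hi hfi => ?_
      obtain ⟨⟨h1, h2⟩ | ⟨h1, h2⟩, h3⟩ := (hfc _).1 hfi
      · exact (hyp _ (Cmb_eq h h1 (hcard i hi)) (Finset.subset_insert _ _)
          (fun hh => hi (hh ▸ Finset.mem_insert_self _ _)) h3).1 (fun hh => h2 hh.symm.subset)
      · have hnG := hn G hG
        have hin : i = n := by
          rcases Finset.mem_insert.1 h1 with hh | hh
          · exact hh.symm
          · exact absurd (Finset.mem_of_mem_erase hh) hnG
        subst hin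
        rw [Finset.erase_insert (fun hh => hnG (Finset.mem_of_mem_erase hh))] at h2
        obtain ⟨f, hf, hE⟩ := ssub_erase h2 (by rw [Finset.card_erase_add_one hg, hFc, h.card G hG])
        rw [hE]
        exact (hyp F hF h2.subset (fun hh => hne hh.symm) hvF).2 rfl f hf
    · rintro rfl
      have hngG : n ∉ G.erase g := fun hh => hnF (Finset.mem_of_mem_erase hh)
      have first : PF κ N (insert n (G.erase g)) := by
        refine PF_step (Finset.mem_insert_self _ _) fun i hi hfi => ?_
        rw [Finset.erase_insert hngG] at hfi ⊢
        have hin : i ≠ n := fun hh => hi (hh ▸ Finset.mem_insert_self _ _)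
        have hnT : n ∉ insert i (G.erase g) := by
          rw [Finset.mem_insert]; rintro (hh | hh)
          · exact hin hh.symm
          · exact hngG hh
        obtain ⟨⟨h1, h2⟩ | ⟨h1, h2⟩, h3⟩ := (hfc _).1 hfi
        · have hiG : i ∉ G := by
            intro hiG
            by_cases hig : i = g
            · subst hig; exact h2 (by rw [Finset.insert_erase hg])
            · exact hi (Finset.mem_insert_of_mem (Finset.mem_erase.2 ⟨hig, hiG⟩))
          exact (hyp _ (Cmb_eq h h1 (hcard i hiG)) (Finset.subset_insert _ _)
            (fun hh => hiG (hh ▸ Finset.mem_insert_self _ _)) h3).1 (fun hh => h2 hh.symm.subset)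
        · exact absurd h1 hnT
      intro f hf
      by_cases hfg : f = g
      · rw [hfg]; exact first
      · have hgn : g ≠ n := by rintro rfl; exact hnF hg
        have hfn : f ≠ n := by rintro rfl; exact hnF hf
        refine PF_step (g := g) (Finset.mem_insert_of_mem (Finset.mem_erase.2 ⟨fun hh => hfg hh.symm, hg⟩)) fun i hi hfi => ?_
        have hin : i ≠ n := fun hh => hi (hh ▸ Finset.mem_insert_self _ _)
        have hnT : n ∈ insert i ((insert n (G.erase f)).erase g) :=
          Finset.mem_insert_of_mem (Finset.mem_erase.2 ⟨fun hh => hgn hh.symm, Finset.mem_insert_self _ _⟩)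
        obtain ⟨⟨⟨H, h1, h1'⟩, h2⟩ | ⟨h1, h2⟩, h3⟩ := (hfc _).1 hfi
        · exact absurd (h1' hnT) (hn H h1)
        · have hiG : i ∈ G := h2.subset (Finset.mem_erase.2 ⟨hin, Finset.mem_insert_self _ _⟩)
          have hif : i = f := by
            by_contra hh
            exact hi (Finset.mem_insert_of_mem (Finset.mem_erase.2 ⟨hh, hiG⟩))
          subst hif
          have : insert i ((insert n (G.erase i)).erase g) = insert n (G.erase g) := by
            ext x
            simp only [Finset.mem_insert, Finset.mem_erase]
            constructor
            · rintro (rfl | ⟨a, b | ⟨b, c⟩⟩)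
              · exact Or.inr ⟨hfg, hf⟩
              · exact Or.inl b
              · exact Or.inr ⟨a, c⟩
            · rintro (rfl | ⟨a, b⟩)
              · exact Or.inr ⟨fun hh => hgn hh.symm, Or.inl rfl⟩
              · by_cases hx : x = i
                · exact Or.inl hx
                · exact Or.inr ⟨a, Or.inr ⟨hx, b⟩⟩
          rw [this]
          exact first
theorem SS_A {fa : Finset σ → Prop} {d} (hd : 2 ≤ d) (h : Cmb fa d) {F : Finset σ} (hF : fa F)
    (hv : ∀ v, ∃ G, fa G ∧ v ∈ G) (hS : ∀ v, SS κ (cx (cdel (cK fa) v))) : SS κ (cx (cKF fa F)) := by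
  have hN := fc_cx (DC_KF fa F)
  have hdel : ∀ v, SS κ (cx (cdel (cKF fa F) v)) := by
    intro v
    have h1 := fc_cx (DC_del (DC_KF fa F) v)
    have h2 := fc_cx (DC_del (DC_K fa) v)
    by_cases hvF : v ∈ F
    · refine SS_congr (fun t => ?_) (hS v)
      rw [h1, h2]
      exact ⟨fun a => ⟨a.1.1, a.2⟩, fun a => ⟨⟨a.1, fun b => a.2 (b hvF)⟩, a.2⟩⟩
    · obtain ⟨G, hG, hvG⟩ := hv v
      refine SS_cut F d hd (h.card F hF) (fun t => ?_) (TV_D h hF hvF hG hvG) (hS v)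
      rw [h1, h2]
      exact ⟨fun a => ⟨⟨a.1.1, a.2⟩, a.1.2⟩, fun a => ⟨⟨a.1.1, a.2⟩, a.1.2⟩⟩
  obtain ⟨f0, hf0⟩ : F.Nonempty := Finset.card_pos.1 (by rw [h.card F hF]; omega)
  obtain ⟨ρ, gg, hSh⟩ := Sh_of h hF f0
  refine SS_of fun x hx hdx hx2 => ?_
  have hM : ∀ g t, fc (cx (cdel (cKF fa F) g)) t ↔ fc (cx (cKF fa F)) t ∧ g ∉ t := by
    intro g t
    rw [fc_cx (DC_del (DC_KF fa F) g), hN]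
    exact Iff.rfl
  obtain ⟨y, hy, hq⟩ := MM_exists hdx (fun g => by
    refine qq_detect g (hM g) ?_
    obtain ⟨y, hy, hy2⟩ := hdel g _ (qt_dec (fun t h => ((hM g t).1 h).1) hx)
    exact ⟨y, hy2⟩)
  exact hq.rng (acyc hSh y hy hq.2)
theorem SS_B {fa : Finset σ → Prop} {F : Finset σ} {v n : σ} (hF : fa F) (hvF : v ∈ F)
    (hn : ∀ G, fa G → n ∉ G) (hS : SS κ (cx (cdel (cK fa) v))) : SS κ (cx (cdel (cL fa F n) v)) := by
  have h1 := fc_cx (DC_del (DC_L hF n) v)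
  have h2 := fc_cx (DC_del (DC_K fa) v)
  have hnF := hn F hF
  have hnv : n ≠ v := by rintro rfl; exact hnF hvF
  refine SS_cone n (F.erase v) (fun t ht => ?_) (fun hh => hnF (Finset.mem_of_mem_erase hh)) (fun t => ?_) hS
  · obtain ⟨⟨G, a, b⟩, _⟩ := (h2 t).1 ht
    exact fun c => hn G a (b c)
  · rw [h1, h2]
    constructor
    · rintro ⟨⟨a, b⟩ | ⟨a, b⟩, c⟩
      · exact Or.inl ⟨a, c⟩
      · exact Or.inr ⟨a, Finset.subset_erase.2 ⟨b.subset, fun e => c (Finset.mem_of_mem_erase e)⟩⟩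
    · rintro (⟨a, b⟩ | ⟨a, b⟩)
      · exact ⟨Or.inl ⟨a, fun c => b (c hvF)⟩, b⟩
      · have hvt : v ∉ t := fun c =>
          (Finset.mem_erase.1 (b (Finset.mem_erase.2 ⟨fun e => hnv e.symm, c⟩))).1 rfl
        refine ⟨Or.inr ⟨a, lt_of_le_of_lt b (Finset.erase_ssubset hvF)⟩, hvt⟩
theorem SS_C {fa : Finset σ → Prop} {d} (hd : 2 ≤ d) (h : Cmb fa d) {F F0 : Finset σ} {v n : σ} (hF : fa F) (hvF : v ∉ F)
    (hF0 : fa F0) (hv : v ∈ F0)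
    (hn : ∀ G, fa G → n ∉ G) (hS : SS κ (cx (cdel (cK fa) v))) : SS κ (cx (cdel (cL fa F n) v)) := by
  have h1 := fc_cx (DC_del (DC_L hF n) v)
  have h2 := fc_cx (DC_del (DC_K fa) v)
  have hnF := hn F hF
  have hnv : n ≠ v := by rintro rfl; exact hn F0 hF0 hv
  let P : Finset σ → Prop := fun t => cdel (cK fa) v t ∨ (n ∈ t ∧ t.erase n ⊆ F)
  have hP : DC P := by
    rintro s t (a | ⟨a, b⟩) hst
    · exact Or.inl (DC_del (DC_K fa) v s t a hst)
    · by_cases hs : n ∈ s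
      · exact Or.inr ⟨hs, (Finset.erase_subset_erase n hst).trans b⟩
      · have : s ⊆ F := (Finset.subset_erase.2 ⟨hst, hs⟩).trans b
        exact Or.inl ⟨⟨F, hF, this⟩, fun c => hvF (this c)⟩
  have h3 := fc_cx hP
  have hSP : SS κ (cx P) := by
    refine SS_cone n F (fun t ht => ?_) hnF (fun t => ?_) hS
    · obtain ⟨⟨G, a, b⟩, _⟩ := (h2 t).1 ht
      exact fun c => hn G a (b c)
    · rw [h3, h2]
  refine SS_cut F d hd (h.card F hF) (fun t => ?_) (TV_C h hF hvF hF0 hv hn) hSP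
  rw [h1, h3]
  constructor
  · rintro ⟨⟨a, b⟩ | ⟨a, b⟩, c⟩
    · exact ⟨Or.inl ⟨a, c⟩, b⟩
    · exact ⟨Or.inr ⟨a, b.subset⟩, fun e => b.2 (Finset.subset_erase.2 ⟨e, hnF⟩)⟩
  · rintro ⟨⟨a, b⟩ | ⟨a, b⟩, c⟩
    · exact ⟨Or.inl ⟨a, c⟩, b⟩
    · refine ⟨Or.inr ⟨a, b, fun e => c (e.trans (Finset.erase_subset _ _))⟩, fun e => ?_⟩
      exact hvF (b (Finset.mem_erase.2 ⟨fun e => hnv e.symm, e⟩))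
end KZ
namespace KZ
open Geo
variable {κ : Type} [Field κ] [CharZero κ] {σ : Type} [Fintype σ] [DecidableEq σ]
theorem s1_of_deg {β : σ →₀ ℕ} (h : β.degree = β.support.card) : β = s1 β.support := by
  apply s1_of_le
  intro g
  by_contra hg
  have h1 : β.degree = ∑ i ∈ β.support, β i := rfl
  have h2 : ∑ i ∈ β.support, 1 < ∑ i ∈ β.support, β i := by
    refine Finset.sum_lt_sum (fun i hi => ?_) ⟨g, ?_, by omega⟩
    · have := Finsupp.mem_support_iff.1 hi; omega
    · rw [Finsupp.mem_support_iff]; omega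
  rw [Finset.sum_const, smul_eq_mul, mul_one] at h2
  omega
theorem s1_erase {s : Finset σ} {i : σ} (hi : i ∈ s) : s1 (s.erase i) + ei i = s1 s := by
  ext j
  rw [Finsupp.add_apply, s1_apply, s1_apply, Finsupp.single_apply]
  by_cases h : i = j
  · subst h; simp [hi]
  · have h' : ¬ j = i := fun e => h e.symm
    simp [h, h']
theorem s1_erase_sub {s : Finset σ} {i : σ} (hi : i ∈ s) : s1 s - ei i = s1 (s.erase i) := by
  rw [← s1_erase hi]; exact add_tsub_cancel_right _ _
theorem eq_zero_of_neg {S : EE κ σ} (h : S = - S) : S = 0 := by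
  have h2 : (2 : κ) • S = 0 := by
    rw [two_smul]; nth_rewrite 1 [h]; exact neg_add_cancel S
  exact (smul_eq_zero.1 h2).resolve_left two_ne_zero
theorem S2 {N : Set (Finset σ)} (hS : SS κ N) {a b : KA κ N} (ha : a ∈ Fil N 1) (hb : b ∈ Fil N 1)
    (hda : kD N a = 0) (hdb : kD N b = 0) : ∃ x, kD N x = -(kI κ N a) * b := by
  let A : ℕ → ℕ → KA κ N := fun i j => if i = 0 then a else b
  have hx : (kd N).Dec (Fil N 1) (-(kI κ N a) * b) := by
    refine ⟨2, A, ?_, ?_⟩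
    · intro i j h1 h2 h3
      have hij : (i = 0 ∧ j = 1) ∨ (i = 1 ∧ j = 2) := by omega
      rcases hij with ⟨rfl, rfl⟩ | ⟨rfl, rfl⟩
      · refine ⟨ha, ?_⟩
        rw [DGA.obs, show Ioo 0 1 = (∅ : Finset ℕ) from rfl, Finset.sum_empty]
        exact hda
      · refine ⟨hb, ?_⟩
        rw [DGA.obs, show Ioo 1 2 = (∅ : Finset ℕ) from rfl, Finset.sum_empty]
        exact hdb
    · rw [DGA.obs, show Ioo 0 2 = ({1} : Finset ℕ) from rfl, Finset.sum_singleton]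
      rfl
  obtain ⟨y, _, hy⟩ := hS _ hx
  exact ⟨y, hy⟩
theorem notG {fa : Finset σ → Prop} {d} (hd : 2 ≤ d) (h : Cmb fa d) {F : Finset σ} (hF : fa F) {n : σ}
    (hn : ∀ G, fa G → n ∉ G) (hS : SS κ (cx (cL fa F n))) : False := by
  classical
  have hL := fc_cx (DC_L hF n)
  have hK := fc_cx (DC_K fa)
  have hKF := fc_cx (DC_KF fa F)
  set N := cx (cL fa F n) with hNdef
  set NK := cx (cK fa) with hNKdef
  have hFc := h.card F hF
  have hnF := hn F hF
  obtain ⟨f, hf⟩ : F.Nonempty := Finset.card_pos.1 (by omega)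
  have hfn : f ≠ n := by rintro rfl; exact hnF hf
  obtain ⟨U, hU0, hU, -⟩ := exists_Ln (κ := κ) (insert n F)ᶜ
  have hUn : ct κ n U = 0 := hU.2 n (by simp)
  have hUF : ∀ i ∈ F, ct κ i U = 0 := fun i hi => hU.2 i (by simp [hi])
  have hUT : ∀ i, i ∉ F → i ≠ n → u κ i * U = 0 := fun i h1 h2 => hU.1 i (by simp [h1, h2])
  have hFN : ¬ fc N F := by
    rw [hL]
    rintro (⟨a, b⟩ | ⟨a, b⟩)
    · exact b subset_rfl
    · exact hnF a
  have hcone : ∀ g ∈ F, fc N (insert n (F.erase g)) := by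
    intro g hg
    rw [hL]
    refine Or.inr ⟨Finset.mem_insert_self _ _, ?_⟩
    rw [Finset.erase_insert (fun hh => hnF (Finset.mem_of_mem_erase hh))]
    exact Finset.erase_ssubset hg
  -- the two cycles
  have hda : kD N (tt κ N (s1 (F.erase f)) (u κ f)) = 0 := by
    rw [kD_tt]
    refine Finset.sum_eq_zero fun i _ => ?_
    rw [ct_u]
    split_ifs with hi
    · subst hi
      rw [s1_erase hf]
      exact tt_zero_of (by rw [s1_supp]; exact hFN) _
    · exact map_zero _
  have hdb : kD N (tt κ N (ei n) U) = 0 := by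
    rw [kD_tt]
    refine Finset.sum_eq_zero fun i _ => ?_
    by_cases hin : i = n
    · rw [hin, hUn, map_zero]
    by_cases hiF : i ∈ F
    · rw [hUF i hiF, map_zero]
    refine tt_zero_of ?_ _
    rw [supp_add, hL, Finsupp.support_single_ne_zero _ one_ne_zero]
    rintro (⟨⟨G, a, a'⟩, b⟩ | ⟨a, b⟩)
    · exact hn G a (a' (by simp))
    · exact hiF (b.subset (by simp [hin]))
  obtain ⟨x, hx⟩ := S2 hS (tt_mem_Fil N (by rw [s1_deg, Finset.card_erase_of_mem hf, hFc]; omega) (u κ f))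
    (tt_mem_Fil N (by rw [deg_ei]) U) hda hdb
  rw [kI_tt, ev_u, map_neg, neg_neg, tt_mul] at hx
  -- the transferred chain
  let Tm : (σ →₀ ℕ) → EE κ σ →ₗ[κ] KA κ NK := fun α =>
    if α n = 0 ∧ α.degree = d - 1 then tt κ NK α ∘ₗ (LinearMap.mulLeft κ (u κ n) ∘ₗ ct κ n) else 0
  have hcf : ∀ β, ∀ z : KA κ N, cf NK β (op N Tm z) =
      if β n = 0 ∧ β.degree = d - 1 then u κ n * ct κ n (cf N β z) else 0 := by
    intro β z
    induction z using KA_ind with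
    | h0 => simp
    | ha y z hy hz =>
      rw [map_add, map_add, hy, hz]
      split_ifs with hc
      · rw [map_add, map_add, mul_add]
      · rw [add_zero]
    | ht α e hα =>
      rw [op_tt _ hα, cf_tt _ _ hα]
      by_cases hc : α n = 0 ∧ α.degree = d - 1
      · have hαK : fc NK α.support := by
          rw [hK]
          rcases (hL _).1 hα with hh | hh
          · exact hh.1
          · exact absurd hc.1 (Finsupp.mem_support_iff.1 hh.1)
        have : Tm α e = tt κ NK α (u κ n * ct κ n e) := by
          simp only [Tm, if_pos hc]; rfl
        rw [this, cf_tt _ _ hαK]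
        by_cases hab : α = β
        · subst hab; rw [if_pos rfl, if_pos rfl, if_pos hc]
        · rw [if_neg hab, if_neg hab, map_zero, mul_zero]; split_ifs <;> rfl
      · have : Tm α e = 0 := by simp only [Tm, if_neg hc]; rfl
        rw [this, map_zero]
        by_cases hab : α = β
        · subst hab; rw [if_neg hc]
        · rw [if_neg hab, map_zero, mul_zero]; split_ifs <;> rfl
  have hdy : kD NK (op N Tm x) = - tt κ NK (s1 F) (u κ n * U) := by
    refine ext_cf fun β hβ => ?_
    have hFK : fc NK (s1 F).support := by rw [s1_supp, hK]; exact ⟨F, hF, subset_rfl⟩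
    rw [cf_d hβ, map_neg, cf_tt _ _ hFK]
    have hβn : β n = 0 := by
      obtain ⟨G, a, b⟩ := (hK _).1 hβ
      by_contra hh
      exact hn G a (b (Finsupp.mem_support_iff.2 hh))
    by_cases hdeg : β.degree = d
    swap
    · rw [if_neg (by rintro rfl; exact hdeg (by rw [s1_deg, hFc])), neg_zero]
      refine Finset.sum_eq_zero fun i hi => ?_
      have h1 := congrArg Finsupp.degree (sub_add_ei (Finsupp.mem_support_iff.1 hi))
      rw [deg_add, deg_ei] at h1
      rw [hcf, if_neg (by rintro ⟨-, h2⟩; omega), map_zero]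
    have hstep : ∑ i ∈ β.support, ct κ i (cf NK (β - ei i) (op N Tm x)) =
        u κ n * ct κ n (∑ i ∈ β.support, ct κ i (cf N (β - ei i) x)) := by
      rw [map_sum, Finset.mul_sum]
      refine Finset.sum_congr rfl fun i hi => ?_
      have h1 := congrArg Finsupp.degree (sub_add_ei (Finsupp.mem_support_iff.1 hi))
      rw [deg_add, deg_ei] at h1
      have hin : i ≠ n := by rintro rfl; exact (Finsupp.mem_support_iff.1 hi) hβn
      rw [hcf, if_pos ⟨by rw [Finsupp.tsub_apply, hβn, Nat.zero_sub], by omega⟩, ct_u_mul_ne hin,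
        ct_comm n i, mul_neg]
    rw [hstep]
    by_cases hβN : fc N β.support
    · have ht0 : fc N (s1 (F.erase f) + ei n).support := by
        rw [supp_add, s1_supp]; exact hcone f hf
      rw [← cf_d hβN, hx, cf_tt _ _ ht0, if_neg, if_neg, map_zero, mul_zero, neg_zero]
      · rintro rfl
        rw [s1_supp] at hβN
        exact hFN hβN
      · rintro rfl
        simp at hβn
    have hβF : β = s1 F := by
      obtain ⟨G, a, b⟩ := (hK _).1 hβ
      have hsub : F ⊆ β.support := by
        by_contra hh
        exact hβN ((hL _).2 (Or.inl ⟨⟨G, a, b⟩, hh⟩))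
      have hFG := Cmb_sub h hF a (hsub.trans b)
      subst hFG
      have hE : β.support = F := Finset.Subset.antisymm b hsub
      rw [← hE]
      apply s1_of_deg
      rw [hE, hdeg, hFc]
    subst hβF
    rw [if_pos rfl, s1_supp, map_sum]
    have hY : ∀ g ∈ F, ct κ n (ct κ g (cf N (s1 F - ei g) x)) =
        (if g = f then - U else 0) + ∑ i ∈ F, ct κ g (ct κ i (cf N (s1 F - ei g - ei i + ei n) x)) := by
      intro g hg
      have hfg : fc N (s1 (F.erase g) + ei n).support := by rw [supp_add, s1_supp]; exact hcone g hg
      have hng : n ∉ F.erase g := fun hh => hnF (Finset.mem_of_mem_erase hh)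
      have ht0 : fc N (s1 (F.erase f) + ei n).support := by
        rw [supp_add, s1_supp]; exact hcone f hf
      have e1 := cf_d hfg x
      rw [hx, cf_tt _ _ ht0, supp_add, s1_supp, Finset.sum_insert hng, add_tsub_cancel_right] at e1
      have e2 : (if s1 (F.erase f) + ei n = s1 (F.erase g) + ei n then u κ f * U else 0) =
          if g = f then u κ f * U else 0 := by
        by_cases hgf : g = f
        · subst hgf; rw [if_pos rfl, if_pos rfl]
        · rw [if_neg hgf, if_neg]
          intro hh
          have := DFunLike.congr_fun (add_right_cancel hh) g
          rw [s1_apply, s1_apply, if_pos (Finset.mem_erase.2 ⟨hgf, hg⟩), if_neg (Finset.notMem_erase _ _)] at this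
          omega
      rw [e2] at e1
      have e3 : ct κ n (cf N (s1 (F.erase g)) x) = (if g = f then u κ f * U else 0) -
          ∑ i ∈ F.erase g, ct κ i (cf N (s1 (F.erase g) + ei n - ei i) x) := by
        rw [e1]; abel
      rw [ct_comm n g, s1_erase_sub hg, e3, map_sub, neg_sub, map_sum, sub_eq_add_neg, add_comm]
      congr 1
      · by_cases hgf : g = f
        · subst hgf
          rw [if_pos rfl, if_pos rfl, ct_u_mul_self, hUF g hg, mul_zero, sub_zero]
        · rw [if_neg hgf, if_neg hgf, map_zero, neg_zero]
      · rw [← Finset.insert_erase hg, Finset.sum_insert (Finset.notMem_erase _ _), ct_ct, zero_add, Finset.insert_erase hg]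
        refine Finset.sum_congr rfl fun i hi => ?_
        congr 3
        rw [← s1_erase hi]
        rw [add_right_comm, add_tsub_cancel_right, add_tsub_cancel_right]
    rw [Finset.sum_congr rfl hY, Finset.sum_add_distrib, Finset.sum_ite_eq' F f, if_pos hf]
    have hZ : ∑ g ∈ F, ∑ i ∈ F, ct κ g (ct κ i (cf N (s1 F - ei g - ei i + ei n) x)) = 0 := by
      apply eq_zero_of_neg
      rw [← Finset.sum_neg_distrib]
      conv_lhs => rw [Finset.sum_comm]
      refine Finset.sum_congr rfl fun i _ => ?_
      rw [← Finset.sum_neg_distrib]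
      refine Finset.sum_congr rfl fun g _ => ?_
      rw [ct_comm, tsub_right_comm]
    rw [hZ, add_zero, mul_neg]
  obtain ⟨ρ, gg, hSh⟩ := Sh_of h hF f
  refine top_nonbdry (κ := κ) (N := NK) (M := cx (cKF fa F)) (F := F) (U := u κ n * U)
    ((hK F).2 ⟨F, hF, subset_rfl⟩) ?_ ?_ (acyc hSh) ?_ ⟨?_, ?_⟩ ⟨- op N Tm x, by rw [map_neg, hdy, neg_neg]⟩
  · intro t ht hFt
    obtain ⟨G, a, b⟩ := (hK t).1 ht
    have := Cmb_sub h hF a (hFt.trans b)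
    subst this
    exact Finset.Subset.antisymm b hFt
  · intro t
    rw [hKF, hK]; exact Iff.rfl
  · intro hh
    have := congrArg (ct κ n) hh
    rw [ct_u_mul_self, hUn, mul_zero, sub_zero, map_zero] at this
    exact hU0 this
  · intro g hg
    by_cases hgn : g = n
    · rw [hgn, u_u_mul]
    · rw [u_comm, hUT g (Finset.mem_compl.1 hg) hgn, mul_zero, neg_zero]
  · intro g hg
    have hgF : g ∈ F := by simpa using hg
    rw [ct_u_mul_ne (by rintro rfl; exact hnF hgF), hUF g hgF, mul_zero, neg_zero]
end KZ
namespace KZ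
open Geo SimComplex
variable {κ : Type} [Field κ] [CharZero κ]
theorem golod_cx {W : Type} [Fintype W] [DecidableEq W] (K : SimComplex W) {P : Finset W → Prop} (hP : DC P)
    (h : ∀ t, (t = ∅ ∨ t ∈ K.faces) ↔ P t) : K.IsGolod κ ↔ SS κ (cx P) := by
  refine golod_emb K (cx P) (Function.Embedding.refl W) fun t => ?_
  rw [fc_cx hP, ← h]
  simp
theorem golod_cdel {W : Type} [Fintype W] [DecidableEq W] (K : SimComplex W) {P : Finset W → Prop} (hP : DC P)
    (h : ∀ t, (t = ∅ ∨ t ∈ K.faces) ↔ P t) (v : W) :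
    (K.deleteVertex v).IsGolod κ ↔ SS κ (cx (cdel P v)) := by
  refine golod_cx _ (DC_del hP v) fun t => ?_
  rw [cdel, ← h]
  have h1 : t ∈ (K.deleteVertex v).faces ↔ t ∈ K.faces ∧ v ∉ t := by
    refine and_congr_right fun _ => ?_
    constructor
    · intro hh hv
      exact (@Finset.mem_erase _ (Classical.decEq W) _ _ _).1 (hh hv) |>.1 rfl
    · intro hh x hx
      exact (@Finset.mem_erase _ (Classical.decEq W) _ _ _).2 ⟨by rintro rfl; exact hh hx, Finset.mem_univ _⟩
  rw [h1]
  constructor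
  · rintro (rfl | ⟨a, b⟩)
    · exact ⟨Or.inl rfl, Finset.notMem_empty _⟩
    · exact ⟨Or.inr a, b⟩
  · rintro ⟨rfl | a, b⟩
    · exact Or.inl rfl
    · exact Or.inr ⟨a, b⟩
section opt
variable {V : Type} [Fintype V] [DecidableEq V]
def fo (fa : Finset V → Prop) (G : Finset (Option V)) : Prop := ∃ H, fa H ∧ G = H.map Function.Embedding.some
theorem fo_n {fa : Finset V → Prop} {G} (h : fo fa G) : none ∉ G := by
  obtain ⟨H, _, rfl⟩ := h
  simp
theorem Cmb_opt {fa : Finset V → Prop} {d} (h : Cmb fa d) : Cmb (fo fa) d := by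
  refine ⟨?_, ?_⟩
  · rintro _ ⟨H, hH, rfl⟩
    rw [Finset.card_map, h.card H hH]
  · rintro _ ⟨F0, hF0, rfl⟩
    obtain ⟨val, R, hS⟩ := h.shell F0 hF0
    refine ⟨fun G => val G.eraseNone, fun G => (R G.eraseNone).map Function.Embedding.some, ⟨?_, ?_, ?_, ?_, ?_⟩⟩
    · rintro _ ⟨G, hG, rfl⟩ _ ⟨G', hG', rfl⟩ he
      simp only [Finset.eraseNone_map_some] at he
      rw [hS.inj G hG G' hG' he]
    · rintro _ ⟨G, hG, rfl⟩ _ ⟨G', hG', rfl⟩ s h1 h2 h3 hne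
      obtain ⟨s, h2', rfl⟩ := Finset.subset_map_iff.1 h2
      simp only [Finset.eraseNone_map_some, Finset.map_subset_map] at h1 h3 ⊢
      exact hS.lt G hG G' hG' s h1 h2' h3 (by rintro rfl; exact hne rfl)
    · rintro _ ⟨G, hG, rfl⟩ s h1 h2
      obtain ⟨s, h1', rfl⟩ := Finset.subset_map_iff.1 h1
      simp only [Finset.eraseNone_map_some, Finset.map_subset_map]
      refine hS.own G hG s h1' fun G' hG' hs => ?_
      have := h2 _ ⟨G', hG', rfl⟩ (Finset.map_subset_map.2 hs)
      simpa only [Finset.eraseNone_map_some] using this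
    · simp only [Finset.eraseNone_map_some, Finset.map_subset_map]
      exact hS.R0
    · rintro _ ⟨G, hG, rfl⟩ hne
      obtain ⟨g, h1, h2⟩ := hS.R1 G hG (by rintro rfl; exact hne rfl)
      exact ⟨some g, by simpa using h1, by simpa using h2⟩
theorem cK_opt (fa : Finset V → Prop) (t : Finset (Option V)) :
    cK (fo fa) t ↔ ∃ s, cK fa s ∧ t = s.map Function.Embedding.some := by
  constructor
  · rintro ⟨_, ⟨H, hH, rfl⟩, ht⟩
    obtain ⟨s, h2, rfl⟩ := Finset.subset_map_iff.1 ht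
    exact ⟨s, ⟨H, hH, h2⟩, rfl⟩
  · rintro ⟨s, ⟨H, hH, hs⟩, rfl⟩
    exact ⟨_, ⟨H, hH, rfl⟩, Finset.map_subset_map.2 hs⟩
theorem SS_opt {P : Finset V → Prop} {P' : Finset (Option V) → Prop} (hP : DC P) (hP' : DC P')
    (h : ∀ t, P' t ↔ ∃ s, P s ∧ t = s.map Function.Embedding.some) (hS : SS κ (cx P)) : SS κ (cx P') := by
  refine (SS_emb Function.Embedding.some ?_).1 hS
  intro t
  rw [fc_cx hP', h]
  simp only [fc_cx hP]
theorem stellar_cL (K : SimComplex V) {fa : Finset V → Prop} (hK : ∀ t, (t = ∅ ∨ t ∈ K.faces) ↔ cK fa t)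
    {F : Finset V} (hF : fa F) (hFn : F.Nonempty) (t : Finset (Option V)) :
    (t = ∅ ∨ t ∈ (stellar K F).faces) ↔ cL (fo fa) (F.map Function.Embedding.some) none t := by
  have hE : (Finset.eraseNone t).map Function.Embedding.some = t.erase none := Finset.map_some_eraseNone t
  have hss : t.erase none ⊂ F.map Function.Embedding.some ↔ Finset.eraseNone t ⊂ F := by
    rw [← hE, Finset.ssubset_def, Finset.ssubset_def, Finset.map_subset_map, Finset.map_subset_map]
  constructor
  · rintro (rfl | ⟨hne, ⟨h1, h2, h3⟩ | ⟨h1, h2, h3⟩⟩)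
    · refine Or.inl ⟨⟨_, ⟨F, hF, rfl⟩, Finset.empty_subset _⟩, fun hh => ?_⟩
      exact (hFn.map (f := Function.Embedding.some)).ne_empty (Finset.subset_empty.1 hh)
    · rw [Finset.erase_eq_of_notMem h1] at hE
      refine Or.inl ⟨(cK_opt fa t).2 ⟨_, (hK _).1 (Or.inr h2), hE.symm⟩, fun hh => h3 ?_⟩
      rwa [← hE, Finset.map_subset_map] at hh
    · exact Or.inr ⟨h1, hss.2 h2⟩
  · rintro (⟨h1, h2⟩ | ⟨h1, h2⟩)
    · by_cases ht : t = ∅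
      · exact Or.inl ht
      obtain ⟨s, hs, rfl⟩ := (cK_opt fa t).1 h1
      refine Or.inr ⟨Finset.nonempty_iff_ne_empty.2 ht, Or.inl ⟨by simp, ?_, ?_⟩⟩
      · rw [Finset.eraseNone_map_some]
        refine ((hK s).2 hs).resolve_left ?_
        rintro rfl
        exact ht rfl
      · rw [Finset.eraseNone_map_some]
        intro hh
        exact h2 (Finset.map_subset_map.2 hh)
    · refine Or.inr ⟨⟨_, h1⟩, Or.inr ⟨h1, hss.1 h2, ?_⟩⟩
      exact ((hK _).2 ⟨F, hF, (hss.1 h2).subset⟩).symm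
end opt
theorem final {d : ℕ} {V : Type} [Fintype V] (Q : SimplicialPolytope d V)
    (h : Q.boundaryComplex.IsMinimallyNonGolod κ) (F : Finset V) (hF : Q.boundaryComplex.IsFacet F) :
    (stellar Q.boundaryComplex F).IsMinimallyNonGolod κ := by
  letI := Classical.decEq V
  obtain ⟨fa, hC, hK⟩ := Cmb_of Q
  change ∀ s, _ ↔ cK fa s at hK
  have hFn : F.Nonempty := Finset.nonempty_iff_ne_empty.2
    (by rintro rfl; exact Q.boundaryComplex.not_empty_mem hF.1)
  have hfF : fa F := by
    obtain ⟨G, hG, hs⟩ := (hK F).1 (Or.inr hF.1)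
    have hGf : G ∈ Q.boundaryComplex.faces := ((hK G).2 ⟨G, hG, subset_rfl⟩).resolve_left
      (hFn.mono hs).ne_empty
    rw [← hF.2 G hGf hs]; exact hG
  have hd : 2 ≤ d := by
    by_contra hd
    refine h.1 ((golod_cx _ (DC_K fa) hK).2 (SS_of_TV2 (TV_of ?_ ?_)))
    · intro t ht
      obtain ⟨G, a, b⟩ := (fc_cx (DC_K fa) t).1 ht
      have := Finset.card_le_card b
      rw [hC.card G a] at this; omega
    · intro t ht hc
      obtain ⟨G, a, b⟩ := (fc_cx (DC_K fa) t).1 ht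
      have := Finset.card_le_card b
      rw [hC.card G a] at this; omega
  have hvf : ∀ v, {v} ∈ Q.boundaryComplex.faces := by
    intro v
    refine ⟨Finset.singleton_nonempty v, {v}, ?_, Q.is_vertex v, subset_rfl⟩
    intro hh
    have := Finset.card_le_card (Finset.subset_univ F)
    rw [← hh, Finset.card_singleton, hC.card F hfF] at this
    omega
  have hv : ∀ v, ∃ G, fa G ∧ v ∈ G := by
    intro v
    obtain ⟨G, a, b⟩ := (hK {v}).1 (Or.inr (hvf v))
    exact ⟨G, a, Finset.singleton_subset_iff.1 b⟩
  have hS : ∀ v, SS κ (cx (cdel (cK fa) v)) := fun v =>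
    (golod_cdel _ (DC_K fa) hK v).1 (h.2 v (hvf v))
  have hSo : ∀ v, SS κ (cx (cdel (cK (fo fa)) (some v))) := by
    intro v
    refine SS_opt (DC_del (DC_K fa) v) (DC_del (DC_K _) _) (fun t => ?_) (hS v)
    constructor
    · rintro ⟨a, b⟩
      obtain ⟨s, hs, rfl⟩ := (cK_opt fa t).1 a
      exact ⟨s, ⟨hs, fun hh => b (by simpa using hh)⟩, rfl⟩
    · rintro ⟨s, ⟨a, b⟩, rfl⟩
      exact ⟨(cK_opt fa _).2 ⟨s, a, rfl⟩, fun hh => b (by simpa using hh)⟩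
  have hfo : fo fa (F.map Function.Embedding.some) := ⟨F, hfF, rfl⟩
  have hst := stellar_cL Q.boundaryComplex hK hfF hFn
  have hCo := Cmb_opt hC
  have hn : ∀ G, fo fa G → none ∉ G := fun G => fo_n
  refine ⟨fun hg => ?_, ?_⟩
  · exact notG hd hCo hfo hn ((golod_cx _ (DC_L hfo none) hst).1 hg)
  · rintro (_ | v) -
    · rw [golod_cdel _ (DC_L hfo none) hst none]
      have h1 : SS κ (cx (cKF (fo fa) (F.map Function.Embedding.some))) := by
        refine SS_opt (DC_KF fa F) (DC_KF _ _) (fun t => ?_) (SS_A hd hC hfF hv hS)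
        constructor
        · rintro ⟨a, b⟩
          obtain ⟨s, hs, rfl⟩ := (cK_opt fa t).1 a
          exact ⟨s, ⟨hs, fun hh => b (Finset.map_subset_map.2 hh)⟩, rfl⟩
        · rintro ⟨s, ⟨a, b⟩, rfl⟩
          exact ⟨(cK_opt fa _).2 ⟨s, a, rfl⟩, fun hh => b (Finset.map_subset_map.1 hh)⟩
      refine SS_congr (fun t => ?_) h1
      rw [fc_cx (DC_KF _ _), fc_cx (DC_del (DC_L hfo none) none)]
      constructor
      · rintro ⟨a | a, b⟩
        · exact a
        · exact absurd a.1 b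
      · rintro ⟨⟨G, a, a'⟩, b⟩
        exact ⟨Or.inl ⟨⟨G, a, a'⟩, b⟩, fun hh => hn G a (a' hh)⟩
    · rw [golod_cdel _ (DC_L hfo none) hst (some v)]
      by_cases hvF : v ∈ F
      · exact SS_B hfo (by simpa using hvF) hn (hSo v)
      · obtain ⟨G, hG, hvG⟩ := hv v
        exact SS_C hd hCo hfo (by simpa using hvF) ⟨G, hG, rfl⟩ (by simpa using hvG) hn (hSo v)
end KZ
open SimComplex in
/-- **Minimal non-Golodness is preserved by vertex truncation** (Limonchenko,
Theorem 3.13).  Let `P` be a simple polytope whose face ring `𝕜[K_P]` is minimally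
non-Golod (over a field `𝕜` of characteristic zero), where `K_P` is the boundary complex
of the dual simplicial polytope `Q`.  Then for any vertex truncation `Q' = vc(P)` of `P`
— dually, for the stellar subdivision of `K_P` at any facet `F` — the face ring
`𝕜[K_{vc(P)}]` is also minimally non-Golod. -/
theorem minimally_non_golod_vertex_cut {d : ℕ} {V : Type} [Fintype V]
    (Q : SimplicialPolytope d V)
    (𝕜 : Type) [Field 𝕜] [CharZero 𝕜]
    (h : Q.boundaryComplex.IsMinimallyNonGolod 𝕜)
    (F : Finset V) (hF : Q.boundaryComplex.IsFacet F) :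
    (stellar Q.boundaryComplex F).IsMinimallyNonGolod 𝕜 := by
  exact KZ.final Q h F hF
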